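/- Let n ≠ m with n, m ≥ 2, let Γ_0 = F_n × F_m with the union of the standard free generating sets, and let μ_0 = α_1 μ̂_1 + α_2 μ̂_2 be the mixture of the lazy simple random walks on the two factors (α_1, α_2 > 0, α_1 + α_2 = 1). Let Γ_1 = ℤ^d with d ≥ 3, equipped with a finitely supported symmetric admissible probability measure μ_1 and a finite generating set. Let Γ = Γ_0 * Γ_1 be the free product, with word metric for the union of the generating sets, and for α ∈ (0,1) let μ_α = α μ_1 + (1−α) μ_0 (a finitely supported symmetric admissible probability measure on Γ), with R_α the radius of convergence of its Green function G. Then there exists α_0 ∈ (0,1) such that for every 0 < α ≤ α_0 there exist 1 < r_* < r_♯ < R_α with: (1) for every 0 < r ≤ r_*, the Poincaré series Θ_Γ(r, ω_Γ(r)) = Σ_{x∈Γ} G(e,x|r) e^{−ω_Γ(r)|x|} diverges, and moreover ω_{Γ_0}(r) < ω_Γ(r) and ω_{Γ_1}(r) < ω_Γ(r), where ω_{Γ_i}(r) = limsup_{n→∞} (1/n) log Σ_{x ∈ Γ_i, |x| = n} G(e,x|r); (2) at r = r_♯, the series Θ_Γ(r_♯, ω_Γ(r_♯)) converges, and ω_{Γ_0}(r_♯)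 = ω_Γ(r_♯). -/

import Mathlib

open scoped Pointwise Classical
open Filter

namespace GreenGrowth

variable {G : Type*} [Group G]

/-- Word length with respect to a finite generating set `S` (symmetrized). -/
noncomputable def wordLength (S : Finset G) (x : G) : ℕ :=
  sInf {n : ℕ | x ∈ ((S : Set G) ∪ (S : Set G)⁻¹) ^ n}

/-- `n`-step distribution of the `μ`-random walk: the `n`-fold convolution power of `μ`,
so that `p_n(x, y) = convPow μ n (x⁻¹ * y)`. -/
noncomputable def convPow (μ : G → ℝ) : ℕ → G → ℝ
  | 0 => fun x => if x = 1 then 1 else 0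
  | n + 1 => fun x => ∑' y : G, μ y * convPow μ n (y⁻¹ * x)

/-- The Green function `G(e, x | r)`. -/
noncomputable def green (μ : G → ℝ) (r : ℝ) (x : G) : ℝ :=
  ∑' n : ℕ, r ^ n * convPow μ n x

/-- `μ` is a probability measure on `G`. -/
def IsProbMeasure (μ : G → ℝ) : Prop := (∀ x, 0 ≤ μ x) ∧ HasSum μ 1

/-- `μ` is admissible: its support generates `G` as a semigroup, i.e. every element of `G`
is reached with positive probability at some time. -/
def IsAdmissible (μ : G → ℝ) : Prop := ∀ x : G, ∃ n : ℕ, 0 < convPow μ n x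

/-- `μ` is symmetric. -/
def IsSymm (μ : G → ℝ) : Prop := ∀ x : G, μ x⁻¹ = μ x

/-- The spectral radius of the `μ`-random walk. -/
noncomputable def spectralRadius (μ : G → ℝ) : ℝ :=
  limsup (fun n : ℕ => (convPow μ n 1) ^ ((n : ℝ)⁻¹)) atTop

/-- `R`, the radius of convergence of the Green function: the inverse of the
spectral radius. -/
noncomputable def greenRadius (μ : G → ℝ) : ℝ := (spectralRadius μ)⁻¹

/-- The `μ`-random walk is transient at the spectral radius: the Green function
`G(x, y | r)` is finite for all `x, y` and all `0 < r ≤ R`. -/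
def TransientAtSpectralRadius (μ : G → ℝ) : Prop :=
  ∀ r : ℝ, 0 < r → r ≤ greenRadius μ →
    ∀ x : G, Summable (fun n : ℕ => r ^ n * convPow μ n x)

/-- `H_r(n) = Σ_{x ∈ S_n} G(e, x | r)`, the sum of the Green function over the sphere
of radius `n`. -/
noncomputable def greenSphereSum (S : Finset G) (μ : G → ℝ) (r : ℝ) (n : ℕ) : ℝ :=
  ∑' x : G, if wordLength S x = n then green μ r x else 0

/-- `ω_Γ(r) = limsup (1/n) log H_r(n)`, the growth rate of the Green function. -/
noncomputable def greenGrowthRate (S : Finset G) (μ : G → ℝ) (r : ℝ) : ℝ :=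
  limsup (fun n : ℕ => Real.log (greenSphereSum S μ r n) / n) atTop

/-- The cardinality of the sphere of radius `n`. -/
noncomputable def sphereCard (S : Finset G) (n : ℕ) : ℕ :=
  Nat.card {x : G // wordLength S x = n}

/-- The volume growth rate `v = limsup (1/n) log #S_n`. -/
noncomputable def volumeGrowthRate (S : Finset G) : ℝ :=
  limsup (fun n : ℕ => Real.log (sphereCard S n) / n) atTop

end GreenGrowth

namespace GreenGrowth

/-- The direct product of free groups `F_n × F_m`. -/
abbrev BiFree (n m : ℕ) := FreeGroup (Fin n) × FreeGroup (Fin m)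

/-- The lazy simple random walk on the free group `F_k`: mass `1/2` at the identity
and mass `1/(4k)` at each of the `2k` standard generators and their inverses. -/
noncomputable def lazyFreeSRW (k : ℕ) (x : FreeGroup (Fin k)) : ℝ :=
  if x = 1 then 1 / 2
  else if ∃ i : Fin k, x = FreeGroup.of i ∨ x = (FreeGroup.of i)⁻¹ then 1 / (4 * k)
  else 0

/-- The generating set of `F_n × F_m` given by the union of the standard free
generating sets of the two factors. -/
noncomputable def biFreeGens (n m : ℕ) : Finset (BiFree n m) :=
  (Finset.univ.image fun i : Fin n => ((FreeGroup.of i, 1) : BiFree n m)) ∪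
    (Finset.univ.image fun j : Fin m => ((1, FreeGroup.of j) : BiFree n m))

/-- The measure `μ₀ = α₁ μ̂₁ + α₂ μ̂₂` on `F_n × F_m`, mixture of the lazy simple
random walks on the two factors. -/
noncomputable def biFreeMu (n m : ℕ) (α₁ α₂ : ℝ) (z : BiFree n m) : ℝ :=
  α₁ * (if z.2 = 1 then lazyFreeSRW n z.1 else 0) +
    α₂ * (if z.1 = 1 then lazyFreeSRW m z.2 else 0)

end GreenGrowth

namespace GreenGrowth

/-- Pushforward of a measure along an (injective) map. -/
noncomputable def pushfwd {A B : Type*} (f : A → B) (μ : A → ℝ) (b : B) : ℝ :=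
  ∑' a : A, if f a = b then μ a else 0

/-- `ω_A(r) = limsup (1/n) log Σ_{x ∈ A, |x|=n} G(e,x|r)`. -/
noncomputable def omegaRestricted {G : Type*} [Group G] (S : Finset G) (μ : G → ℝ)
    (A : Set G) (r : ℝ) : ℝ :=
  limsup (fun n : ℕ =>
    Real.log (∑' x : G, if x ∈ A ∧ wordLength S x = n then green μ r x else 0) / n)
    atTop

/-- The free product `Γ = (F_n × F_m) ∗ ℤ^d`. -/
abbrev FreeProdGroup (n m d : ℕ) := Monoid.Coprod (BiFree n m) (Multiplicative (Fin d → ℤ))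

/-- The generating set of `Γ = (F_n × F_m) ∗ ℤ^d`: the union of the generating sets
of the two free factors. -/
noncomputable def freeProdGens (n m d : ℕ) (S₁ : Finset (Multiplicative (Fin d → ℤ))) :
    Finset (FreeProdGroup n m d) :=
  ((biFreeGens n m).image fun x => (Monoid.Coprod.inl x : FreeProdGroup n m d)) ∪
    (S₁.image fun x => (Monoid.Coprod.inr x : FreeProdGroup n m d))

/-- The measure `μ_α = α μ₁ + (1−α) μ₀` on `Γ = (F_n × F_m) ∗ ℤ^d`. -/
noncomputable def freeProdMu (n m d : ℕ) (α₁ α₂ : ℝ)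
    (μ₁ : Multiplicative (Fin d → ℤ) → ℝ) (α : ℝ) (g : FreeProdGroup n m d) : ℝ :=
  α * pushfwd (fun x => (Monoid.Coprod.inr x : FreeProdGroup n m d)) μ₁ g +
    (1 - α) * pushfwd (fun x => (Monoid.Coprod.inl x : FreeProdGroup n m d))
      (biFreeMu n m α₁ α₂) g

section

section Convolution

variable {G : Type*} [Group G]

/-- Left convolution by `μ`, so that `convPow μ (n + 1) = lconv μ (convPow μ n)`. -/
noncomputable def lconv (μ f : G → ℝ) (x : G) : ℝ := ∑' y : G, μ y * f (y⁻¹ * x)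

/-- A nonnegative, finitely supported measure. -/
structure IsFinMeasure (μ : G → ℝ) : Prop where
  nonneg : ∀ x, 0 ≤ μ x
  finite : (Function.support μ).Finite

/-- The Green function at `r` is finite everywhere. -/
def GreenFinite (μ : G → ℝ) (r : ℝ) : Prop :=
  ∀ x : G, Summable (fun n : ℕ => r ^ n * convPow μ n x)

variable {μ : G → ℝ}

lemma lconv_eq_sum (hμ : (Function.support μ).Finite) (f : G → ℝ) (x : G) :
    lconv μ f x = ∑ y ∈ hμ.toFinset, μ y * f (y⁻¹ * x) := by
  refine tsum_eq_sum fun y hy => ?_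
  have : μ y = 0 := by simpa using hy
  simp [this]

lemma lconv_mono (hμ : IsFinMeasure μ) {f g : G → ℝ} (h : ∀ x, f x ≤ g x) (x : G) :
    lconv μ f x ≤ lconv μ g x := by
  rw [lconv_eq_sum hμ.finite, lconv_eq_sum hμ.finite]
  exact Finset.sum_le_sum fun y _ => mul_le_mul_of_nonneg_left (h _) (hμ.nonneg y)

lemma lconv_nonneg (hμ : IsFinMeasure μ) {f : G → ℝ} (h : ∀ x, 0 ≤ f x) (x : G) :
    0 ≤ lconv μ f x := tsum_nonneg fun y => mul_nonneg (hμ.nonneg y) (h _)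

lemma lconv_const_mul (μ : G → ℝ) (c : ℝ) (f : G → ℝ) (x : G) :
    lconv μ (fun z => c * f z) x = c * lconv μ f x := by
  unfold lconv
  rw [← tsum_mul_left]
  exact tsum_congr fun y => by ring

lemma lconv_mul_const (μ : G → ℝ) (c : ℝ) (f : G → ℝ) (x : G) :
    lconv μ (fun z => f z * c) x = lconv μ f x * c := by
  rw [mul_comm, ← lconv_const_mul]
  simp only [mul_comm]

lemma lconv_sub (hμ : IsFinMeasure μ) (f g : G → ℝ) (x : G) :
    lconv μ (fun z => f z - g z) x = lconv μ f x - lconv μ g x := by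
  simp only [lconv_eq_sum hμ.finite, mul_sub, Finset.sum_sub_distrib]

lemma lconv_finset_sum (hμ : IsFinMeasure μ) {ι : Type*} (s : Finset ι) (f : ι → G → ℝ) (x : G) :
    lconv μ (fun z => ∑ i ∈ s, f i z) x = ∑ i ∈ s, lconv μ (f i) x := by
  simp only [lconv_eq_sum hμ.finite, Finset.mul_sum]
  exact Finset.sum_comm

lemma lconv_tsum (hμ : IsFinMeasure μ) {f : ℕ → G → ℝ} (hf : ∀ x, Summable fun n => f n x)
    (x : G) : lconv μ (fun z => ∑' n, f n z) x = ∑' n, lconv μ (f n) x := by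
  simp only [lconv_eq_sum hμ.finite, ← tsum_mul_left]
  exact (Summable.tsum_finsetSum fun y _ => (hf _).mul_left _).symm

lemma lconv_translate (μ f : G → ℝ) (x w : G) :
    lconv μ (fun z => f (z * w)) x = lconv μ f (x * w) := by
  simp only [lconv, mul_assoc]

lemma convPow_eq_iterate (μ : G → ℝ) (n : ℕ) :
    convPow μ n = (lconv μ)^[n] (fun x => if x = 1 then 1 else 0) := by
  induction n with
  | zero => rfl
  | succ n ih => rw [Function.iterate_succ_apply', ← ih]; rfl

lemma iterate_lconv_nonneg (hμ : IsFinMeasure μ) {f : G → ℝ} (h : ∀ x, 0 ≤ f x) (n : ℕ) (x : G) :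
    0 ≤ (lconv μ)^[n] f x := by
  induction n generalizing x with
  | zero => exact h x
  | succ n ih => rw [Function.iterate_succ_apply']; exact lconv_nonneg hμ ih x

lemma convPow_nonneg (hμ : IsFinMeasure μ) (n : ℕ) (x : G) : 0 ≤ convPow μ n x := by
  rw [convPow_eq_iterate]
  exact iterate_lconv_nonneg hμ (fun x => by split_ifs <;> norm_num) n x

/-- A nonnegative supersolution of `W = f + r μ * W` dominates the Neumann series of `f`. -/
lemma neumann_le (hμ : IsFinMeasure μ) {r : ℝ} (hr : 0 ≤ r) {f W : G → ℝ} (hW : ∀ x, 0 ≤ W x)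
    (h : ∀ x, f x + r * lconv μ W x ≤ W x) (N : ℕ) (x : G) :
    ∑ n ∈ Finset.range N, r ^ n * (lconv μ)^[n] f x ≤ W x := by
  induction N generalizing x with
  | zero => simpa using hW x
  | succ N ih =>
    rw [Finset.sum_range_succ']
    have h1 : ∑ n ∈ Finset.range N, r ^ (n + 1) * (lconv μ)^[n + 1] f x
        = r * lconv μ (fun z => ∑ n ∈ Finset.range N, r ^ n * (lconv μ)^[n] f z) x := by
      rw [lconv_finset_sum hμ, Finset.mul_sum]
      refine Finset.sum_congr rfl fun n _ => ?_
      rw [lconv_const_mul, Function.iterate_succ_apply']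
      ring
    rw [h1]
    have h2 := mul_le_mul_of_nonneg_left (lconv_mono hμ ih x) hr
    have h3 := h x
    simp only [pow_zero, one_mul, Function.iterate_zero, id]
    linarith

lemma neumann_summable (hμ : IsFinMeasure μ) {r : ℝ} (hr : 0 ≤ r) {f W : G → ℝ}
    (hf : ∀ x, 0 ≤ f x) (hW : ∀ x, 0 ≤ W x)
    (h : ∀ x, f x + r * lconv μ W x ≤ W x) (x : G) :
    Summable (fun n : ℕ => r ^ n * (lconv μ)^[n] f x) ∧
      ∑' n : ℕ, r ^ n * (lconv μ)^[n] f x ≤ W x := by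
  have h0 : ∀ n : ℕ, 0 ≤ r ^ n * (lconv μ)^[n] f x := fun n =>
    mul_nonneg (pow_nonneg hr n) (iterate_lconv_nonneg hμ hf n x)
  have hs := summable_of_sum_range_le h0 (fun N => neumann_le hμ hr hW h N x)
  exact ⟨hs, hs.tsum_le_of_sum_range_le fun N => neumann_le hμ hr hW h N x⟩

lemma green_le_of_supersolution (hμ : IsFinMeasure μ) {r : ℝ} (hr : 0 ≤ r) {W : G → ℝ}
    (hW : ∀ x, 0 ≤ W x) (h : ∀ x, (if x = 1 then 1 else 0) + r * lconv μ W x ≤ W x) :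
    GreenFinite μ r ∧ ∀ x, green μ r x ≤ W x := by
  have h0 : ∀ x : G, (0 : ℝ) ≤ if x = 1 then 1 else 0 := fun x => by split_ifs <;> norm_num
  have := neumann_summable hμ hr h0 hW h
  simp only [← convPow_eq_iterate] at this
  exact ⟨fun x => (this x).1, fun x => (this x).2⟩

lemma green_nonneg (hμ : IsFinMeasure μ) {r : ℝ} (hr : 0 ≤ r) (x : G) : 0 ≤ green μ r x :=
  tsum_nonneg fun n => mul_nonneg (pow_nonneg hr n) (convPow_nonneg hμ n x)

lemma green_eq (hμ : IsFinMeasure μ) {r : ℝ} (hG : GreenFinite μ r) (x : G) :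
    green μ r x = (if x = 1 then 1 else 0) + r * lconv μ (green μ r) x := by
  have h1 : lconv μ (green μ r) x = ∑' n, lconv μ (fun z => r ^ n * convPow μ n z) x :=
    lconv_tsum hμ hG x
  rw [h1, ← tsum_mul_left, green, (hG x).tsum_eq_zero_add]
  congr 1
  · simp [convPow]
  · refine tsum_congr fun n => ?_
    rw [lconv_const_mul]
    change r ^ (n + 1) * lconv μ (convPow μ n) x = _
    ring

lemma one_le_green_one (hμ : IsFinMeasure μ) {r : ℝ} (hr : 0 ≤ r) (hG : GreenFinite μ r) :
    1 ≤ green μ r 1 := by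
  rw [green_eq hμ hG 1]
  simpa using mul_nonneg hr (lconv_nonneg hμ (green_nonneg hμ hr) 1)

lemma green_pos (hμ : IsFinMeasure μ) {r : ℝ} (hr : 0 < r) (hG : GreenFinite μ r) {x : G}
    (h : ∃ n, 0 < convPow μ n x) : 0 < green μ r x := by
  obtain ⟨n, hn⟩ := h
  exact (hG x).tsum_pos (fun k => mul_nonneg (pow_nonneg hr.le k) (convPow_nonneg hμ k x)) n
    (mul_pos (pow_pos hr n) hn)

lemma GreenFinite.mono (hμ : IsFinMeasure μ) {r r' : ℝ} (hr : 0 ≤ r) (hrr' : r ≤ r')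
    (hG : GreenFinite μ r') : GreenFinite μ r := fun x =>
  (hG x).of_nonneg_of_le (fun n => mul_nonneg (pow_nonneg hr n) (convPow_nonneg hμ n x))
    fun n => mul_le_mul_of_nonneg_right (pow_le_pow_left₀ hr hrr' n) (convPow_nonneg hμ n x)

lemma green_mono (hμ : IsFinMeasure μ) {r r' : ℝ} (hr : 0 ≤ r) (hrr' : r ≤ r')
    (hG : GreenFinite μ r') (x : G) : green μ r x ≤ green μ r' x :=
  (hG.mono hμ hr hrr' x).tsum_le_tsum
    (fun n => mul_le_mul_of_nonneg_right (pow_le_pow_left₀ hr hrr' n) (convPow_nonneg hμ n x))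
    (hG x)

lemma continuousOn_green (hμ : IsFinMeasure μ) {b : ℝ} (hG : GreenFinite μ b) (x : G) :
    ContinuousOn (fun r => green μ r x) (Set.Icc 0 b) := by
  refine continuousOn_tsum (u := fun n => b ^ n * convPow μ n x) (fun n => by fun_prop) (hG x) ?_
  intro n r hr
  rw [Real.norm_of_nonneg (mul_nonneg (pow_nonneg hr.1 n) (convPow_nonneg hμ n x))]
  exact mul_le_mul_of_nonneg_right (pow_le_pow_left₀ hr.1 hr.2 n) (convPow_nonneg hμ n x)

/-- The normalized Green function `F(e, x | r) = G(e, x | r) / G(e, e | r)`. -/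
noncomputable def hitting (μ : G → ℝ) (r : ℝ) (x : G) : ℝ := green μ r x / green μ r 1

lemma hitting_one (hμ : IsFinMeasure μ) {r : ℝ} (hr : 0 ≤ r) (hG : GreenFinite μ r) :
    hitting μ r 1 = 1 :=
  div_self (zero_lt_one.trans_le (one_le_green_one hμ hr hG)).ne'

lemma hitting_nonneg (hμ : IsFinMeasure μ) {r : ℝ} (hr : 0 ≤ r) (x : G) : 0 ≤ hitting μ r x :=
  div_nonneg (green_nonneg hμ hr x) (green_nonneg hμ hr 1)

lemma lconv_hitting (hμ : IsFinMeasure μ) {r : ℝ} (hr : 0 < r) (hG : GreenFinite μ r) (x : G) :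
    lconv μ (hitting μ r) x = (hitting μ r x - (if x = 1 then (green μ r 1)⁻¹ else 0)) / r := by
  have h : lconv μ (hitting μ r) x = lconv μ (green μ r) x * (green μ r 1)⁻¹ :=
    lconv_mul_const μ _ _ x
  have h2 := green_eq hμ hG x
  have h3 : green μ r 1 ≠ 0 := (zero_lt_one.trans_le (one_le_green_one hμ hr.le hG)).ne'
  rw [h, eq_div_iff hr.ne', hitting, h2]
  split_ifs <;> field_simp <;> ring

/-- Domination principle: `hitting μ r` is the smallest nonnegative function which is at least `1`
at the identity and `r`-superharmonic elsewhere. -/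
lemma hitting_le (hμ : IsFinMeasure μ) {r : ℝ} (hr : 0 < r) (hG : GreenFinite μ r) {h : G → ℝ}
    (h0 : ∀ x, 0 ≤ h x) (h1 : 1 ≤ h 1) (hh : ∀ x, x ≠ 1 → r * lconv μ h x ≤ h x) (x : G) :
    hitting μ r x ≤ h x := by
  have hpos : 0 < green μ r 1 := zero_lt_one.trans_le (one_le_green_one hμ hr.le hG)
  have hF := lconv_hitting hμ hr hG
  set F := hitting μ r with hFdef
  have hF1 : F 1 = 1 := hitting_one hμ hr.le hG
  set g : G → ℝ := fun x => min (h x) (F x) with hg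
  have key := (green_le_of_supersolution hμ hr.le (W := fun x => green μ r 1 * g x)
    (fun x => mul_nonneg hpos.le (le_min (h0 x) (hitting_nonneg hμ hr.le x))) ?_).2 x
  · have h2 : green μ r x = green μ r 1 * F x := by
      rw [hFdef, hitting]; field_simp
    rw [h2] at key
    exact (le_of_mul_le_mul_left key hpos).trans (min_le_left _ _)
  · intro z
    rw [lconv_const_mul]
    have hgF : r * lconv μ g z ≤ F z - (if z = 1 then (green μ r 1)⁻¹ else 0) := by
      refine (mul_le_mul_of_nonneg_left
        (lconv_mono hμ (g := F) (fun x => min_le_right _ _) z) hr.le).trans_eq ?_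
      rw [hF]; field_simp
    by_cases hz : z = 1
    · subst hz
      have : g 1 = 1 := by simp only [hg, hF1]; exact min_eq_right h1
      rw [this]
      simp only [if_true, hF1] at hgF ⊢
      have := mul_le_mul_of_nonneg_left hgF hpos.le
      rw [mul_sub, mul_inv_cancel₀ hpos.ne'] at this
      linarith
    · simp only [hz, if_false] at hgF ⊢
      have hgh : r * lconv μ g z ≤ h z := (mul_le_mul_of_nonneg_left
        (lconv_mono hμ (g := h) (fun x => min_le_left _ _) z) hr.le).trans (hh z hz)
      have : r * lconv μ g z ≤ g z := le_min hgh (by linarith)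
      have := mul_le_mul_of_nonneg_left this hpos.le
      linarith

lemma mul_lconv_hitting_le (hμ : IsFinMeasure μ) {r : ℝ} (hr : 0 < r) (hG : GreenFinite μ r)
    (x : G) : r * lconv μ (hitting μ r) x ≤ hitting μ r x := by
  rw [lconv_hitting hμ hr hG, mul_div_cancel₀ _ hr.ne']
  have : 0 ≤ (green μ r 1)⁻¹ := inv_nonneg.2 (green_nonneg hμ hr.le 1)
  split_ifs <;> linarith

lemma hitting_mono (hμ : IsFinMeasure μ) {r r' : ℝ} (hr : 0 < r) (hrr' : r ≤ r')
    (hG : GreenFinite μ r') (x : G) : hitting μ r x ≤ hitting μ r' x := by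
  have hr' := hr.trans_le hrr'
  refine hitting_le hμ hr (hG.mono hμ hr.le hrr') (hitting_nonneg hμ hr'.le)
    (hitting_one hμ hr'.le hG).ge (fun z _ => ?_) x
  exact (mul_le_mul_of_nonneg_right hrr' (lconv_nonneg hμ (hitting_nonneg hμ hr'.le) z)).trans
    (mul_lconv_hitting_le hμ hr' hG z)

lemma hitting_mul_le (hμ : IsFinMeasure μ) {r : ℝ} (hr : 0 < r) (hG : GreenFinite μ r)
    (x y : G) : hitting μ r x * hitting μ r y ≤ hitting μ r (x * y) := by
  rcases (hitting_nonneg hμ hr.le y).eq_or_lt with h | h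
  · rw [← h, mul_zero]; exact hitting_nonneg hμ hr.le _
  rw [← le_div_iff₀ h]
  refine hitting_le hμ hr hG (h := fun x => hitting μ r (x * y) / hitting μ r y)
    (fun z => div_nonneg (hitting_nonneg hμ hr.le _) h.le) ?_ (fun z _ => ?_) x
  · simp [h.ne']
  · simp only [div_eq_mul_inv]
    rw [lconv_mul_const μ _ (fun z => hitting μ r (z * y)), lconv_translate, ← mul_assoc]
    exact mul_le_mul_of_nonneg_right (mul_lconv_hitting_le hμ hr hG _) (inv_nonneg.2 h.le)

/-- Uniqueness: a positive solution dominated by a function on which `μ` contracts is the Green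
function. -/
lemma green_eq_of_solution (hμ : IsFinMeasure μ) {r : ℝ} (hr : 0 < r) {Φ Ψ : G → ℝ} {C θ : ℝ}
    (hΦ0 : ∀ x, 0 ≤ Φ x) (hΦ : ∀ x, Φ x = (if x = 1 then 1 else 0) + r * lconv μ Φ x)
    (hC : 0 ≤ C) (hΦΨ : ∀ x, Φ x ≤ C * Ψ x) (hθ : 0 ≤ θ) (hθ1 : θ < 1)
    (hΨ : ∀ x, r * lconv μ Ψ x ≤ θ * Ψ x) :
    GreenFinite μ r ∧ ∀ x, green μ r x = Φ x := by
  obtain ⟨hG, hle⟩ := green_le_of_supersolution hμ hr.le hΦ0 (fun x => (hΦ x).ge)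
  refine ⟨hG, fun x => le_antisymm (hle x) ?_⟩
  have hbound : ∀ n : ℕ, ∀ x, Φ x - green μ r x ≤ C * θ ^ n * Ψ x := by
    intro n
    induction n with
    | zero =>
      intro x
      have := green_nonneg hμ hr.le x
      have := hΦΨ x
      simp only [pow_zero, mul_one]
      linarith
    | succ n ih =>
      intro x
      have h1 : Φ x - green μ r x = r * lconv μ (fun z => Φ z - green μ r z) x := by
        rw [lconv_sub hμ, hΦ x, green_eq hμ hG x]
        ring
      rw [h1]
      have h2 := mul_le_mul_of_nonneg_left (lconv_mono hμ ih x) hr.le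
      rw [lconv_const_mul μ (C * θ ^ n)] at h2
      have h3 := mul_le_mul_of_nonneg_left (hΨ x) (mul_nonneg hC (pow_nonneg hθ n))
      rw [pow_succ]
      linarith
  have hlim : Tendsto (fun n : ℕ => C * θ ^ n * Ψ x) atTop (nhds 0) := by
    simpa using ((tendsto_pow_atTop_nhds_zero_of_lt_one hθ hθ1).const_mul C).mul_const (Ψ x)
  have := ge_of_tendsto' hlim (fun n => hbound n x)
  linarith

lemma convPow_le (hμ : IsFinMeasure μ) {t C : ℝ} (ht : 0 ≤ t) {Ψ : G → ℝ}
    (hC : 0 ≤ C) (hδ : ∀ x : G, (if x = 1 then 1 else 0) ≤ C * Ψ x)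
    (hΨ : ∀ x, lconv μ Ψ x ≤ t * Ψ x) (n : ℕ) (x : G) :
    convPow μ n x ≤ C * t ^ n * Ψ x := by
  induction n generalizing x with
  | zero => simpa [convPow] using hδ x
  | succ n ih =>
    have h := lconv_mono hμ ih x
    rw [lconv_const_mul μ (C * t ^ n)] at h
    have h3 := mul_le_mul_of_nonneg_left (hΨ x) (mul_nonneg hC (pow_nonneg ht n))
    rw [pow_succ]
    change lconv μ (convPow μ n) x ≤ _
    linarith

/-- Lower and upper bounds on the inverse spectral radius. -/
lemma le_greenRadius (hμ : IsFinMeasure μ) {t C : ℝ} (ht : 0 < t) {Ψ : G → ℝ}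
    (hC : 0 ≤ C) (hδ : ∀ x : G, (if x = 1 then 1 else 0) ≤ C * Ψ x)
    (hΨ : ∀ x, lconv μ Ψ x ≤ t * Ψ x) (h1 : 0 < μ 1) : t⁻¹ ≤ greenRadius μ := by
  have hlow : ∀ n, μ 1 ^ n ≤ convPow μ n 1 := by
    intro n
    induction n with
    | zero => simp [convPow]
    | succ n ih =>
      rw [pow_succ']
      refine (mul_le_mul_of_nonneg_left ih h1.le).trans ?_
      change _ ≤ lconv μ (convPow μ n) 1
      rw [lconv_eq_sum hμ.finite]
      have := Finset.single_le_sum (f := fun y => μ y * convPow μ n (y⁻¹ * 1))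
        (s := hμ.finite.toFinset) (fun y _ => mul_nonneg (hμ.nonneg y) (convPow_nonneg hμ n _))
        (a := 1) (by simpa using h1.ne')
      simpa using this
  set K := max 1 (C * Ψ 1) with hK
  have hK1 : 1 ≤ K := le_max_left _ _
  have hup : ∀ n : ℕ, convPow μ n 1 ≤ K * t ^ n := fun n =>
    (convPow_le hμ ht.le hC hδ hΨ n 1).trans (by
      rw [mul_right_comm]
      exact mul_le_mul_of_nonneg_right (le_max_right _ _) (pow_nonneg ht.le n))
  have hup' : ∀ᶠ n : ℕ in atTop, (convPow μ n 1) ^ ((n : ℝ)⁻¹) ≤ K ^ ((n : ℝ)⁻¹) * t := by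
    filter_upwards [eventually_gt_atTop 0] with n hn
    have h := Real.rpow_le_rpow (convPow_nonneg hμ n 1) (hup n) (inv_nonneg.2 n.cast_nonneg)
    rwa [Real.mul_rpow (by linarith) (pow_nonneg ht.le n),
      Real.pow_rpow_inv_natCast ht.le hn.ne'] at h
  have hlow' : ∀ᶠ n : ℕ in atTop, μ 1 ≤ (convPow μ n 1) ^ ((n : ℝ)⁻¹) := by
    filter_upwards [eventually_gt_atTop 0] with n hn
    have h := Real.rpow_le_rpow (pow_nonneg h1.le n) (hlow n) (inv_nonneg.2 n.cast_nonneg)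
    rwa [Real.pow_rpow_inv_natCast h1.le hn.ne'] at h
  have hlim : Tendsto (fun n : ℕ => K ^ ((n : ℝ)⁻¹) * t) atTop (nhds t) := by
    have h0 : Tendsto (fun n : ℕ => ((n : ℝ)⁻¹)) atTop (nhds 0) :=
      tendsto_inv_atTop_zero.comp tendsto_natCast_atTop_atTop
    have h2 := (Real.continuousAt_const_rpow (a := K) (b := 0) (by linarith)).tendsto.comp h0
    simpa using h2.mul_const t
  have hcob : IsCoboundedUnder (· ≤ ·) atTop (fun n : ℕ => (convPow μ n 1) ^ ((n : ℝ)⁻¹)) :=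
    IsBoundedUnder.isCoboundedUnder_le ⟨μ 1, by simpa using hlow'⟩
  have hbdd : IsBoundedUnder (· ≤ ·) atTop (fun n : ℕ => (convPow μ n 1) ^ ((n : ℝ)⁻¹)) :=
    hlim.isBoundedUnder_le.mono_le hup'
  have hle : spectralRadius μ ≤ t := by
    rw [← hlim.limsup_eq]
    exact limsup_le_limsup hup' hcob hlim.isBoundedUnder_le
  have hge : μ 1 ≤ spectralRadius μ := le_limsup_of_frequently_le hlow'.frequently hbdd
  exact inv_anti₀ (h1.trans_le hge) hle

end Convolution

end

section

section Length

variable {G : Type*} [Group G]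

/-- `ℓ` is the word length for the finite set `S`, characterized by its behaviour under left
multiplication by generators. -/
structure IsLength (S : Finset G) (ℓ : G → ℕ) : Prop where
  one : ℓ 1 = 0
  le_succ : ∀ s ∈ (S : Set G) ∪ (S : Set G)⁻¹, ∀ x, ℓ (s * x) ≤ ℓ x + 1
  exists_decr : ∀ x, x ≠ 1 → ∃ s ∈ (S : Set G) ∪ (S : Set G)⁻¹, ∃ y, x = s * y ∧ ℓ y + 1 ≤ ℓ x

variable {S : Finset G} {ℓ : G → ℕ}

lemma IsLength.eq_one (h : IsLength S ℓ) {x : G} (hx : ℓ x = 0) : x = 1 := by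
  by_contra hne
  obtain ⟨s, -, y, -, hy⟩ := h.exists_decr x hne
  omega

lemma IsLength.pos (h : IsLength S ℓ) {x : G} (hx : x ≠ 1) : 1 ≤ ℓ x :=
  Nat.one_le_iff_ne_zero.2 fun h0 => hx (h.eq_one h0)

lemma IsLength.mem_pow (h : IsLength S ℓ) (x : G) :
    x ∈ ((S : Set G) ∪ (S : Set G)⁻¹) ^ ℓ x := by
  generalize hn : ℓ x = n
  induction n generalizing x with
  | zero => simp [h.eq_one hn]
  | succ n ih =>
    have hne : x ≠ 1 := by rintro rfl; simp [h.one] at hn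
    obtain ⟨s, hs, y, rfl, hy⟩ := h.exists_decr x hne
    have := h.le_succ s hs y
    rw [pow_succ']
    exact Set.mul_mem_mul hs (ih y (by omega))

lemma IsLength.mul_le_of_mem (h : IsLength S ℓ) {n : ℕ} {x : G}
    (hx : x ∈ ((S : Set G) ∪ (S : Set G)⁻¹) ^ n) (y : G) : ℓ (x * y) ≤ n + ℓ y := by
  induction n generalizing x with
  | zero => simp_all
  | succ n ih =>
    rw [pow_succ'] at hx
    obtain ⟨s, hs, z, hz, rfl⟩ := Set.mem_mul.1 hx
    have h1 := ih hz
    have h2 := h.le_succ s hs (z * y)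
    rw [mul_assoc]
    omega

lemma IsLength.mul_le (h : IsLength S ℓ) (x y : G) : ℓ (x * y) ≤ ℓ x + ℓ y :=
  h.mul_le_of_mem (h.mem_pow x) y

lemma IsLength.inv_le (h : IsLength S ℓ) (x : G) : ℓ x⁻¹ ≤ ℓ x := by
  have h1 : x⁻¹ ∈ ((S : Set G) ∪ (S : Set G)⁻¹) ^ ℓ x := by
    have := Set.inv_mem_inv.2 (h.mem_pow x)
    rwa [← inv_pow, Set.union_inv, inv_inv, Set.union_comm] at this
  simpa [h.one] using h.mul_le_of_mem h1 1

lemma IsLength.inv (h : IsLength S ℓ) (x : G) : ℓ x⁻¹ = ℓ x :=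
  (h.inv_le x).antisymm (by simpa using h.inv_le x⁻¹)

lemma IsLength.wordLength_eq (h : IsLength S ℓ) : wordLength S = ℓ := by
  funext x
  refine le_antisymm (Nat.sInf_le (h.mem_pow x)) ?_
  refine le_csInf ⟨_, h.mem_pow x⟩ fun n hn => ?_
  simpa [h.one] using h.mul_le_of_mem hn 1

lemma IsLength.finite_sphere (h : IsLength S ℓ) (n : ℕ) : {x | ℓ x = n}.Finite := by
  refine Set.Finite.subset (s := ((S : Set G) ∪ (S : Set G)⁻¹) ^ n) ?_ ?_
  · have hT := S.finite_toSet.union S.finite_toSet.inv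
    induction n with
    | zero => simp
    | succ k ih => rw [pow_succ]; exact ih.mul hT
  · rintro x rfl
    exact h.mem_pow x

lemma IsLength.exists_eq [Infinite G] (h : IsLength S ℓ) (n : ℕ) : ∃ x, ℓ x = n := by
  have h1 : ∃ x, n ≤ ℓ x := by
    by_contra! hc
    refine Set.infinite_univ (α := G) (Set.Finite.subset
      ((Set.finite_lt_nat n).biUnion fun k _ => h.finite_sphere k) fun x _ => ?_)
    simpa using hc x
  obtain ⟨x, hx⟩ := h1
  generalize hk : ℓ x = k at hx
  induction k generalizing x with
  | zero => exact ⟨x, by omega⟩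
  | succ k ih =>
    rcases hx.eq_or_lt with h2 | h2
    · exact ⟨x, by omega⟩
    · have hne : x ≠ 1 := by rintro rfl; simp [h.one] at hk
      obtain ⟨s, hs, y, rfl, hy⟩ := h.exists_decr x hne
      have := h.le_succ s hs y
      exact ih y (by omega) (by omega)

lemma isLength_wordLength (hS : Subgroup.closure (S : Set G) = ⊤) :
    IsLength S (wordLength S) := by
  set T := (S : Set G) ∪ (S : Set G)⁻¹ with hT
  have hex : ∀ x : G, ∃ n : ℕ, x ∈ T ^ n := by
    intro x
    have hx : x ∈ Submonoid.closure T := by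
      rw [← Subgroup.closure_toSubmonoid, hS]; trivial
    induction hx using Submonoid.closure_induction with
    | mem x hx => exact ⟨1, by simpa using hx⟩
    | one => exact ⟨0, by simp⟩
    | mul x y _ _ hx hy =>
      obtain ⟨a, ha⟩ := hx
      obtain ⟨b, hb⟩ := hy
      exact ⟨a + b, by rw [pow_add]; exact Set.mul_mem_mul ha hb⟩
  have hmem : ∀ x : G, x ∈ T ^ wordLength S x := fun x => Nat.sInf_mem (hex x)
  refine ⟨?_, fun s hs x => ?_, fun x hx => ?_⟩
  · exact Nat.eq_zero_of_le_zero (Nat.sInf_le (by simp))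
  · refine Nat.sInf_le ?_
    change s * x ∈ T ^ (wordLength S x + 1)
    rw [pow_succ']
    exact Set.mul_mem_mul hs (hmem x)
  · have hm := hmem x
    cases hn : wordLength S x with
    | zero => rw [hn] at hm; exact absurd (by simpa using hm) hx
    | succ n =>
      rw [hn, pow_succ'] at hm
      obtain ⟨s, hs, z, hz, rfl⟩ := Set.mem_mul.1 hm
      exact ⟨s, hs, z, rfl, Nat.succ_le_succ (Nat.sInf_le hz)⟩

end Length

section Poincare

lemma summable_iff_tsum_ofReal_ne_top {X : Type*} {f : X → ℝ} (hf : ∀ x, 0 ≤ f x) :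
    Summable f ↔ ∑' x, ENNReal.ofReal (f x) ≠ ⊤ := by
  refine ⟨fun h => h.tsum_ofReal_ne_top, fun h => ?_⟩
  have := ENNReal.summable_toReal h
  simpa only [ENNReal.toReal_ofReal (hf _)] using this

/-- The Poincaré series `Σ g(x) e^{-s ℓ(x)}` as an extended nonnegative real. -/
noncomputable def poincare {X : Type*} (ℓ : X → ℕ) (g : X → ℝ) (s : ℝ) : ENNReal :=
  ∑' x, ENNReal.ofReal (g x * Real.exp (-(s * ℓ x)))

/-- The sum of `g` over the sphere of radius `n`. -/
noncomputable def sphereSum {X : Type*} (ℓ : X → ℕ) (g : X → ℝ) (n : ℕ) : ℝ :=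
  ∑' x, if ℓ x = n then g x else 0

variable {X : Type*} {ℓ : X → ℕ} {g : X → ℝ}

lemma summable_sphere (hfin : ∀ n, {x | ℓ x = n}.Finite) (n : ℕ) :
    Summable (fun x => if ℓ x = n then g x else 0) :=
  summable_of_hasFiniteSupport ((hfin n).subset fun x hx => by
    by_contra h
    exact hx (if_neg h))

lemma sphereSum_nonneg (hg : ∀ x, 0 ≤ g x) (n : ℕ) : 0 ≤ sphereSum ℓ g n :=
  tsum_nonneg fun x => by split_ifs <;> simp [hg]

lemma poincare_eq_tsum_sphereSum (hfin : ∀ n, {x | ℓ x = n}.Finite) (hg : ∀ x, 0 ≤ g x) (s : ℝ) :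
    poincare ℓ g s = ∑' n : ℕ, ENNReal.ofReal (sphereSum ℓ g n * Real.exp (-(s * n))) := by
  have h1 : ∀ n : ℕ, ENNReal.ofReal (sphereSum ℓ g n * Real.exp (-(s * n)))
      = ∑' x, if ℓ x = n then ENNReal.ofReal (g x * Real.exp (-(s * ℓ x))) else 0 := by
    intro n
    rw [sphereSum, ← tsum_mul_right, ENNReal.ofReal_tsum_of_nonneg
      (fun x => mul_nonneg (by split_ifs <;> simp [hg]) (Real.exp_pos _).le)
      ((summable_sphere hfin n).mul_right _)]
    refine tsum_congr fun x => ?_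
    by_cases h : ℓ x = n <;> simp [h]
  simp only [h1]
  rw [ENNReal.tsum_comm]
  refine tsum_congr fun x => ?_
  rw [tsum_eq_single (ℓ x) (fun n hn => if_neg hn.symm), if_pos rfl]

lemma poincare_anti (hg : ∀ x, 0 ≤ g x) {s t : ℝ} (h : s ≤ t) :
    poincare ℓ g t ≤ poincare ℓ g s := by
  refine ENNReal.tsum_le_tsum fun x => ENNReal.ofReal_le_ofReal
    (mul_le_mul_of_nonneg_left (Real.exp_le_exp.2 ?_) (hg x))
  have := mul_le_mul_of_nonneg_right h (Nat.cast_nonneg (α := ℝ) (ℓ x))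
  linarith

lemma limsup_le_of_poincare_ne_top (hfin : ∀ n, {x | ℓ x = n}.Finite) (hg : ∀ x, 0 ≤ g x)
    {K c : ℝ} (hK : 0 < K) (hc : 0 < c) (hlow : ∀ n, ∃ x, ℓ x = n ∧ K * c ^ n ≤ g x)
    {s : ℝ} (hs : poincare ℓ g s ≠ ⊤) :
    limsup (fun n : ℕ => Real.log (sphereSum ℓ g n) / n) atTop ≤ s := by
  rw [poincare_eq_tsum_sphereSum hfin hg] at hs
  have hsum := (summable_iff_tsum_ofReal_ne_top (fun n =>
    mul_nonneg (sphereSum_nonneg hg n) (Real.exp_pos _).le)).2 hs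
  have hlow' : ∀ n, K * c ^ n ≤ sphereSum ℓ g n := by
    intro n
    obtain ⟨x, hx, hxg⟩ := hlow n
    refine hxg.trans ?_
    have := (summable_sphere (g := g) hfin n).le_tsum x
      (fun y _ => by split_ifs <;> simp [hg])
    simpa [hx, sphereSum] using this
  have hpos : ∀ n, 0 < sphereSum ℓ g n := fun n =>
    (mul_pos hK (pow_pos hc n)).trans_le (hlow' n)
  have hup : ∀ᶠ n : ℕ in atTop, Real.log (sphereSum ℓ g n) / n ≤ s := by
    have h1 := hsum.tendsto_atTop_zero.eventually (gt_mem_nhds zero_lt_one)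
    filter_upwards [h1, eventually_gt_atTop 0] with n hn hn0
    have hn0' : (0 : ℝ) < n := by exact_mod_cast hn0
    rw [div_le_iff₀ hn0', Real.log_le_iff_le_exp (hpos n)]
    rw [Real.exp_neg, ← div_eq_mul_inv, div_lt_one (Real.exp_pos _)] at hn
    exact hn.le
  have hbelow : ∀ᶠ n : ℕ in atTop,
      -|Real.log K| + Real.log c ≤ Real.log (sphereSum ℓ g n) / n := by
    filter_upwards [eventually_gt_atTop 0] with n hn0
    have hn0' : (1 : ℝ) ≤ n := by exact_mod_cast hn0
    rw [le_div_iff₀ (by linarith)]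
    have h1 := Real.log_le_log (mul_pos hK (pow_pos hc n)) (hlow' n)
    rw [Real.log_mul hK.ne' (pow_pos hc n).ne', Real.log_pow] at h1
    have h2 := neg_abs_le (Real.log K)
    have h3 := mul_le_mul_of_nonneg_left hn0' (abs_nonneg (Real.log K))
    linarith
  exact limsup_le_of_le
    (IsBoundedUnder.isCoboundedUnder_le ⟨_, eventually_map.2 hbelow⟩) hup

lemma le_limsup_of_poincare_eq_top (hfin : ∀ n, {x | ℓ x = n}.Finite) (hg : ∀ x, 0 ≤ g x)
    (hpos : ∀ n, 0 < sphereSum ℓ g n) {s t : ℝ} (ht : poincare ℓ g t ≠ ⊤)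
    (hs : poincare ℓ g s = ⊤) :
    s ≤ limsup (fun n : ℕ => Real.log (sphereSum ℓ g n) / n) atTop := by
  rw [poincare_eq_tsum_sphereSum hfin hg] at hs ht
  have hnn : ∀ s : ℝ, ∀ n : ℕ, 0 ≤ sphereSum ℓ g n * Real.exp (-(s * n)) := fun s n =>
    mul_nonneg (sphereSum_nonneg hg n) (Real.exp_pos _).le
  have hsum := (summable_iff_tsum_ofReal_ne_top (hnn t)).2 ht
  have hbdd : IsBoundedUnder (· ≤ ·) atTop
      (fun n : ℕ => Real.log (sphereSum ℓ g n) / n) := by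
    refine ⟨t, ?_⟩
    have h1 := hsum.tendsto_atTop_zero.eventually (gt_mem_nhds zero_lt_one)
    simp only [eventually_map]
    filter_upwards [h1, eventually_gt_atTop 0] with n hn hn0
    have hn0' : (0 : ℝ) < n := by exact_mod_cast hn0
    rw [div_le_iff₀ hn0', Real.log_le_iff_le_exp (hpos n)]
    rw [Real.exp_neg, ← div_eq_mul_inv, div_lt_one (Real.exp_pos _)] at hn
    exact hn.le
  by_contra! hlt
  obtain ⟨s', hs', hs's⟩ := exists_between hlt
  refine (summable_iff_tsum_ofReal_ne_top (hnn s)).1 ?_ hs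
  have hgeo : Summable (fun n : ℕ => Real.exp (s' - s) ^ n) :=
    summable_geometric_of_lt_one (Real.exp_pos _).le (Real.exp_lt_one_iff.2 (by linarith))
  refine hgeo.of_norm_bounded_eventually_nat ?_
  filter_upwards [eventually_lt_of_limsup_lt hs' hbdd, eventually_gt_atTop 0] with n hn hn0
  have hn0' : (0 : ℝ) < n := by exact_mod_cast hn0
  rw [div_lt_iff₀ hn0', Real.log_lt_iff_lt_exp (hpos n)] at hn
  rw [Real.norm_of_nonneg (hnn s n), ← Real.exp_nat_mul]
  refine (mul_le_mul_of_nonneg_right hn.le (Real.exp_pos _).le).trans_eq ?_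
  rw [← Real.exp_add]
  congr 1
  ring

end Poincare

section GreenSums

variable {G : Type*} [Group G] {μ : G → ℝ}

lemma tsum_convPow (hμ : IsFinMeasure μ) {f : G → ℝ} (hf : ∀ x, 0 ≤ f x) (n : ℕ) (x : G) :
    ∑' z, ENNReal.ofReal (convPow μ n z * f (z⁻¹ * x))
      = ENNReal.ofReal ((lconv μ)^[n] f x) := by
  induction n generalizing x with
  | zero =>
    rw [tsum_eq_single 1]
    · simp [convPow]
    · intro z hz; simp [convPow, hz]
  | succ n ih =>
    rw [Function.iterate_succ_apply', lconv_eq_sum hμ.finite, ENNReal.ofReal_sum_of_nonneg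
      (fun y _ => mul_nonneg (hμ.nonneg y) (iterate_lconv_nonneg hμ hf n _))]
    have h1 : ∀ z, ENNReal.ofReal (convPow μ (n + 1) z * f (z⁻¹ * x))
        = ∑ y ∈ hμ.finite.toFinset, ENNReal.ofReal (μ y) *
          ENNReal.ofReal (convPow μ n (y⁻¹ * z) * f (z⁻¹ * x)) := by
      intro z
      change ENNReal.ofReal (lconv μ (convPow μ n) z * _) = _
      rw [lconv_eq_sum hμ.finite, Finset.sum_mul, ENNReal.ofReal_sum_of_nonneg (fun y _ =>
        mul_nonneg (mul_nonneg (hμ.nonneg y) (convPow_nonneg hμ n _)) (hf _))]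
      exact Finset.sum_congr rfl fun y _ => by rw [mul_assoc, ENNReal.ofReal_mul (hμ.nonneg y)]
    simp only [h1]
    rw [Summable.tsum_finsetSum (fun _ _ => ENNReal.summable)]
    refine Finset.sum_congr rfl fun y _ => ?_
    rw [ENNReal.tsum_mul_left, ENNReal.ofReal_mul (hμ.nonneg y), ← ih,
      ← (Equiv.mulLeft y).tsum_eq]
    simp [mul_assoc]

lemma tsum_green (hμ : IsFinMeasure μ) {r : ℝ} (hr : 0 ≤ r) (hG : GreenFinite μ r) {f : G → ℝ}
    (hf : ∀ x, 0 ≤ f x) (x : G) :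
    ∑' z, ENNReal.ofReal (green μ r z * f (z⁻¹ * x))
      = ∑' n : ℕ, ENNReal.ofReal (r ^ n * (lconv μ)^[n] f x) := by
  have h1 : ∀ z, ENNReal.ofReal (green μ r z * f (z⁻¹ * x))
      = ∑' n : ℕ, ENNReal.ofReal (r ^ n) * ENNReal.ofReal (convPow μ n z * f (z⁻¹ * x)) := by
    intro z
    rw [green, ← tsum_mul_right, ENNReal.ofReal_tsum_of_nonneg (fun n => mul_nonneg
      (mul_nonneg (pow_nonneg hr n) (convPow_nonneg hμ n z)) (hf _)) ((hG z).mul_right _)]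
    exact tsum_congr fun n => by rw [mul_assoc, ENNReal.ofReal_mul (pow_nonneg hr n)]
  simp only [h1]
  rw [ENNReal.tsum_comm]
  refine tsum_congr fun n => ?_
  rw [ENNReal.tsum_mul_left, tsum_convPow hμ hf, ENNReal.ofReal_mul (pow_nonneg hr n)]

/-- A supersolution bounds the sum of `f` against the Green function. -/
lemma tsum_green_le (hμ : IsFinMeasure μ) {r : ℝ} (hr : 0 ≤ r) (hG : GreenFinite μ r)
    {f W : G → ℝ} (hf : ∀ x, 0 ≤ f x) (hW : ∀ x, 0 ≤ W x)
    (h : ∀ x, f x + r * lconv μ W x ≤ W x) :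
    ∑' z, ENNReal.ofReal (green μ r z * f z⁻¹) ≤ ENNReal.ofReal (W 1) := by
  have h1 := tsum_green hμ hr hG hf 1
  simp only [mul_one] at h1
  obtain ⟨hs, hle⟩ := neumann_summable hμ hr hf hW h 1
  rw [h1, ← ENNReal.ofReal_tsum_of_nonneg (fun n => mul_nonneg (pow_nonneg hr n)
    (iterate_lconv_nonneg hμ hf n 1)) hs]
  exact ENNReal.ofReal_le_ofReal hle

lemma lconv_one (μ : G → ℝ) (hsum : ∑' x, μ x = 1) (c : ℝ) (x : G) :
    lconv μ (fun _ => c) x = c := by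
  rw [lconv, tsum_mul_right, hsum, one_mul]

lemma tsum_green_le_of_lt_one (hμ : IsFinMeasure μ) (hsum : ∑' x, μ x = 1) {r : ℝ} (hr : 0 ≤ r)
    (hr1 : r < 1) :
    GreenFinite μ r ∧ ∑' z, ENNReal.ofReal (green μ r z) ≤ ENNReal.ofReal ((1 - r)⁻¹) := by
  have hpos : 0 < (1 - r)⁻¹ := inv_pos.2 (by linarith)
  have key : (1 : ℝ) + r * (1 - r)⁻¹ = (1 - r)⁻¹ := by
    have : (1 - r) ≠ 0 := by linarith
    field_simp; ring
  have hG : GreenFinite μ r := (green_le_of_supersolution hμ hr (W := fun _ => (1 - r)⁻¹)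
    (fun _ => hpos.le) (fun x => by
      rw [lconv_one μ hsum]
      have : (if x = 1 then (1 : ℝ) else 0) ≤ 1 := by split_ifs <;> norm_num
      linarith)).1
  refine ⟨hG, ?_⟩
  have := tsum_green_le hμ hr hG (f := fun _ => 1) (W := fun _ => (1 - r)⁻¹)
    (fun _ => zero_le_one) (fun _ => hpos.le) (fun x => by rw [lconv_one μ hsum, key])
  simpa using this

/-- In the nonpositive range, the set of exponents of convergence of the Poincaré series is
open. -/
lemma poincare_green_open_of_nonpos (hμ : IsFinMeasure μ) {S : Finset G} {ℓ : G → ℕ}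
    (hℓ : IsLength S ℓ) {r : ℝ} (hr : 0 < r) (hG : GreenFinite μ r) {s : ℝ} (hs : s ≤ 0)
    (hfin : poincare ℓ (green μ r) s ≠ ⊤) :
    ∃ δ > 0, poincare ℓ (green μ r) (s - δ) ≠ ⊤ := by
  set f : G → ℝ := fun x => Real.exp (-(s * ℓ x)) with hf
  have hf0 : ∀ x, 0 < f x := fun x => Real.exp_pos _
  have hfmul : ∀ x y, f (x * y) ≤ f x * f y := by
    intro x y
    simp only [hf]
    rw [← Real.exp_add, Real.exp_le_exp]
    have h1 : ((ℓ (x * y) : ℕ) : ℝ) ≤ ℓ x + ℓ y := by exact_mod_cast hℓ.mul_le x y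
    have := mul_le_mul_of_nonneg_left h1 (neg_nonneg.2 hs)
    linarith
  have hfinv : ∀ x, f x⁻¹ = f x := fun x => by simp only [hf, hℓ.inv]
  have hE : ∀ x, ∑' n : ℕ, ENNReal.ofReal (r ^ n * (lconv μ)^[n] f x)
      ≤ ENNReal.ofReal (f x) * poincare ℓ (green μ r) s := by
    intro x
    rw [← tsum_green hμ hr.le hG (fun x => (hf0 x).le), poincare, ← ENNReal.tsum_mul_left]
    refine ENNReal.tsum_le_tsum fun z => ?_
    rw [← ENNReal.ofReal_mul (hf0 x).le]
    refine ENNReal.ofReal_le_ofReal ?_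
    have h1 := mul_le_mul_of_nonneg_left (hfmul z⁻¹ x) (green_nonneg hμ hr.le z)
    rw [hfinv] at h1
    simp only [hf] at h1 ⊢
    linarith
  have hnn : ∀ x, ∀ n : ℕ, 0 ≤ r ^ n * (lconv μ)^[n] f x := fun x n =>
    mul_nonneg (pow_nonneg hr.le n) (iterate_lconv_nonneg hμ (fun x => (hf0 x).le) n x)
  have hsum : ∀ x, Summable (fun n : ℕ => r ^ n * (lconv μ)^[n] f x) := fun x =>
    (summable_iff_tsum_ofReal_ne_top (hnn x)).2
      (ne_top_of_le_ne_top (ENNReal.mul_ne_top ENNReal.ofReal_ne_top hfin) (hE x))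
  set V : G → ℝ := fun x => ∑' n : ℕ, r ^ n * (lconv μ)^[n] f x with hV
  have hVeq : ∀ x, V x = f x + r * lconv μ V x := by
    intro x
    have h1 : lconv μ V x = ∑' n, lconv μ (fun z => r ^ n * (lconv μ)^[n] f z) x :=
      lconv_tsum hμ hsum x
    rw [h1, ← tsum_mul_left]
    simp only [hV]
    rw [(hsum x).tsum_eq_zero_add]
    congr 1
    · simp
    · refine tsum_congr fun n => ?_
      rw [lconv_const_mul, Function.iterate_succ_apply']
      ring
  have hfV : ∀ x, f x ≤ V x := by
    intro x
    have := mul_nonneg hr.le (lconv_nonneg hμ (f := V) (fun x => tsum_nonneg (hnn x)) x)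
    linarith [hVeq x]
  set D := (poincare ℓ (green μ r) s).toReal + 1 with hD
  have hDpos : 0 < D := by positivity
  have hVD : ∀ x, V x ≤ D * f x := by
    intro x
    have h1 := hE x
    rw [← ENNReal.ofReal_tsum_of_nonneg (hnn x) (hsum x),
      ENNReal.ofReal_le_iff_le_toReal (ENNReal.mul_ne_top ENNReal.ofReal_ne_top hfin),
      ENNReal.toReal_mul, ENNReal.toReal_ofReal (hf0 x).le] at h1
    rw [hD, add_mul, one_mul]
    linarith [hf0 x]
  have hVpos : ∀ x, 0 < V x := fun x => (hf0 x).trans_le (hfV x)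
  have hD1 : 1 ≤ D := by
    have := (hfV 1).trans (hVD 1)
    nlinarith [hf0 1]
  have hLV : ∀ x, r * lconv μ V x ≤ (1 - D⁻¹) * V x := by
    intro x
    have h1 : D⁻¹ * V x ≤ f x := by
      rw [inv_mul_le_iff₀ hDpos]; exact hVD x
    linarith [hVeq x]
  obtain ⟨K, hK⟩ : ∃ K : ℕ, ∀ y, μ y ≠ 0 → ℓ y⁻¹ ≤ K := by
    refine ⟨hμ.finite.toFinset.sup (fun y => ℓ y⁻¹), fun y hy => ?_⟩
    exact Finset.le_sup (f := fun y => ℓ y⁻¹) (by simpa using hy)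
  obtain ⟨δ, hδ, hδ1⟩ : ∃ δ > 0, Real.exp (δ * K) * (1 - D⁻¹) < 1 := by
    have hc : Continuous (fun δ : ℝ => Real.exp (δ * K) * (1 - D⁻¹)) := by fun_prop
    have h0 : Real.exp (0 * K) * (1 - D⁻¹) < 1 := by simpa using hDpos
    have hev := (hc.tendsto 0).eventually (gt_mem_nhds h0)
    obtain ⟨δ, h1, h2⟩ := ((hev.filter_mono nhdsWithin_le_nhds).and
      (self_mem_nhdsWithin (s := Set.Ioi (0 : ℝ)))).exists
    exact ⟨δ, h2, h1⟩
  refine ⟨δ, hδ, ?_⟩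
  set q := Real.exp (δ * K) * (1 - D⁻¹) with hq
  set V' : G → ℝ := fun x => V x * Real.exp (δ * ℓ x) with hV'
  have hV'pos : ∀ x, 0 < V' x := fun x => mul_pos (hVpos x) (Real.exp_pos _)
  have hLV' : ∀ x, r * lconv μ V' x ≤ q * V' x := by
    intro x
    have h1 : lconv μ V' x ≤ Real.exp (δ * K) * Real.exp (δ * ℓ x) * lconv μ V x := by
      rw [lconv_eq_sum hμ.finite, lconv_eq_sum hμ.finite, Finset.mul_sum]
      refine Finset.sum_le_sum fun y hy => ?_
      have hy' : μ y ≠ 0 := by simpa using hy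
      have h2 : Real.exp (δ * ℓ (y⁻¹ * x)) ≤ Real.exp (δ * K) * Real.exp (δ * ℓ x) := by
        rw [← Real.exp_add, Real.exp_le_exp, ← mul_add]
        refine mul_le_mul_of_nonneg_left ?_ hδ.le
        exact_mod_cast (hℓ.mul_le y⁻¹ x).trans (Nat.add_le_add_right (hK y hy') _)
      have h3 := mul_le_mul_of_nonneg_left h2
        (mul_nonneg (hμ.nonneg y) (hVpos (y⁻¹ * x)).le)
      simp only [hV']
      linarith
    have h4 := mul_le_mul_of_nonneg_left h1 hr.le
    have h5 := mul_le_mul_of_nonneg_left (hLV x)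
      (mul_pos (Real.exp_pos (δ * K)) (Real.exp_pos (δ * ℓ x))).le
    simp only [hV', hq]
    linarith
  have hfin' := tsum_green_le hμ hr.le hG
    (f := fun x => Real.exp (-((s - δ) * ℓ x))) (W := fun x => (1 - q)⁻¹ * V' x)
    (fun x => (Real.exp_pos _).le)
    (fun x => mul_nonneg (inv_nonneg.2 (by linarith)) (hV'pos x).le) (fun x => by
      rw [lconv_const_mul]
      have h1 : Real.exp (-((s - δ) * ℓ x)) ≤ V' x := by
        have : Real.exp (-((s - δ) * ℓ x)) = f x * Real.exp (δ * ℓ x) := by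
          simp only [hf]; rw [← Real.exp_add]; congr 1; ring
        rw [this]
        exact mul_le_mul_of_nonneg_right (hfV x) (Real.exp_pos _).le
      have h2 := mul_le_mul_of_nonneg_left (hLV' x) (inv_nonneg.2 (by linarith : 0 ≤ 1 - q))
      have h3 : (1 - q)⁻¹ * V' x - (1 - q)⁻¹ * (q * V' x) = V' x := by
        have : 1 - q ≠ 0 := by linarith
        field_simp
      linarith)
  refine ne_top_of_le_ne_top ENNReal.ofReal_ne_top (le_trans (le_of_eq ?_) hfin')
  simp only [poincare, hℓ.inv]

lemma poincare_zero_ne_top (hμ : IsFinMeasure μ) (hsum : ∑' x, μ x = 1) (ℓ : G → ℕ) {r : ℝ}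
    (hr : 0 ≤ r) (hr1 : r < 1) : poincare ℓ (green μ r) 0 ≠ ⊤ := by
  have := (tsum_green_le_of_lt_one hμ hsum hr hr1).2
  refine ne_top_of_le_ne_top ENNReal.ofReal_ne_top (le_trans (le_of_eq ?_) this)
  simp [poincare]

lemma poincare_green_open (hμ : IsFinMeasure μ) (hsum : ∑' x, μ x = 1) {S : Finset G} {ℓ : G → ℕ}
    (hℓ : IsLength S ℓ) {r : ℝ} (hr : 0 < r) (hr1 : r < 1) {s : ℝ}
    (hfin : poincare ℓ (green μ r) s ≠ ⊤) :
    ∃ δ > 0, poincare ℓ (green μ r) (s - δ) ≠ ⊤ := by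
  rcases le_or_gt s 0 with hs | hs
  · exact poincare_green_open_of_nonpos hμ hℓ hr (tsum_green_le_of_lt_one hμ hsum hr.le hr1).1
      hs hfin
  · exact ⟨s, hs, by simpa using poincare_zero_ne_top hμ hsum ℓ hr.le hr1⟩

/-- A subsolution forces divergence of the sum of `f` against the Green function. -/
lemma tsum_green_eq_top (hμ : IsFinMeasure μ) {r : ℝ} (hr : 0 < r) (hG : GreenFinite μ r)
    {f g : G → ℝ} (hf : ∀ x, 0 ≤ f x) {C : ℝ} (hC : 0 < C) (hgf : ∀ x, g x ≤ C * f x)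
    (hg : ∀ x, g x ≤ r * lconv μ g x) (hpos : 0 < lconv μ g 1) :
    ∑' z, ENNReal.ofReal (green μ r z * f z⁻¹) = ⊤ := by
  have h1 := tsum_green hμ hr.le hG hf 1
  simp only [mul_one] at h1
  rw [h1]
  have hit : ∀ n : ℕ, ∀ x, g x ≤ r ^ n * (lconv μ)^[n] g x := by
    intro n
    induction n with
    | zero => intro x; simp
    | succ n ih =>
      intro x
      have h2 := mul_le_mul_of_nonneg_left (lconv_mono hμ ih x) hr.le
      rw [lconv_const_mul] at h2
      rw [Function.iterate_succ_apply', pow_succ]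
      linarith [hg x]
  have hfg : ∀ n : ℕ, ∀ x, (lconv μ)^[n] g x ≤ C * (lconv μ)^[n] f x := by
    intro n
    induction n with
    | zero => exact hgf
    | succ n ih =>
      intro x
      have h2 := lconv_mono hμ ih x
      rw [lconv_const_mul] at h2
      simpa only [Function.iterate_succ_apply'] using h2
  set ε := r * lconv μ g 1 / C with hε
  have hεpos : 0 < ε := div_pos (mul_pos hr hpos) hC
  have hlow : ∀ n : ℕ, ε ≤ r ^ (n + 1) * (lconv μ)^[n + 1] f 1 := by
    intro n
    rw [hε, div_le_iff₀ hC]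
    have h2 := mul_le_mul_of_nonneg_left (lconv_mono hμ (hit n) 1) hr.le
    rw [lconv_const_mul, ← Function.iterate_succ_apply' (lconv μ)] at h2
    have h3 := mul_le_mul_of_nonneg_left (hfg (n + 1) 1) (pow_pos hr (n + 1)).le
    rw [pow_succ] at h3 ⊢
    linarith
  rw [tsum_eq_zero_add' ENNReal.summable]
  refine ENNReal.add_eq_top.2 (Or.inr (top_unique ?_))
  calc (⊤ : ENNReal) = ∑' _ : ℕ, ENNReal.ofReal ε :=
        (ENNReal.tsum_const_eq_top_of_ne_zero (by simpa using hεpos)).symm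
    _ ≤ _ := ENNReal.tsum_le_tsum fun n => ENNReal.ofReal_le_ofReal (hlow n)

end GreenSums

end

section

section Splitting

/-- A decomposition of `Γ` as the free product of `M false` and `M true`: `P i` is the set of
elements whose normal form does not start with a letter of `M i`. -/
structure Splitting (M : Bool → Type*) [∀ i, Group (M i)] (Γ : Type*) [Group Γ] where
  ι : ∀ i, M i →* Γ
  P : Bool → Set Γ
  word : Γ → List (Σ i, M i)
  one_mem : ∀ i, 1 ∈ P i
  bij : ∀ i, Function.Bijective fun p : M i × P i => ι i p.1 * (p.2 : Γ)
  mem_of : ∀ i (x : M i), x ≠ 1 → ∀ h ∈ P i, ι i x * h ∈ P (!i)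
  exists_of : ∀ g, g ≠ 1 → ∃ i, ∃ x : M i, x ≠ 1 ∧ ∃ h ∈ P i, g = ι i x * h
  word_one : word 1 = []
  word_mul : ∀ i (x : M i), x ≠ 1 → ∀ h ∈ P i, word (ι i x * h) = ⟨i, x⟩ :: word h

section Construction

variable {M : Bool → Type*} [∀ i, Group (M i)] {Γ : Type*} [Group Γ]

open Monoid.CoprodI in
/-- The splitting of a group isomorphic to a free product. -/
noncomputable def Splitting.ofMulEquiv (e : Γ ≃* Monoid.CoprodI M) (ι : ∀ i, M i →* Γ)
    (hι : ∀ i x, e (ι i x) = of x) : Splitting M Γ where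
  ι := ι
  P i := {g | (Word.equiv (e g)).fstIdx ≠ some i}
  word g := (Word.equiv (e g)).toList
  one_mem i := by
    have : Word.equiv (1 : Monoid.CoprodI M) = Word.empty := by
      rw [← Equiv.eq_symm_apply]
      exact Word.prod_empty.symm
    simp [this, Word.fstIdx, Word.empty]
  bij i := by
    constructor
    · rintro ⟨x, h, hh⟩ ⟨y, k, hk⟩ hxy
      have h1 : Word.rcons ⟨x, Word.equiv (e h), hh⟩ = Word.rcons ⟨y, Word.equiv (e k), hk⟩ := by
        apply Word.equiv.symm.injective
        change Word.prod _ = Word.prod _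
        rw [Word.prod_rcons, Word.prod_rcons]
        change of x * Word.equiv.symm (Word.equiv (e h)) = of y * Word.equiv.symm (Word.equiv (e k))
        rw [Equiv.symm_apply_apply, Equiv.symm_apply_apply, ← hι, ← hι, ← map_mul, ← map_mul]
        exact congrArg e hxy
      have h2 := Word.rcons_inj h1
      simp only [Word.Pair.mk.injEq, EmbeddingLike.apply_eq_iff_eq] at h2
      obtain ⟨rfl, rfl⟩ := h2
      rfl
    · intro g
      obtain ⟨p, hp⟩ := (Word.equivPair i).symm.surjective (Word.equiv (e g))
      rw [Word.equivPair_symm] at hp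
      refine ⟨⟨p.head, e.symm (Word.equiv.symm p.tail), ?_⟩, ?_⟩
      · simpa using p.fstIdx_ne
      · apply e.injective
        have h3 : (Word.rcons p).prod = e g := by
          rw [hp]
          exact Word.equiv.symm_apply_apply (e g)
        rw [Word.prod_rcons] at h3
        rw [map_mul, hι]
        refine Eq.trans ?_ h3
        exact congrArg _ (e.apply_symm_apply _)
  mem_of i x hx h hh := by
    have : Word.equiv (e (ι i x * h)) = Word.cons x (Word.equiv (e h)) hh hx := by
      rw [← Equiv.eq_symm_apply]
      change _ = Word.prod _
      rw [Word.prod_cons, map_mul, hι]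
      congr 1
      exact (Word.equiv.symm_apply_apply (e h)).symm
    change (Word.equiv (e (ι i x * h))).fstIdx ≠ _
    rw [this, Word.fstIdx_cons]
    simp
  exists_of g hg := by
    have key : ∀ w : Word M, w ≠ Word.empty → ∃ i, ∃ x : M i, x ≠ 1 ∧ ∃ v : Word M,
        v.fstIdx ≠ some i ∧ w.prod = of x * v.prod := by
      intro w
      induction w using Word.consRecOn with
      | empty => simp
      | cons i x v h1 h2 _ => exact fun _ => ⟨i, x, h2, v, h1, Word.prod_cons _ _ _ _ _⟩
    obtain ⟨i, x, hx, v, hv, hw⟩ := key (Word.equiv (e g)) (by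
      intro h
      apply hg
      rw [← Equiv.eq_symm_apply] at h
      apply e.injective
      rw [h, map_one]
      rfl)
    refine ⟨i, x, hx, e.symm v.prod, ?_, ?_⟩
    · have : Word.equiv v.prod = v := Word.equiv.apply_symm_apply v
      simpa [this] using hv
    · apply e.injective
      rw [map_mul, hι, e.apply_symm_apply, ← hw]
      exact (Word.equiv.symm_apply_apply (e g)).symm
  word_one := by
    have : Word.equiv (1 : Monoid.CoprodI M) = Word.empty := by
      rw [← Equiv.eq_symm_apply]
      exact Word.prod_empty.symm
    simp [this, Word.empty]
  word_mul i x hx h hh := by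
    have : Word.equiv (e (ι i x * h)) = Word.cons x (Word.equiv (e h)) hh hx := by
      rw [← Equiv.eq_symm_apply]
      change _ = Word.prod _
      rw [Word.prod_cons, map_mul, hι]
      congr 1
      exact (Word.equiv.symm_apply_apply (e h)).symm
    rw [this]
    rfl

/-- The two factors of a binary free product as a family indexed by `Bool`. -/
abbrev Factor (A B : Type) (i : Bool) : Type := match i with
  | false => A
  | true => B

instance Factor.group (A B : Type) [Group A] [Group B] : ∀ i, Group (Factor A B i)
  | false => inferInstanceAs (Group A)
  | true => inferInstanceAs (Group B)

/-- The inclusions of the factors of a binary free product. -/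
def Factor.incl (A B : Type) [Group A] [Group B] : ∀ i, Factor A B i →* Monoid.Coprod A B
  | false => (Monoid.Coprod.inl : A →* Monoid.Coprod A B)
  | true => (Monoid.Coprod.inr : B →* Monoid.Coprod A B)

/-- A binary free product as a free product indexed by `Bool`. -/
noncomputable def coprodMulEquiv (A B : Type) [Group A] [Group B] :
    Monoid.Coprod A B ≃* Monoid.CoprodI (Factor A B) :=
  MonoidHom.toMulEquiv
    (Monoid.Coprod.lift (Monoid.CoprodI.of (M := Factor A B) (i := false))
      (Monoid.CoprodI.of (M := Factor A B) (i := true)))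
    (Monoid.CoprodI.lift (Factor.incl A B))
    (by
      apply Monoid.Coprod.hom_ext <;> ext x
      · simp only [MonoidHom.comp_apply, MonoidHom.id_apply]
        rw [Monoid.Coprod.lift_apply_inl, Monoid.CoprodI.lift_of]
        rfl
      · simp only [MonoidHom.comp_apply, MonoidHom.id_apply]
        rw [Monoid.Coprod.lift_apply_inr, Monoid.CoprodI.lift_of]
        rfl)
    (by
      apply Monoid.CoprodI.ext_hom
      intro i
      ext x
      rw [MonoidHom.comp_apply, MonoidHom.comp_apply, Monoid.CoprodI.lift_of]
      cases i
      · exact Monoid.Coprod.lift_apply_inl (M := A) (N := B) _ _ x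
      · exact Monoid.Coprod.lift_apply_inr (M := A) (N := B) _ _ x)

/-- The splitting of a binary free product. -/
noncomputable def coprodSplitting (A B : Type) [Group A] [Group B] :
    Splitting (Factor A B) (Monoid.Coprod A B) :=
  Splitting.ofMulEquiv (coprodMulEquiv A B) (Factor.incl A B) (by
    intro i x
    cases i
    · exact Monoid.Coprod.lift_apply_inl (Monoid.CoprodI.of (M := Factor A B) (i := false))
        (Monoid.CoprodI.of (M := Factor A B) (i := true)) x
    · exact Monoid.Coprod.lift_apply_inr (Monoid.CoprodI.of (M := Factor A B) (i := false))
        (Monoid.CoprodI.of (M := Factor A B) (i := true)) x)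

end Construction

namespace Splitting

variable {M : Bool → Type*} [∀ i, Group (M i)] {Γ : Type*} [Group Γ] (D : Splitting M Γ)

lemma induction {p : Γ → Prop} (one : p 1)
    (mul : ∀ i (x : M i), x ≠ 1 → ∀ h ∈ D.P i, p h → p (D.ι i x * h)) (g : Γ) : p g := by
  induction hn : (D.word g).length using Nat.strong_induction_on generalizing g with
  | _ n ih =>
    by_cases hg : g = 1
    · exact hg ▸ one
    · obtain ⟨i, x, hx, h, hh, rfl⟩ := D.exists_of g hg
      rw [D.word_mul i x hx h hh] at hn
      exact mul i x hx h hh (ih _ (by simp [← hn]) h rfl)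

lemma ι_injective (i : Bool) : Function.Injective (D.ι i) := by
  intro x y hxy
  have := (D.bij i).1 (a₁ := (x, ⟨1, D.one_mem i⟩)) (a₂ := (y, ⟨1, D.one_mem i⟩)) (by simpa using hxy)
  exact (Prod.ext_iff.1 this).1

lemma exists_eq (i : Bool) (g : Γ) : ∃ x : M i, ∃ h ∈ D.P i, g = D.ι i x * h := by
  obtain ⟨⟨x, h⟩, rfl⟩ := (D.bij i).2 g
  exact ⟨x, h, h.2, rfl⟩

/-- The multiplicative extension of functions on the factors. -/
noncomputable def ext {R : Type*} [CommMonoid R] (φ : ∀ i, M i → R) (g : Γ) : R :=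
  ((D.word g).map fun a => φ a.1 a.2).prod

/-- The additive extension of functions on the factors. -/
def addExt (ℓ : ∀ i, M i → ℕ) (g : Γ) : ℕ := ((D.word g).map fun a => ℓ a.1 a.2).sum

section ext

variable {R : Type*} [CommMonoid R] {φ : ∀ i, M i → R} {ℓ : ∀ i, M i → ℕ}

@[simp] lemma ext_one : D.ext φ 1 = 1 := by simp [ext, D.word_one]

lemma ext_mul' {i : Bool} {x : M i} (hx : x ≠ 1) {h : Γ} (hh : h ∈ D.P i) :
    D.ext φ (D.ι i x * h) = φ i x * D.ext φ h := by
  simp [ext, D.word_mul i x hx h hh]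

lemma ext_mul (hφ : ∀ i, φ i 1 = 1) {i : Bool} (x : M i) {h : Γ} (hh : h ∈ D.P i) :
    D.ext φ (D.ι i x * h) = φ i x * D.ext φ h := by
  by_cases hx : x = 1
  · simp [hx, hφ]
  · exact D.ext_mul' hx hh

lemma ext_ι (hφ : ∀ i, φ i 1 = 1) {i : Bool} (x : M i) : D.ext φ (D.ι i x) = φ i x := by
  simpa using D.ext_mul hφ x (D.one_mem i)

@[simp] lemma addExt_one : D.addExt ℓ 1 = 0 := by simp [addExt, D.word_one]

lemma addExt_mul (hℓ : ∀ i, ℓ i 1 = 0) {i : Bool} (x : M i) {h : Γ} (hh : h ∈ D.P i) :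
    D.addExt ℓ (D.ι i x * h) = ℓ i x + D.addExt ℓ h := by
  by_cases hx : x = 1
  · simp [hx, hℓ]
  · simp [addExt, D.word_mul i x hx h hh]

lemma addExt_ι (hℓ : ∀ i, ℓ i 1 = 0) {i : Bool} (x : M i) : D.addExt ℓ (D.ι i x) = ℓ i x := by
  simpa using D.addExt_mul hℓ x (D.one_mem i)

end ext

/-- The word length for the union of generating sets of the factors is the sum of the lengths of
the letters. -/
lemma isLength_addExt {S : ∀ i, Finset (M i)} {ℓ : ∀ i, M i → ℕ} (hS : ∀ i, IsLength (S i) (ℓ i))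
    {T : Finset Γ} (hT : (T : Set Γ) = ⋃ i, D.ι i '' (S i : Set (M i))) :
    IsLength T (D.addExt ℓ) := by
  have h1 : ∀ i, ℓ i 1 = 0 := fun i => (hS i).one
  have hmem : ∀ s, s ∈ (T : Set Γ) ∪ (T : Set Γ)⁻¹ ↔
      ∃ i, ∃ a ∈ (S i : Set (M i)) ∪ (S i : Set (M i))⁻¹, D.ι i a = s := by
    intro s
    rw [hT]
    simp only [Set.mem_union, Set.mem_inv, Set.mem_iUnion, Set.mem_image]
    constructor
    · rintro (⟨i, a, ha, rfl⟩ | ⟨i, a, ha, h⟩)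
      · exact ⟨i, a, Or.inl ha, rfl⟩
      · exact ⟨i, a⁻¹, Or.inr (by simpa using ha), by rw [map_inv, h, inv_inv]⟩
    · rintro ⟨i, a, ha | ha, rfl⟩
      · exact Or.inl ⟨i, a, ha, rfl⟩
      · exact Or.inr ⟨i, a⁻¹, ha, by simp⟩
  refine ⟨D.addExt_one, fun s hs g => ?_, fun g hg => ?_⟩
  · obtain ⟨i, a, ha, rfl⟩ := (hmem s).1 hs
    obtain ⟨x, h, hh, rfl⟩ := D.exists_eq i g
    rw [← mul_assoc, ← map_mul, D.addExt_mul h1 _ hh, D.addExt_mul h1 _ hh]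
    have := (hS i).le_succ a ha x
    omega
  · obtain ⟨i, x, hx, h, hh, rfl⟩ := D.exists_of g hg
    obtain ⟨a, ha, y, rfl, hy⟩ := (hS i).exists_decr x hx
    refine ⟨D.ι i a, (hmem _).2 ⟨i, a, ha, rfl⟩, D.ι i y * h, by rw [map_mul, mul_assoc], ?_⟩
    rw [D.addExt_mul h1 _ hh, D.addExt_mul h1 _ hh]
    omega

end Splitting

end Splitting

end

section

section Mix

lemma pushfwd_apply {A B : Type*} {f : A → B} (hf : Function.Injective f) (μ : A → ℝ) (a : A) :
    pushfwd f μ (f a) = μ a := by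
  unfold pushfwd
  rw [tsum_eq_single a]
  · simp
  · intro b hb
    rw [if_neg (fun h => hb (hf h))]

lemma pushfwd_of_notMem_range {A B : Type*} {f : A → B} (μ : A → ℝ) {b : B}
    (hb : b ∉ Set.range f) : pushfwd f μ b = 0 := by
  unfold pushfwd
  rw [tsum_congr (g := fun _ => 0) fun a => if_neg fun h => hb ⟨a, h⟩, tsum_zero]

lemma isFinMeasure_pushfwd {A B : Type*} [Group A] [Group B] {f : A → B}
    (hf : Function.Injective f) {μ : A → ℝ} (hμ : IsFinMeasure μ) :
    IsFinMeasure (pushfwd f μ) := by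
  constructor
  · intro b
    by_cases hb : b ∈ Set.range f
    · obtain ⟨a, rfl⟩ := hb
      rw [pushfwd_apply hf]
      exact hμ.nonneg a
    · rw [pushfwd_of_notMem_range μ hb]
  · refine (hμ.finite.image f).subset fun b hb => ?_
    by_cases hb' : b ∈ Set.range f
    · obtain ⟨a, rfl⟩ := hb'
      rw [Function.mem_support, pushfwd_apply hf] at hb
      exact ⟨a, hb, rfl⟩
    · exact (hb (pushfwd_of_notMem_range μ hb')).elim

lemma lconv_pushfwd {A B : Type*} [Group A] [Group B] {f : A →* B} (hf : Function.Injective f)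
    (μ : A → ℝ) (F : B → ℝ) (b : B) :
    lconv (pushfwd f μ) F b = lconv μ (fun a => F (f a * b)) 1 := by
  unfold lconv
  rw [← hf.tsum_eq]
  · exact tsum_congr fun a => by rw [pushfwd_apply hf]; simp
  · intro y hy
    by_contra h
    exact hy (by simp [pushfwd_of_notMem_range μ h])

lemma sum_bool_eq (i : Bool) (f : Bool → ℝ) : ∑ b, f b = f i + f (!i) := by
  cases i
  · simp [add_comm]
  · simp

namespace Splitting

variable {M : Bool → Type*} [∀ i, Group (M i)] {Γ : Type*} [Group Γ] (D : Splitting M Γ)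
  {w : Bool → ℝ} {μ : ∀ i, M i → ℝ}

/-- The mixture with weights `w i` of measures on the factors. -/
noncomputable def mix (w : Bool → ℝ) (μ : ∀ i, M i → ℝ) (g : Γ) : ℝ :=
  ∑ i, w i * pushfwd (D.ι i) (μ i) g

lemma isFinMeasure_mix (hw : ∀ i, 0 ≤ w i) (hμ : ∀ i, IsFinMeasure (μ i)) :
    IsFinMeasure (D.mix w μ) := by
  have h := fun i => isFinMeasure_pushfwd (D.ι_injective i) (hμ i)
  refine ⟨fun g => Finset.sum_nonneg fun i _ => mul_nonneg (hw i) ((h i).nonneg g), ?_⟩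
  refine (Set.finite_iUnion fun i => (h i).finite).subset fun g hg => ?_
  by_contra hg'
  simp only [Set.mem_iUnion, Function.mem_support, not_exists, not_not] at hg'
  exact hg (Finset.sum_eq_zero fun i _ => by rw [hg' i, mul_zero])

lemma mix_one_pos (hw : ∀ i, 0 ≤ w i) (hμ : ∀ i, IsFinMeasure (μ i)) {i : Bool} (hi : 0 < w i)
    (hi' : 0 < μ i 1) : 0 < D.mix w μ 1 := by
  have h := fun i => isFinMeasure_pushfwd (D.ι_injective i) (hμ i)
  refine Finset.sum_pos' (fun i _ => mul_nonneg (hw i) ((h i).nonneg _)) ⟨i, Finset.mem_univ _, ?_⟩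
  have := pushfwd_apply (D.ι_injective i) (μ i) 1
  rw [map_one] at this
  rw [this]
  exact mul_pos hi hi'

lemma lconv_mix (hμ : ∀ i, IsFinMeasure (μ i)) (F : Γ → ℝ) (g : Γ) :
    lconv (D.mix w μ) F g = ∑ i, w i * lconv (μ i) (fun a => F (D.ι i a * g)) 1 := by
  have h := fun i => isFinMeasure_pushfwd (D.ι_injective i) (hμ i)
  have hs : ∀ i, Summable fun y => w i * (pushfwd (D.ι i) (μ i) y * F (y⁻¹ * g)) := fun i =>
    summable_of_hasFiniteSupport ((h i).finite.subset fun y hy hy' => hy (by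
      simp [hy']))
  simp only [← lconv_pushfwd (D.ι_injective _)]
  unfold lconv mix
  simp only [Finset.sum_mul, ← tsum_mul_left, mul_assoc]
  exact Summable.tsum_finsetSum fun i _ => hs i

variable {φ : ∀ i, M i → ℝ}

lemma lconv_ext_aux (hφ : ∀ i, φ i 1 = 1) {i : Bool} (x : M i) {h : Γ} (hh : h ∈ D.P i) :
    lconv (μ i) (fun a => D.ext φ (D.ι i a * (D.ι i x * h))) 1 =
      lconv (μ i) (φ i) x * D.ext φ h := by
  have : (fun a => D.ext φ (D.ι i a * (D.ι i x * h))) = fun a => φ i (a * x) * D.ext φ h := by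
    funext a
    rw [← mul_assoc, ← map_mul, D.ext_mul hφ _ hh]
  rw [this, lconv_mul_const, lconv_translate, one_mul]

lemma lconv_mix_ext_one (hμ : ∀ i, IsFinMeasure (μ i)) (hφ : ∀ i, φ i 1 = 1) :
    lconv (D.mix w μ) (D.ext φ) 1 = ∑ i, w i * lconv (μ i) (φ i) 1 := by
  rw [D.lconv_mix hμ]
  refine Finset.sum_congr rfl fun i _ => ?_
  have := D.lconv_ext_aux (μ := μ) hφ (1 : M i) (D.one_mem i)
  rw [map_one, mul_one, ext_one, mul_one] at this
  rw [this]

lemma lconv_mix_ext_mul (hμ : ∀ i, IsFinMeasure (μ i)) (hφ : ∀ i, φ i 1 = 1) {i : Bool} {x : M i}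
    (hx : x ≠ 1) {h : Γ} (hh : h ∈ D.P i) :
    lconv (D.mix w μ) (D.ext φ) (D.ι i x * h) =
      w i * (lconv (μ i) (φ i) x * D.ext φ h) +
        w (!i) * (lconv (μ (!i)) (φ (!i)) 1 * D.ext φ (D.ι i x * h)) := by
  rw [D.lconv_mix hμ, sum_bool_eq i, D.lconv_ext_aux hφ x hh]
  have := D.lconv_ext_aux (μ := μ) hφ (1 : M (!i)) (D.mem_of i x hx h hh)
  rw [map_one, one_mul] at this
  rw [this]

lemma ext_nonneg (hφ : ∀ i x, 0 ≤ φ i x) (g : Γ) : 0 ≤ D.ext φ g := by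
  induction g using D.induction with
  | one => simp
  | mul i x hx h hh ih => rw [D.ext_mul' hx hh]; exact mul_nonneg (hφ i x) ih

lemma ext_mono {ψ : ∀ i, M i → ℝ} (hφ : ∀ i x, 0 ≤ φ i x) (h : ∀ i x, φ i x ≤ ψ i x) (g : Γ) :
    D.ext φ g ≤ D.ext ψ g := by
  induction g using D.induction with
  | one => simp
  | mul i x hx k hk ih =>
    rw [D.ext_mul' hx hk, D.ext_mul' hx hk]
    exact mul_le_mul (h i x) ih (D.ext_nonneg hφ k) ((hφ i x).trans (h i x))

lemma lconv_mix_hitting_le (hμ : ∀ i, IsFinMeasure (μ i)) (hw : ∀ i, 0 ≤ w i) {ζ : Bool → ℝ}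
    (hζ : ∀ i, 0 < ζ i) (hG : ∀ i, GreenFinite (μ i) (ζ i)) {t : ℝ} (ht : ∑ i, w i / ζ i ≤ t)
    (g : Γ) :
    lconv (D.mix w μ) (D.ext fun i => hitting (μ i) (ζ i)) g ≤
      t * D.ext (fun i => hitting (μ i) (ζ i)) g := by
  have hψ1 : ∀ i, hitting (μ i) (ζ i) 1 = 1 := fun i => hitting_one (hμ i) (hζ i).le (hG i)
  have hψ0 : ∀ i x, 0 ≤ hitting (μ i) (ζ i) x := fun i => hitting_nonneg (hμ i) (hζ i).le
  have hL : ∀ i x, w i * lconv (μ i) (hitting (μ i) (ζ i)) x ≤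
      w i / ζ i * hitting (μ i) (ζ i) x := by
    intro i x
    rw [div_mul_eq_mul_div, le_div_iff₀ (hζ i), mul_assoc]
    refine mul_le_mul_of_nonneg_left ?_ (hw i)
    rw [mul_comm]
    exact mul_lconv_hitting_le (hμ i) (hζ i) (hG i) x
  by_cases hg : g = 1
  · subst hg
    rw [D.lconv_mix_ext_one hμ hψ1, ext_one, mul_one]
    refine le_trans (Finset.sum_le_sum fun i _ => ?_) ht
    simpa [hψ1] using hL i 1
  · obtain ⟨i, x, hx, h, hh, rfl⟩ := D.exists_of g hg
    rw [D.lconv_mix_ext_mul hμ hψ1 hx hh, ← mul_assoc, ← mul_assoc]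
    have h0 := D.ext_nonneg hψ0 h
    have h2 := D.ext_nonneg hψ0 (D.ι i x * h)
    have h3 := mul_le_mul_of_nonneg_right (hL i x) h0
    have h4 := mul_le_mul_of_nonneg_right (hL (!i) 1) h2
    rw [hψ1, mul_one] at h4
    rw [mul_assoc (w i / ζ i), ← D.ext_mul' hx hh (φ := fun i => hitting (μ i) (ζ i))] at h3
    rw [sum_bool_eq i] at ht
    have h5 := mul_le_mul_of_nonneg_right ht h2
    linarith

/-- The Green function of a mixture on a free product, in terms of the Green functions of the
factors. -/
theorem green_mix (hμ : ∀ i, IsFinMeasure (μ i)) (hw : ∀ i, 0 < w i) {ζ ζ' : Bool → ℝ}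
    (hζ : ∀ i, 0 < ζ i) (hζζ' : ∀ i, ζ i ≤ ζ' i) (hG : ∀ i, GreenFinite (μ i) (ζ' i))
    {κ : ℝ} (hκ : 0 < κ) (hwκ : ∀ i, w i = κ * (ζ i * green (μ i) (ζ i) 1))
    {r : ℝ} (hr : 0 < r) (hr' : r⁻¹ = ∑ i, w i / ζ i - κ) {t : ℝ}
    (ht : ∑ i, w i / ζ' i ≤ t) (hrt : r * t < 1) :
    GreenFinite (D.mix w μ) r ∧
      ∀ g, green (D.mix w μ) r g = D.ext (fun i => hitting (μ i) (ζ i)) g / (r * κ) := by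
  have hm := D.isFinMeasure_mix (fun i => (hw i).le) hμ
  have hζ' : ∀ i, 0 < ζ' i := fun i => (hζ i).trans_le (hζζ' i)
  have hGζ : ∀ i, GreenFinite (μ i) (ζ i) := fun i => (hG i).mono (hμ i) (hζ i).le (hζζ' i)
  have hrκ : 0 < r * κ := mul_pos hr hκ
  have ht0 : 0 ≤ t := le_trans (Finset.sum_nonneg fun i _ => (div_pos (hw i) (hζ' i)).le) ht
  have hφ1 : ∀ i, hitting (μ i) (ζ i) 1 = 1 := fun i => hitting_one (hμ i) (hζ i).le (hGζ i)
  have hψ1 : ∀ i, hitting (μ i) (ζ' i) 1 = 1 := fun i => hitting_one (hμ i) (hζ' i).le (hG i)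
  have hφ0 : ∀ i x, 0 ≤ hitting (μ i) (ζ i) x := fun i => hitting_nonneg (hμ i) (hζ i).le
  have hψ0 : ∀ i x, 0 ≤ hitting (μ i) (ζ' i) x := fun i => hitting_nonneg (hμ i) (hζ' i).le
  have hL1 : ∀ i, w i * lconv (μ i) (hitting (μ i) (ζ i)) 1 = w i / ζ i - κ := by
    intro i
    have hg : green (μ i) (ζ i) 1 ≠ 0 :=
      (zero_lt_one.trans_le (one_le_green_one (hμ i) (hζ i).le (hGζ i))).ne'
    have hz := (hζ i).ne'
    rw [lconv_hitting (hμ i) (hζ i) (hGζ i), if_pos rfl, hφ1, hwκ i]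
    field_simp
  have hL : ∀ i, ∀ x ≠ 1, w i * lconv (μ i) (hitting (μ i) (ζ i)) x =
      w i / ζ i * hitting (μ i) (ζ i) x := by
    intro i x hx
    rw [lconv_hitting (hμ i) (hζ i) (hGζ i), if_neg hx, sub_zero]
    ring
  refine green_eq_of_solution hm hr (Ψ := D.ext fun i => hitting (μ i) (ζ' i)) (C := (r * κ)⁻¹)
    (θ := r * t) (fun g => div_nonneg (D.ext_nonneg hφ0 g) hrκ.le) ?_ (inv_nonneg.2 hrκ.le) ?_
    (mul_nonneg hr.le ht0) hrt ?_
  · intro g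
    simp only [div_eq_mul_inv]
    rw [lconv_mul_const]
    by_cases hg : g = 1
    · subst hg
      rw [D.lconv_mix_ext_one hμ hφ1, ext_one, if_pos rfl, Finset.sum_congr rfl fun i _ => hL1 i,
        sum_bool_eq true]
      rw [sum_bool_eq true] at hr'
      have : w true / ζ true - κ + (w (!true) / ζ (!true) - κ) = r⁻¹ - κ := by rw [hr']; ring
      rw [this]
      field_simp
      ring
    · obtain ⟨i, x, hx, h, hh, rfl⟩ := D.exists_of g hg
      rw [D.lconv_mix_ext_mul hμ hφ1 hx hh, if_neg hg, ← mul_assoc (w i), ← mul_assoc (w (!i)), hL i x hx,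
        hL1 (!i), D.ext_mul' hx hh]
      rw [sum_bool_eq i] at hr'
      have : w i / ζ i * hitting (μ i) (ζ i) x * D.ext (fun i => hitting (μ i) (ζ i)) h +
          (w (!i) / ζ (!i) - κ) *
            (hitting (μ i) (ζ i) x * D.ext (fun i => hitting (μ i) (ζ i)) h) =
          r⁻¹ * (hitting (μ i) (ζ i) x * D.ext (fun i => hitting (μ i) (ζ i)) h) := by
        rw [hr']; ring
      rw [this]
      field_simp
      ring
  · intro g
    rw [div_eq_inv_mul]
    exact mul_le_mul_of_nonneg_left (D.ext_mono hφ0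
      (fun i x => hitting_mono (hμ i) (hζ i) (hζζ' i) (hG i) x) g) (inv_nonneg.2 hrκ.le)
  · intro g
    rw [mul_assoc]
    exact mul_le_mul_of_nonneg_left
      (D.lconv_mix_hitting_le hμ (fun i => (hw i).le) hζ' hG ht g) hr.le

end Splitting

end Mix

end

section

section FreeProductPoincare

namespace Splitting

variable {M : Bool → Type*} [∀ i, Group (M i)] {Γ : Type*} [Group Γ] (D : Splitting M Γ)

section ENNReal

lemma tsum_eq (i : Bool) (F : Γ → ENNReal) :
    ∑' g, F g = ∑' x : M i, ∑' h : D.P i, F (D.ι i x * h) := by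
  rw [← (Equiv.ofBijective _ (D.bij i)).tsum_eq]
  exact ENNReal.tsum_prod (f := fun (x : M i) (h : D.P i) => F (D.ι i x * h))

lemma tsum_P (i : Bool) (F : Γ → ENNReal) :
    ∑' h : D.P i, F h =
      F 1 + ∑' x : M (!i), ∑' h : D.P (!i), if x = 1 then 0 else F (D.ι (!i) x * h) := by
  rw [tsum_subtype, D.tsum_eq (!i)]
  have h1 : ∀ (x : M (!i)) (h : D.P (!i)), (D.P i).indicator F (D.ι (!i) x * h) =
      (if x = 1 then (if h = ⟨1, D.one_mem _⟩ then F 1 else 0) else 0) +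
        if x = 1 then 0 else F (D.ι (!i) x * h) := by
    rintro x ⟨h, hh⟩
    by_cases hx : x = 1
    · subst hx
      by_cases h1 : h = 1
      · subst h1
        simp [D.one_mem]
      · have : h ∉ D.P i := by
          intro hi
          obtain ⟨j, y, hy, k, hk, hyk⟩ := D.exists_of h h1
          have hcase : ∀ l, h ∈ D.P l → j ≠ l := by
            rintro l hl rfl
            have := (D.bij j).1 (a₁ := (1, ⟨h, hl⟩)) (a₂ := (y, ⟨k, hk⟩)) (by simpa using hyk)
            exact hy (Prod.ext_iff.1 this).1.symm
          have h2 := hcase _ hi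
          have h3 := hcase _ hh
          revert h2 h3
          cases i <;> cases j <;> simp
        simp [this, h1]
    · have : D.ι (!i) x * h ∈ D.P i := by simpa using D.mem_of _ x hx h hh
      simp [hx, this]
  simp only [h1, ENNReal.tsum_add]
  congr 1
  rw [tsum_eq_single 1 (fun x hx => by simp [hx])]
  simp

/-- The sum of `φ` over the nontrivial elements of a factor. -/
noncomputable def letterSum (φ : ∀ i, M i → ENNReal) (i : Bool) : ENNReal :=
  ∑' x : M i, if x = 1 then 0 else φ i x

variable {φ : ∀ i, M i → ENNReal}

lemma tsum_P_ext (i : Bool) :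
    ∑' h : D.P i, D.ext φ h = 1 + letterSum φ (!i) * ∑' h : D.P (!i), D.ext φ h := by
  rw [D.tsum_P i, ext_one, letterSum, ← ENNReal.tsum_mul_right]
  congr 1
  refine tsum_congr fun x => ?_
  by_cases hx : x = 1
  · simp [hx]
  · simp only [hx, if_false, ← ENNReal.tsum_mul_left]
    exact tsum_congr fun h => D.ext_mul' hx h.2

lemma tsum_ext_eq_top (h : 1 ≤ letterSum φ false * letterSum φ true) : ∑' g, D.ext φ g = ⊤ := by
  have h1 : ∑' h : D.P true, D.ext φ h = ⊤ := by
    by_contra hne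
    have h2 : ∑' h : D.P true, D.ext φ h = 1 + letterSum φ false * ∑' h : D.P false, D.ext φ h :=
      D.tsum_P_ext true
    have h3 : ∑' h : D.P false, D.ext φ h = 1 + letterSum φ true * ∑' h : D.P true, D.ext φ h :=
      D.tsum_P_ext false
    rw [h3, mul_add, mul_one, ← mul_assoc] at h2
    have h4 : 1 + ∑' h : D.P true, D.ext φ h ≤ ∑' h : D.P true, D.ext φ h := by
      conv_rhs => rw [h2]
      gcongr
      exact (le_mul_of_one_le_left' h).trans le_add_self
    rw [add_comm] at h4
    exact absurd h4 (not_le.2 (ENNReal.lt_add_right hne one_ne_zero))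
  rw [tsum_subtype (D.P true) (D.ext φ)] at h1
  refine top_unique (h1 ▸ ENNReal.tsum_le_tsum fun g => ?_)
  exact Set.indicator_le_self' (fun _ _ => zero_le) g

lemma tsum_ext_ne_top (hfin : ∀ i, letterSum φ i ≠ ⊤)
    (h : letterSum φ false * letterSum φ true < 1) : ∑' g, D.ext φ g ≠ ⊤ := by
  set q := letterSum φ false * letterSum φ true with hq
  have hqi : ∀ i, letterSum φ i * letterSum φ (!i) = q := by
    intro i
    cases i
    · rfl
    · exact mul_comm _ _
  have hq1 : 1 - q ≠ 0 := (tsub_pos_of_lt h).ne'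
  have hq2 : 1 - q ≠ ⊤ := ne_top_of_le_ne_top ENNReal.one_ne_top tsub_le_self
  set E : ℕ → Γ → ENNReal := fun k g => if (D.word g).length < k then D.ext φ g else 0 with hE
  have hbound : ∀ k i, ∑' h : D.P i, E k h ≤ (1 + letterSum φ (!i)) * (1 - q)⁻¹ := by
    intro k
    induction k with
    | zero => simp [hE]
    | succ k ih =>
      intro i
      rw [D.tsum_P i]
      have h1 : E (k + 1) 1 = 1 := by simp [hE, D.word_one]
      have h2 : (∑' x : M (!i), ∑' h : D.P (!i),
          if x = 1 then 0 else E (k + 1) (D.ι (!i) x * h)) =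
            letterSum φ (!i) * ∑' h : D.P (!i), E k h := by
        rw [letterSum, ← ENNReal.tsum_mul_right]
        refine tsum_congr fun x => ?_
        by_cases hx : x = 1
        · simp [hx]
        · simp only [hx, if_false, ← ENNReal.tsum_mul_left]
          refine tsum_congr fun h => ?_
          simp only [hE, D.word_mul _ x hx h h.2, D.ext_mul' hx h.2, List.length_cons,
            Nat.add_lt_add_iff_right]
          split_ifs <;> simp
      rw [h1, h2]
      calc 1 + letterSum φ (!i) * ∑' h : D.P (!i), E k h
          ≤ 1 + letterSum φ (!i) * ((1 + letterSum φ (!!i)) * (1 - q)⁻¹) := by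
            gcongr
            exact ih (!i)
        _ = (1 - q) * (1 - q)⁻¹ + (letterSum φ (!i) + q) * (1 - q)⁻¹ := by
            rw [ENNReal.mul_inv_cancel hq1 hq2, ← hqi (!i)]
            ring
        _ = (1 - q + q + letterSum φ (!i)) * (1 - q)⁻¹ := by ring
        _ = (1 + letterSum φ (!i)) * (1 - q)⁻¹ := by rw [tsub_add_cancel_of_le h.le]
  have hE' : ∀ i, ∑' h : D.P i, D.ext φ h ≤ (1 + letterSum φ (!i)) * (1 - q)⁻¹ := by
    intro i
    rw [ENNReal.tsum_eq_iSup_sum]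
    refine iSup_le fun s => ?_
    obtain ⟨k, hk⟩ : ∃ k, ∀ h ∈ s, (D.word (h : Γ)).length < k := by
      refine ⟨s.sup (fun h => (D.word (h : Γ)).length) + 1, fun h hh => ?_⟩
      exact Nat.lt_succ_of_le (Finset.le_sup (f := fun h : D.P i => (D.word (h : Γ)).length) hh)
    refine le_trans ?_ (hbound k i)
    refine le_trans (Finset.sum_le_sum fun h hh => ?_) (ENNReal.sum_le_tsum s)
    simp [hE, hk h hh]
  have hfin' : ∀ i, ∑' h : D.P i, D.ext φ h ≠ ⊤ := fun i =>
    ne_top_of_le_ne_top (ENNReal.mul_ne_top (ENNReal.add_ne_top.2 ⟨ENNReal.one_ne_top, hfin _⟩)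
      (ENNReal.inv_ne_top.2 hq1)) (hE' i)
  rw [D.tsum_eq true]
  have h5 : ∀ x : M true, ∑' h : D.P true, D.ext φ (D.ι true x * h) ≤
      ((if x = 1 then 1 else 0) + if x = 1 then 0 else φ true x) * ∑' h : D.P true, D.ext φ h := by
    intro x
    by_cases hx : x = 1
    · simp [hx]
    · rw [← ENNReal.tsum_mul_left]
      refine le_of_eq (tsum_congr fun h => ?_)
      rw [D.ext_mul' hx h.2]
      simp [hx]
  refine ne_top_of_le_ne_top ?_ (ENNReal.tsum_le_tsum h5)
  rw [ENNReal.tsum_mul_right, ENNReal.tsum_add, tsum_ite_eq]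
  exact ENNReal.mul_ne_top (ENNReal.add_ne_top.2 ⟨ENNReal.one_ne_top, hfin true⟩) (hfin' _)

end ENNReal

end Splitting

end FreeProductPoincare

end

section

section Phases

/-- The exponential growth rate of the sphere sums of `g` with respect to the length `ℓ`. -/
noncomputable def growth {X : Type*} (ℓ : X → ℕ) (g : X → ℝ) : ℝ :=
  limsup (fun n : ℕ => Real.log (sphereSum ℓ g n) / n) atTop

section Growth

variable {G : Type*} [Group G] [Infinite G] {S : Finset G} {ℓ : G → ℕ} {g : G → ℝ} {K c : ℝ}

lemma growth_le (hℓ : IsLength S ℓ) (hK : 0 < K) (hc : 0 < c) (hlow : ∀ x, K * c ^ ℓ x ≤ g x)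
    {s : ℝ} (hs : poincare ℓ g s ≠ ⊤) : growth ℓ g ≤ s := by
  refine limsup_le_of_poincare_ne_top hℓ.finite_sphere
    (fun x => le_trans (by positivity) (hlow x)) hK hc (fun n => ?_) hs
  obtain ⟨x, hx⟩ := hℓ.exists_eq n
  exact ⟨x, hx, hx ▸ hlow x⟩

lemma le_growth (hℓ : IsLength S ℓ) (hK : 0 < K) (hc : 0 < c) (hlow : ∀ x, K * c ^ ℓ x ≤ g x)
    {s t : ℝ} (ht : poincare ℓ g t ≠ ⊤) (hs : poincare ℓ g s = ⊤) : s ≤ growth ℓ g := by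
  have hg : ∀ x, 0 < g x := fun x => lt_of_lt_of_le (by positivity) (hlow x)
  refine le_limsup_of_poincare_eq_top hℓ.finite_sphere (fun x => (hg x).le) (fun n => ?_) ht hs
  obtain ⟨x, hx⟩ := hℓ.exists_eq n
  refine (summable_sphere hℓ.finite_sphere n).tsum_pos (fun y => ?_) x ?_
  · split_ifs
    · exact (hg y).le
    · exact le_rfl
  · rw [if_pos hx]
    exact hg x

end Growth

namespace Splitting

variable {M : Bool → Type*} [∀ i, Group (M i)] {Γ : Type*} [Group Γ] (D : Splitting M Γ)

/-- The weight `φ(x) e^{-s ℓ(x)}` of a letter. -/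
noncomputable def weight (ℓ : ∀ i, M i → ℕ) (φ : ∀ i, M i → ℝ) (s : ℝ) (i : Bool) (x : M i) :
    ENNReal :=
  ENNReal.ofReal (φ i x * Real.exp (-(s * ℓ i x)))

variable {ℓ : ∀ i, M i → ℕ} {φ : ∀ i, M i → ℝ}

lemma poincare_letter (h1 : ∀ i, φ i 1 = 1) (hℓ1 : ∀ i, ℓ i 1 = 0) {c : ℝ} (hc : 0 ≤ c) (s : ℝ)
    (i : Bool) :
    poincare (ℓ i) (fun x => c * φ i x) s =
      ENNReal.ofReal c * (1 + letterSum (weight ℓ φ s) i) := by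
  have h : ∀ x, ENNReal.ofReal (c * φ i x * Real.exp (-(s * ℓ i x))) =
      ENNReal.ofReal c * weight ℓ φ s i x := fun x => by
    rw [mul_assoc, ENNReal.ofReal_mul hc, weight]
  simp only [poincare, h, ENNReal.tsum_mul_left]
  congr 1
  rw [letterSum, ENNReal.tsum_eq_add_tsum_ite 1]
  congr 1
  simp [weight, h1, hℓ1]

lemma ofReal_ext_mul_exp (h1 : ∀ i, φ i 1 = 1) (hφ : ∀ i x, 0 ≤ φ i x) (hℓ1 : ∀ i, ℓ i 1 = 0)
    (s : ℝ) (g : Γ) :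
    ENNReal.ofReal (D.ext φ g * Real.exp (-(s * D.addExt ℓ g))) = D.ext (weight ℓ φ s) g := by
  induction g using D.induction with
  | one => simp [D.ext_one, D.addExt_one]
  | mul i x hx h hh ih =>
    rw [D.ext_mul h1 x hh, D.ext_mul (fun j => by simp [weight, h1, hℓ1]) x hh, ← ih,
      D.addExt_mul hℓ1 x hh, weight,
      ← ENNReal.ofReal_mul (mul_nonneg (hφ i x) (Real.exp_pos _).le)]
    congr 1
    push_cast
    rw [mul_add, neg_add, Real.exp_add]
    ring

lemma poincare_ext (h1 : ∀ i, φ i 1 = 1) (hφ : ∀ i x, 0 ≤ φ i x) (hℓ1 : ∀ i, ℓ i 1 = 0)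
    {c : ℝ} (hc : 0 ≤ c) (s : ℝ) :
    poincare (D.addExt ℓ) (fun g => c * D.ext φ g) s =
      ENNReal.ofReal c * ∑' g, D.ext (weight ℓ φ s) g := by
  rw [poincare, ← ENNReal.tsum_mul_left]
  refine tsum_congr fun g => ?_
  rw [mul_assoc, ENNReal.ofReal_mul hc, D.ofReal_ext_mul_exp h1 hφ hℓ1]

lemma exists_pow_le_ext (h1 : ∀ i, φ i 1 = 1) (hℓ1 : ∀ i, ℓ i 1 = 0)
    (hlow : ∀ i, ∃ c : ℝ, 0 < c ∧ ∀ x, c ^ ℓ i x ≤ φ i x) :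
    ∃ c : ℝ, 0 < c ∧ (∀ i x, c ^ ℓ i x ≤ φ i x) ∧ ∀ g, c ^ D.addExt ℓ g ≤ D.ext φ g := by
  choose b hb hbφ using hlow
  have hc : 0 < min (b false) (b true) := lt_min (hb _) (hb _)
  have hle : ∀ i x, min (b false) (b true) ^ ℓ i x ≤ φ i x := fun i x => by
    refine le_trans (pow_le_pow_left₀ hc.le ?_ _) (hbφ i x)
    cases i
    · exact min_le_left _ _
    · exact min_le_right _ _
  refine ⟨_, hc, hle, fun g => ?_⟩
  induction g using D.induction with
  | one => simp [D.ext_one, D.addExt_one]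
  | mul i x hx h hh ih =>
    rw [D.ext_mul h1 x hh, D.addExt_mul hℓ1 x hh, pow_add]
    exact mul_le_mul (hle i x) ih (by positivity) (le_trans (by positivity) (hle i x))

lemma infinite (D : Splitting M Γ) [∀ i, Infinite (M i)] : Infinite Γ :=
  Infinite.of_injective _ (D.ι_injective false)

lemma letterSum_weight_anti (hφ : ∀ i x, 0 ≤ φ i x) (i : Bool) :
    Antitone fun s => letterSum (weight ℓ φ s) i := by
  intro s t hst
  refine ENNReal.tsum_le_tsum fun x => ?_
  split_ifs
  · exact le_rfl
  · refine ENNReal.ofReal_le_ofReal (mul_le_mul_of_nonneg_left (Real.exp_le_exp.2 ?_) (hφ i x))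
    have : (0 : ℝ) ≤ ℓ i x := Nat.cast_nonneg _
    nlinarith

lemma letterSum_weight_pos [∀ i, Infinite (M i)] (hφ : ∀ i x, 0 < φ i x) (s : ℝ) (i : Bool) :
    0 < letterSum (weight ℓ φ s) i := by
  obtain ⟨x, hx⟩ := exists_ne (1 : M i)
  refine lt_of_lt_of_le ?_ (ENNReal.le_tsum x)
  rw [if_neg hx]
  exact ENNReal.ofReal_pos.2 (mul_pos (hφ i x) (Real.exp_pos _))

lemma lowerSemicontinuous_letterSum (i : Bool) :
    LowerSemicontinuous fun s => letterSum (weight ℓ φ s) i := by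
  refine lowerSemicontinuous_tsum fun x => Continuous.lowerSemicontinuous ?_
  by_cases hx : x = 1
  · simp only [hx, if_true]
    exact continuous_const
  · simp only [hx, if_false, weight]
    exact ENNReal.continuous_ofReal.comp (by fun_prop)

lemma continuousOn_letterSum (hφ : ∀ i x, 0 ≤ φ i x) (i : Bool) {a : ℝ}
    (ha : letterSum (weight ℓ φ a) i ≠ ⊤) :
    ContinuousOn (fun s => letterSum (weight ℓ φ s) i) (Set.Ici a) := by
  have hnn : ∀ s (x : M i), 0 ≤ if x = 1 then 0 else φ i x * Real.exp (-(s * ℓ i x)) :=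
    fun s x => by
      split_ifs
      · exact le_rfl
      · exact mul_nonneg (hφ i x) (Real.exp_pos _).le
  have heq : ∀ s, letterSum (weight ℓ φ s) i =
      ∑' x : M i, ENNReal.ofReal (if x = 1 then 0 else φ i x * Real.exp (-(s * ℓ i x))) :=
    fun s => tsum_congr fun x => by split_ifs <;> simp [weight]
  have hsum := (summable_iff_tsum_ofReal_ne_top (hnn a)).2 (heq a ▸ ha)
  have hle : ∀ x : M i, ∀ s ∈ Set.Ici a,
      (if x = 1 then 0 else φ i x * Real.exp (-(s * ℓ i x))) ≤
        if x = 1 then 0 else φ i x * Real.exp (-(a * ℓ i x)) := fun x s hs => by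
    split_ifs
    · exact le_rfl
    · refine mul_le_mul_of_nonneg_left (Real.exp_le_exp.2 ?_) (hφ i x)
      have : (0 : ℝ) ≤ ℓ i x := Nat.cast_nonneg _
      have : a ≤ s := hs
      nlinarith
  have hcont : ContinuousOn
      (fun s => ∑' x : M i, if x = 1 then 0 else φ i x * Real.exp (-(s * ℓ i x))) (Set.Ici a) := by
    refine continuousOn_tsum (fun x => ?_) hsum fun x s hs => ?_
    · split_ifs <;> fun_prop
    · rw [Real.norm_of_nonneg (hnn s x)]
      exact hle x s hs
  refine (ENNReal.continuous_ofReal.comp_continuousOn hcont).congr fun s hs => ?_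
  have := hsum.of_nonneg_of_le (hnn s) fun x => hle x s hs
  rw [heq s, Function.comp, ENNReal.ofReal_tsum_of_nonneg (hnn s) this]

variable {S : ∀ i, Finset (M i)} {T : Finset Γ}

/-- If both Poincaré series of the factors diverge at their critical exponents, then so does that
of the free product, and its critical exponent is strictly larger. -/
theorem growth_lt_and_divergent [∀ i, Infinite (M i)] (hS : ∀ i, IsLength (S i) (ℓ i))
    (hT : (T : Set Γ) = ⋃ i, D.ι i '' (S i)) (h1 : ∀ i, φ i 1 = 1)
    (hlow : ∀ i, ∃ b : ℝ, 0 < b ∧ ∀ x, b ^ ℓ i x ≤ φ i x) {c : ℝ} (hc : 0 < c)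
    (hopen : ∀ i s, letterSum (weight ℓ φ s) i ≠ ⊤ →
      ∃ δ > 0, letterSum (weight ℓ φ (s - δ)) i ≠ ⊤)
    (hzero : ∀ i, letterSum (weight ℓ φ 0) i ≠ ⊤) :
    poincare (D.addExt ℓ) (fun g => c * D.ext φ g)
        (growth (D.addExt ℓ) fun g => c * D.ext φ g) = ⊤ ∧
      ∀ i, growth (ℓ i) (fun x => c * φ i x) < growth (D.addExt ℓ) fun g => c * D.ext φ g := by
  have hℓ1 : ∀ i, ℓ i 1 = 0 := fun i => (hS i).one
  have hL := D.isLength_addExt hS hT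
  obtain ⟨b, hb, hbφ, hbg⟩ := D.exists_pow_le_ext h1 hℓ1 hlow
  have hpos : ∀ i x, 0 < φ i x := fun i x => lt_of_lt_of_le (by positivity) (hbφ i x)
  have hnn : ∀ i x, 0 ≤ φ i x := fun i x => (hpos i x).le
  have := D.infinite
  have hc0 : ENNReal.ofReal c ≠ 0 := (ENNReal.ofReal_pos.2 hc).ne'
  have htop : ∀ s, 1 ≤ letterSum (weight ℓ φ s) false * letterSum (weight ℓ φ s) true →
      poincare (D.addExt ℓ) (fun g => c * D.ext φ g) s = ⊤ := fun s hs => by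
    rw [D.poincare_ext h1 hnn hℓ1 hc.le, D.tsum_ext_eq_top hs, ENNReal.mul_top hc0]
  have hne : ∀ s, (∀ i, letterSum (weight ℓ φ s) i ≠ ⊤) →
      letterSum (weight ℓ φ s) false * letterSum (weight ℓ φ s) true < 1 →
      poincare (D.addExt ℓ) (fun g => c * D.ext φ g) s ≠ ⊤ := fun s hs hs' => by
    rw [D.poincare_ext h1 hnn hℓ1 hc.le]
    exact ENNReal.mul_ne_top ENNReal.ofReal_ne_top (D.tsum_ext_ne_top hs hs')
  have hlowg : ∀ g, c * b ^ D.addExt ℓ g ≤ c * D.ext φ g := fun g =>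
    mul_le_mul_of_nonneg_left (hbg g) hc.le
  have hlowi : ∀ i x, c * b ^ ℓ i x ≤ c * φ i x := fun i x =>
    mul_le_mul_of_nonneg_left (hbφ i x) hc.le
  obtain ⟨t, ht⟩ : ∃ t, poincare (D.addExt ℓ) (fun g => c * D.ext φ g) t ≠ ⊤ := by
    have hdecay : ∀ i t, 0 ≤ t → letterSum (weight ℓ φ t) i ≤
        ENNReal.ofReal (Real.exp (-t)) * letterSum (weight ℓ φ 0) i := fun i t ht => by
      rw [letterSum, letterSum, ← ENNReal.tsum_mul_left]
      refine ENNReal.tsum_le_tsum fun x => ?_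
      split_ifs with hx
      · simp
      · rw [weight, weight, ← ENNReal.ofReal_mul (Real.exp_pos _).le]
        refine ENNReal.ofReal_le_ofReal ?_
        have h1 : (1 : ℝ) ≤ ℓ i x := by exact_mod_cast (hS i).pos hx
        have : Real.exp (-(t * ℓ i x)) ≤ Real.exp (-t) := Real.exp_le_exp.2 (by nlinarith)
        simp only [zero_mul, neg_zero, Real.exp_zero, mul_one]
        nlinarith [hpos i x]
    set A := (letterSum (weight ℓ φ 0) false).toReal + (letterSum (weight ℓ φ 0) true).toReal
      with hA
    have hA0 : 0 ≤ A := by positivity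
    have hlt : ∀ i, letterSum (weight ℓ φ (Real.log (1 + A))) i < 1 := fun i => by
      refine (hdecay i _ (Real.log_nonneg (by linarith))).trans_lt ?_
      rw [← ENNReal.ofReal_toReal (hzero i), ← ENNReal.ofReal_mul (Real.exp_pos _).le,
        ← ENNReal.ofReal_one, ENNReal.ofReal_lt_ofReal_iff one_pos, Real.exp_neg,
        Real.exp_log (by linarith), inv_mul_lt_iff₀ (by linarith)]
      have h3 := @ENNReal.toReal_nonneg (letterSum (weight ℓ φ 0) false)
      have h4 := @ENNReal.toReal_nonneg (letterSum (weight ℓ φ 0) true)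
      cases i <;> simp only [hA] <;> linarith
    refine ⟨_, hne (Real.log (1 + A)) (fun i => ((hlt i).trans ENNReal.one_lt_top).ne) ?_⟩
    calc _ ≤ letterSum (weight ℓ φ (Real.log (1 + A))) false * 1 := by
          gcongr; exact (hlt true).le
      _ < 1 := by rw [mul_one]; exact hlt false
  refine ⟨?_, fun i => ?_⟩
  · by_contra hfin
    set ω := growth (D.addExt ℓ) fun g => c * D.ext φ g with hω
    have hprod : letterSum (weight ℓ φ ω) false * letterSum (weight ℓ φ ω) true < 1 :=
      not_le.1 fun h => hfin (htop _ h)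
    have hAω : ∀ i, letterSum (weight ℓ φ ω) i ≠ ⊤ := fun i hi => by
      have h0 := fun j => (letterSum_weight_pos (ℓ := ℓ) hpos ω j).ne'
      cases i
      · rw [hi, ENNReal.top_mul (h0 _)] at hprod
        exact absurd hprod (by simp)
      · rw [hi, ENNReal.mul_top (h0 _)] at hprod
        exact absurd hprod (by simp)
    choose δ hδ hδA using fun i => hopen i ω (hAω i)
    have hmin : 0 < min (δ false) (δ true) := lt_min (hδ _) (hδ _)
    have hAa : ∀ i, letterSum (weight ℓ φ (ω - min (δ false) (δ true))) i ≠ ⊤ := fun i =>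
      ne_top_of_le_ne_top (hδA i) (letterSum_weight_anti hnn i (by
        cases i
        · linarith [min_le_left (δ false) (δ true)]
        · linarith [min_le_right (δ false) (δ true)]))
    have hcont : ∀ i, ContinuousAt (fun s => letterSum (weight ℓ φ s) i) ω := fun i =>
      (continuousOn_letterSum hnn i (hAa i)).continuousAt (Ici_mem_nhds (by linarith))
    have hmul := ENNReal.Tendsto.mul (hcont false) (Or.inr (hAω true)) (hcont true)
      (Or.inr (hAω false))
    have hev := (hmul.eventually_lt_const hprod).and
      (Ici_mem_nhds (show ω - min (δ false) (δ true) < ω by linarith))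
    obtain ⟨s, ⟨hs, hsa⟩, hsω⟩ :=
      ((hev.filter_mono nhdsWithin_le_nhds).and (self_mem_nhdsWithin (s := Set.Iio ω))).exists
    refine absurd (growth_le hL hc hb hlowg (hne s (fun i => ne_top_of_le_ne_top (hAa i)
      (letterSum_weight_anti hnn i hsa)) hs)) (not_le.2 hsω)
  · set ω := growth (ℓ i) fun x => c * φ i x with hω
    have hAω : letterSum (weight ℓ φ ω) i = ⊤ := by
      by_contra h
      obtain ⟨δ, hδ, hδA⟩ := hopen i ω h
      have := growth_le (hS i) hc hb (hlowi i) (s := ω - δ) (by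
        rw [poincare_letter h1 hℓ1 hc.le]
        exact ENNReal.mul_ne_top ENNReal.ofReal_ne_top
          (ENNReal.add_ne_top.2 ⟨ENNReal.one_ne_top, hδA⟩))
      linarith
    set η := min (letterSum (weight ℓ φ (ω + 1)) (!i)) 1 with hη
    have hη0 : η ≠ 0 := (lt_min (letterSum_weight_pos hpos _ _) one_pos).ne'
    have hηt : η ≠ ⊤ := ne_top_of_le_ne_top ENNReal.one_ne_top (min_le_right _ _)
    have hev := (lowerSemicontinuous_letterSum (ℓ := ℓ) (φ := φ) i ω η⁻¹
      (hAω.symm ▸ ENNReal.inv_lt_top.2 (pos_iff_ne_zero.2 hη0) :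
        η⁻¹ < letterSum (weight ℓ φ ω) i)).and
      (Iic_mem_nhds (show ω < ω + 1 by linarith))
    obtain ⟨s, ⟨hs, hs1⟩, hsω⟩ :=
      ((hev.filter_mono nhdsWithin_le_nhds).and (self_mem_nhdsWithin (s := Set.Ioi ω))).exists
    refine lt_of_lt_of_le hsω (le_growth hL hc hb hlowg ht (htop s ?_))
    have hprod : 1 ≤ letterSum (weight ℓ φ s) i * letterSum (weight ℓ φ s) (!i) := by
      rw [← ENNReal.inv_mul_cancel hη0 hηt]
      exact mul_le_mul' hs.le ((min_le_left _ _).trans (letterSum_weight_anti hnn _ hs1))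
    cases i
    · exact hprod
    · rwa [mul_comm]

/-- If the Poincaré series of the factor `i` converges at its critical exponent `s₀` and
the product of the letter sums at `s₀` is less than one, then the free product has the same
critical exponent and its Poincaré series converges there. -/
theorem growth_eq_and_convergent [∀ i, Infinite (M i)] (hS : ∀ i, IsLength (S i) (ℓ i))
    (hT : (T : Set Γ) = ⋃ i, D.ι i '' (S i)) (h1 : ∀ i, φ i 1 = 1)
    (hlow : ∀ i, ∃ b : ℝ, 0 < b ∧ ∀ x, b ^ ℓ i x ≤ φ i x) {c : ℝ} (hc : 0 < c) {s₀ : ℝ}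
    (hfin : ∀ i, letterSum (weight ℓ φ s₀) i ≠ ⊤)
    (hprod : letterSum (weight ℓ φ s₀) false * letterSum (weight ℓ φ s₀) true < 1)
    (hinf : ∀ s < s₀, letterSum (weight ℓ φ s) false = ⊤) :
    poincare (D.addExt ℓ) (fun g => c * D.ext φ g)
        (growth (D.addExt ℓ) fun g => c * D.ext φ g) ≠ ⊤ ∧
      growth (ℓ false) (fun x => c * φ false x) = growth (D.addExt ℓ) fun g => c * D.ext φ g := by
  have hℓ1 : ∀ i, ℓ i 1 = 0 := fun i => (hS i).one
  have hL := D.isLength_addExt hS hT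
  obtain ⟨b, hb, hbφ, hbg⟩ := D.exists_pow_le_ext h1 hℓ1 hlow
  have hpos : ∀ i x, 0 < φ i x := fun i x => lt_of_lt_of_le (by positivity) (hbφ i x)
  have hnn : ∀ i x, 0 ≤ φ i x := fun i x => (hpos i x).le
  have := D.infinite
  have hc0 : ENNReal.ofReal c ≠ 0 := (ENNReal.ofReal_pos.2 hc).ne'
  have hlowg : ∀ g, c * b ^ D.addExt ℓ g ≤ c * D.ext φ g := fun g =>
    mul_le_mul_of_nonneg_left (hbg g) hc.le
  have hlowi : ∀ i x, c * b ^ ℓ i x ≤ c * φ i x := fun i x =>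
    mul_le_mul_of_nonneg_left (hbφ i x) hc.le
  have hΘ : poincare (D.addExt ℓ) (fun g => c * D.ext φ g) s₀ ≠ ⊤ := by
    rw [D.poincare_ext h1 hnn hℓ1 hc.le]
    exact ENNReal.mul_ne_top ENNReal.ofReal_ne_top (D.tsum_ext_ne_top hfin hprod)
  have hΘ' : ∀ s < s₀, poincare (D.addExt ℓ) (fun g => c * D.ext φ g) s = ⊤ := fun s hs => by
    rw [D.poincare_ext h1 hnn hℓ1 hc.le, D.tsum_ext_eq_top, ENNReal.mul_top hc0]
    rw [hinf s hs, ENNReal.top_mul (letterSum_weight_pos hpos _ _).ne']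
    exact le_top
  have hi : poincare (ℓ false) (fun x => c * φ false x) s₀ ≠ ⊤ := by
    rw [poincare_letter h1 hℓ1 hc.le]
    exact ENNReal.mul_ne_top ENNReal.ofReal_ne_top
      (ENNReal.add_ne_top.2 ⟨ENNReal.one_ne_top, hfin false⟩)
  have hi' : ∀ s < s₀, poincare (ℓ false) (fun x => c * φ false x) s = ⊤ := fun s hs => by
    rw [poincare_letter h1 hℓ1 hc.le, hinf s hs, add_top, ENNReal.mul_top hc0]
  have e1 : growth (D.addExt ℓ) (fun g => c * D.ext φ g) = s₀ :=
    le_antisymm (growth_le hL hc hb hlowg hΘ)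
      (le_of_forall_lt_imp_le_of_dense fun s hs => le_growth hL hc hb hlowg hΘ (hΘ' s hs))
  have e2 : growth (ℓ false) (fun x => c * φ false x) = s₀ :=
    le_antisymm (growth_le (hS _) hc hb (hlowi _) hi)
      (le_of_forall_lt_imp_le_of_dense fun s hs =>
        le_growth (hS _) hc hb (hlowi _) hi (hi' s hs))
  rw [e1, e2]
  exact ⟨hΘ, rfl⟩

lemma omegaRestricted_eq_growth (hS : ∀ i, IsLength (S i) (ℓ i))
    (hT : (T : Set Γ) = ⋃ i, D.ι i '' (S i)) (h1 : ∀ i, φ i 1 = 1) {c r : ℝ} {ν : Γ → ℝ}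
    (hν : ∀ g, green ν r g = c * D.ext φ g) (i : Bool) :
    omegaRestricted T ν (Set.range (D.ι i)) r = growth (ℓ i) fun x => c * φ i x := by
  rw [omegaRestricted, growth, (D.isLength_addExt hS hT).wordLength_eq]
  congr 1
  funext n
  congr 2
  rw [sphereSum, ← (D.ι_injective i).tsum_eq]
  · refine tsum_congr fun x => ?_
    simp only [Set.mem_range_self, true_and, D.addExt_ι (fun i => (hS i).one), hν, D.ext_ι h1]
  · intro g hg
    simp only [Function.mem_support, ne_eq, ite_eq_right_iff, not_forall] at hg
    exact hg.1.1

lemma greenGrowthRate_eq_growth (hS : ∀ i, IsLength (S i) (ℓ i))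
    (hT : (T : Set Γ) = ⋃ i, D.ι i '' (S i)) {c r : ℝ} {ν : Γ → ℝ}
    (hν : ∀ g, green ν r g = c * D.ext φ g) :
    greenGrowthRate T ν r = growth (D.addExt ℓ) fun g => c * D.ext φ g := by
  rw [greenGrowthRate, growth]
  congr 1
  funext n
  rw [greenSphereSum, (D.isLength_addExt hS hT).wordLength_eq, sphereSum]
  simp only [hν]

lemma summable_green_iff (hS : ∀ i, IsLength (S i) (ℓ i))
    (hT : (T : Set Γ) = ⋃ i, D.ι i '' (S i)) (hφ : ∀ i x, 0 ≤ φ i x) {c r : ℝ} (hc : 0 ≤ c)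
    {ν : Γ → ℝ} (hν : ∀ g, green ν r g = c * D.ext φ g) (s : ℝ) :
    Summable (fun g => green ν r g * Real.exp (-(s * (wordLength T g : ℝ)))) ↔
      poincare (D.addExt ℓ) (fun g => c * D.ext φ g) s ≠ ⊤ := by
  rw [(D.isLength_addExt hS hT).wordLength_eq, summable_iff_tsum_ofReal_ne_top, poincare]
  · simp only [hν]
  · intro g
    rw [hν]
    exact mul_nonneg (mul_nonneg hc (D.ext_nonneg hφ g)) (Real.exp_pos _).le

end Splitting

/-- The hitting function is bounded below by an exponential in the length. -/
lemma exists_pow_le_hitting {G : Type*} [Group G] {μ : G → ℝ} (hμ : IsFinMeasure μ) {r : ℝ}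
    (hr : 0 < r) (hG : GreenFinite μ r) (hadm : IsAdmissible μ) {S : Finset G} {ℓ : G → ℕ}
    (hℓ : IsLength S ℓ) : ∃ b : ℝ, 0 < b ∧ ∀ x, b ^ ℓ x ≤ hitting μ r x := by
  have hpos : ∀ x, 0 < hitting μ r x := fun x =>
    div_pos (green_pos hμ hr hG (hadm x)) (green_pos hμ hr hG (hadm 1))
  have hfin : ((S : Set G) ∪ (S : Set G)⁻¹).Finite := S.finite_toSet.union S.finite_toSet.inv
  obtain ⟨b, hb, hb1, hbS⟩ : ∃ b : ℝ, 0 < b ∧ b ≤ 1 ∧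
      ∀ s ∈ (S : Set G) ∪ (S : Set G)⁻¹, b ≤ hitting μ r s := by
    generalize (S : Set G) ∪ (S : Set G)⁻¹ = B at hfin
    induction B, hfin using Set.Finite.induction_on with
    | empty => exact ⟨1, one_pos, le_rfl, by simp⟩
    | @insert a s ha hs ih =>
      obtain ⟨b, hb, hb1, h⟩ := ih
      refine ⟨min b (hitting μ r a), lt_min hb (hpos a), (min_le_left _ _).trans hb1, ?_⟩
      rintro x (rfl | hx)
      · exact min_le_right _ _
      · exact (min_le_left _ _).trans (h x hx)
  refine ⟨b, hb, fun x => ?_⟩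
  induction hn : ℓ x using Nat.strong_induction_on generalizing x with
  | _ n ih =>
    by_cases hx : x = 1
    · rw [hx, hitting_one hμ hr.le hG]
      exact pow_le_one₀ hb.le hb1
    · obtain ⟨s, hs, y, rfl, hy⟩ := hℓ.exists_decr x hx
      refine le_trans ?_ (hitting_mul_le hμ hr hG s y)
      calc b ^ n ≤ b ^ (ℓ y + 1) := pow_le_pow_of_le_one hb.le hb1 (by omega)
        _ = b * b ^ ℓ y := by ring
        _ ≤ _ := mul_le_mul (hbS s hs) (ih (ℓ y) (by omega) y rfl) (by positivity) (hpos s).le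

end Phases

end

section

section DiracSums

variable {G : Type*} {J : Type*} [Fintype J]

/-- The measure with mass `c j` at each of the points `p j`. -/
noncomputable def diracSum (p : J → G) (c : J → ℝ) (y : G) : ℝ :=
  ∑ j, if y = p j then c j else 0

lemma isFinMeasure_diracSum (p : J → G) {c : J → ℝ} (hc : ∀ j, 0 ≤ c j) :
    IsFinMeasure (diracSum p c) where
  nonneg y := Finset.sum_nonneg fun j _ => by
    split_ifs
    · exact hc j
    · exact le_rfl
  finite := by
    refine (Set.finite_range p).subset fun y hy => ?_
    obtain ⟨j, -, hj⟩ := Finset.exists_ne_zero_of_sum_ne_zero hy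
    by_contra h
    exact hj (if_neg fun e => h ⟨j, e.symm⟩)

lemma hasSum_diracSum_mul (p : J → G) (c : J → ℝ) (f : G → ℝ) :
    HasSum (fun y => diracSum p c y * f y) (∑ j, c j * f (p j)) := by
  have : ∀ y, diracSum p c y * f y = ∑ j, if y = p j then c j * f (p j) else 0 := fun y => by
    rw [diracSum, Finset.sum_mul]
    refine Finset.sum_congr rfl fun j _ => ?_
    split_ifs with h
    · rw [h]
    · rw [zero_mul]
  simp only [this]
  exact hasSum_sum fun j _ => hasSum_ite_eq (p j) _

lemma tsum_diracSum (p : J → G) (c : J → ℝ) : ∑' y, diracSum p c y = ∑ j, c j := by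
  simpa using (hasSum_diracSum_mul p c fun _ => 1).tsum_eq

lemma lconv_diracSum [Group G] (p : J → G) (c : J → ℝ) (f : G → ℝ) (x : G) :
    lconv (diracSum p c) f x = ∑ j, c j * f ((p j)⁻¹ * x) :=
  (hasSum_diracSum_mul p c fun y => f (y⁻¹ * x)).tsum_eq

lemma IsLength.isAdmissible [Group G] {μ : G → ℝ} (hμ : IsFinMeasure μ) {S : Finset G} {ℓ : G → ℕ}
    (hℓ : IsLength S ℓ) (hS : ∀ s ∈ (S : Set G) ∪ (S : Set G)⁻¹, 0 < μ s) : IsAdmissible μ := by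
  intro x
  induction hn : ℓ x using Nat.strong_induction_on generalizing x with
  | _ n ih =>
    by_cases hx : x = 1
    · exact ⟨0, by simp [convPow, hx]⟩
    · obtain ⟨s, hs, y, rfl, hy⟩ := hℓ.exists_decr x hx
      obtain ⟨k, hk⟩ := ih (ℓ y) (by omega) y rfl
      refine ⟨k + 1, ?_⟩
      change 0 < lconv μ (convPow μ k) (s * y)
      rw [lconv_eq_sum hμ.finite]
      refine Finset.sum_pos' (fun z _ => mul_nonneg (hμ.nonneg z) (convPow_nonneg hμ _ _))
        ⟨s, ?_, ?_⟩
      · simpa using (hS s hs).ne'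
      · rw [inv_mul_cancel_left]
        exact mul_pos (hS s hs) hk

end DiracSums

section FreeGroups

open FreeGroup

variable {k : ℕ}

/-- The steps of the lazy walk on the free group. -/
def freeStep (k : ℕ) : Option (Fin k × Bool) → FreeGroup (Fin k)
  | none => 1
  | some a => FreeGroup.mk [a]

/-- The weights of the steps of the lazy walk on the free group. -/
noncomputable def freeMass (k : ℕ) : Option (Fin k × Bool) → ℝ
  | none => 1 / 2
  | some _ => 1 / (4 * k)

lemma freeStep_injective : Function.Injective (freeStep k) := by
  have h : ∀ a, (freeStep k a).toWord = a.toList := by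
    rintro (_ | a)
    · simp [freeStep]
    · simp [freeStep]
  intro a b hab
  have := congrArg toWord hab
  rw [h, h] at this
  cases a <;> cases b <;> simp_all

lemma exists_freeStep_iff (x : FreeGroup (Fin k)) :
    (∃ i : Fin k, x = FreeGroup.of i ∨ x = (FreeGroup.of i)⁻¹) ↔ ∃ a, x = freeStep k (some a) := by
  constructor
  · rintro ⟨i, rfl | rfl⟩
    · exact ⟨(i, true), rfl⟩
    · exact ⟨(i, false), rfl⟩
  · rintro ⟨⟨i, _ | _⟩, rfl⟩
    · exact ⟨i, Or.inr rfl⟩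
    · exact ⟨i, Or.inl rfl⟩

lemma lazyFreeSRW_eq_diracSum : lazyFreeSRW k = diracSum (freeStep k) (freeMass k) := by
  have key : ∀ a, diracSum (freeStep k) (freeMass k) (freeStep k a) = freeMass k a := fun a => by
    simp [diracSum, freeStep_injective.eq_iff]
  funext x
  rw [lazyFreeSRW]
  simp only [exists_freeStep_iff]
  split_ifs with h1 h2
  · rw [h1]
    exact (key none).symm
  · obtain ⟨a, rfl⟩ := h2
    exact (key (some a)).symm
  · refine (Finset.sum_eq_zero fun a _ => if_neg fun h => ?_).symm
    cases a with
    | none => exact h1 h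
    | some a => exact h2 ⟨a, h⟩

/-- The action of the lazy walk on radial functions of the free group. -/
noncomputable def radial (k : ℕ) (u : ℕ → ℝ) : ℕ → ℝ
  | 0 => u 0 / 2 + u 1 / 2
  | j + 1 => u (j + 1) / 2 + (u j + (2 * k - 1) * u (j + 2)) / (4 * k)

lemma sum_freeStep (hk : 0 < k) (u : ℕ → ℝ) (x : FreeGroup (Fin k)) :
    ∑ a, freeMass k a * u (norm ((freeStep k a)⁻¹ * x)) = radial k u (norm x) := by
  have hk' : (k : ℝ) ≠ 0 := by positivity
  have hinv : ∀ a : Fin k × Bool, (freeStep k (some a))⁻¹ = FreeGroup.mk [(a.1, !a.2)] :=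
    fun a => rfl
  have hword : ∀ a : Fin k × Bool, (FreeGroup.mk [a] * x).toWord = reduce (a :: x.toWord) :=
    fun a => by rw [toWord_mul]; simp
  rw [Fintype.sum_option]
  simp only [freeStep, freeMass, inv_one, one_mul] at hinv ⊢
  simp only [hinv, FreeGroup.norm, hword]
  simp only [reduce.cons, reduce_toWord]
  cases x.toWord with
  | nil =>
    simp only [List.length_nil, List.length_singleton, radial, Finset.sum_const,
      Finset.card_univ, Fintype.card_prod, Fintype.card_fin, Fintype.card_bool, nsmul_eq_mul]
    push_cast
    field_simp
    ring
  | cons b l =>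
    have : ∀ a : Fin k × Bool, 1 / (4 * (k : ℝ)) *
        u (if a.1 = b.1 ∧ (!a.2) = !b.2 then l else (a.1, !a.2) :: b :: l).length =
        1 / (4 * (k : ℝ)) * u (l.length + 2) +
          if a = b then 1 / (4 * (k : ℝ)) * (u l.length - u (l.length + 2)) else 0 := fun a => by
      by_cases h : a = b
      · subst h
        simp
        ring
      · rw [if_neg, if_neg h]
        · simp
        · rintro ⟨h1, h2⟩
          exact h (Prod.ext h1 (by simpa using h2))
    simp only [this, Finset.sum_add_distrib, Finset.sum_ite_eq', Finset.mem_univ, if_true,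
      List.length_cons, radial, Finset.sum_const, Finset.card_univ, Fintype.card_prod,
      Fintype.card_fin, Fintype.card_bool, nsmul_eq_mul]
    push_cast
    field_simp
    ring

variable {n m : ℕ} {α₁ α₂ : ℝ}

lemma biFreeMu_eq_diracSum :
    biFreeMu n m α₁ α₂ = diracSum
      (Sum.elim (fun a => ((freeStep n a, 1) : BiFree n m)) fun b => (1, freeStep m b))
      (Sum.elim (fun a => α₁ * freeMass n a) fun b => α₂ * freeMass m b) := by
  funext z
  rw [biFreeMu, lazyFreeSRW_eq_diracSum, lazyFreeSRW_eq_diracSum, diracSum, diracSum, diracSum,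
    Fintype.sum_sum_type]
  simp only [Sum.elim_inl, Sum.elim_inr, Prod.ext_iff]
  congr 1
  · by_cases h : z.2 = 1 <;> simp [h, -Fintype.sum_option, Finset.mul_sum]
  · by_cases h : z.1 = 1 <;> simp [h, -Fintype.sum_option, Finset.mul_sum]

lemma freeMass_nonneg (a : Option (Fin k × Bool)) : 0 ≤ freeMass k a := by
  cases a <;> simp only [freeMass] <;> positivity

lemma isFinMeasure_biFreeMu (h₁ : 0 ≤ α₁) (h₂ : 0 ≤ α₂) : IsFinMeasure (biFreeMu n m α₁ α₂) := by
  rw [biFreeMu_eq_diracSum]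
  refine isFinMeasure_diracSum _ ?_
  rintro (a | b)
  · exact mul_nonneg h₁ (freeMass_nonneg a)
  · exact mul_nonneg h₂ (freeMass_nonneg b)

lemma lconv_biFreeMu (hn : 0 < n) (hm : 0 < m) (u v : ℕ → ℝ) (z : BiFree n m) :
    lconv (biFreeMu n m α₁ α₂) (fun y => u (norm y.1) * v (norm y.2)) z =
      α₁ * (radial n u (norm z.1) * v (norm z.2)) +
        α₂ * (u (norm z.1) * radial m v (norm z.2)) := by
  rw [biFreeMu_eq_diracSum, lconv_diracSum, Fintype.sum_sum_type, ← sum_freeStep hn,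
    ← sum_freeStep hm, Finset.sum_mul, Finset.mul_sum, Finset.mul_sum, Finset.mul_sum]
  congr 1
  · refine Finset.sum_congr rfl fun a _ => ?_
    simp only [Sum.elim_inl, Prod.fst_mul, Prod.snd_mul, Prod.fst_inv, Prod.snd_inv, inv_one,
      one_mul]
    ring
  · refine Finset.sum_congr rfl fun a _ => ?_
    simp only [Sum.elim_inr, Prod.fst_mul, Prod.snd_mul, Prod.fst_inv, Prod.snd_inv, inv_one,
      one_mul]
    ring

lemma tsum_biFreeMu (hn : 0 < n) (hm : 0 < m) (hα : α₁ + α₂ = 1) :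
    ∑' z, biFreeMu n m α₁ α₂ z = 1 := by
  have h : ∀ {k : ℕ}, 0 < k → ∑ a, freeMass k a = 1 := fun {k} hk => by
    have hk' : (k : ℝ) ≠ 0 := by positivity
    rw [Fintype.sum_option]
    simp [freeMass]
    field_simp
    ring
  rw [biFreeMu_eq_diracSum, tsum_diracSum, Fintype.sum_sum_type]
  simp only [Sum.elim_inl, Sum.elim_inr]
  rw [← Finset.mul_sum, ← Finset.mul_sum, h hn, h hm]
  linarith

lemma biFreeMu_one_pos (h₁ : 0 < α₁) (h₂ : 0 < α₂) : 0 < biFreeMu n m α₁ α₂ 1 := by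
  simp only [biFreeMu, Prod.fst_one, Prod.snd_one, if_true, lazyFreeSRW]
  positivity

lemma mem_biFreeGens_or_inv_iff (z : BiFree n m) :
    z ∈ (biFreeGens n m : Set (BiFree n m)) ∪ (biFreeGens n m : Set (BiFree n m))⁻¹ ↔
      (∃ a, z = (freeStep n (some a), 1)) ∨ ∃ b, z = (1, freeStep m (some b)) := by
  simp only [biFreeGens, Finset.coe_union, Finset.coe_image, Finset.coe_univ, Set.image_univ,
    Set.mem_union, Set.mem_inv, Set.mem_range]
  constructor
  · rintro ((⟨i, rfl⟩ | ⟨i, rfl⟩) | (⟨i, h⟩ | ⟨i, h⟩))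
    · exact Or.inl ⟨(i, true), rfl⟩
    · exact Or.inr ⟨(i, true), rfl⟩
    · exact Or.inl ⟨(i, false), by rw [← inv_inv z, ← h]; simp [freeStep, FreeGroup.of, invRev]⟩
    · exact Or.inr ⟨(i, false), by rw [← inv_inv z, ← h]; simp [freeStep, FreeGroup.of, invRev]⟩
  · rintro (⟨⟨i, _ | _⟩, rfl⟩ | ⟨⟨i, _ | _⟩, rfl⟩)
    · exact Or.inr (Or.inl ⟨i, by simp [freeStep, FreeGroup.of, invRev]⟩)
    · exact Or.inl (Or.inl ⟨i, rfl⟩)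
    · exact Or.inr (Or.inr ⟨i, by simp [freeStep, FreeGroup.of, invRev]⟩)
    · exact Or.inl (Or.inr ⟨i, rfl⟩)

lemma norm_freeStep_mul_le (a : Fin k × Bool) (x : FreeGroup (Fin k)) :
    norm (freeStep k (some a) * x) ≤ norm x + 1 := by
  refine (FreeGroup.norm_mul_le _ _).trans ?_
  have : norm (freeStep k (some a)) ≤ 1 := norm_mk_le
  omega

lemma exists_freeStep_mul {x : FreeGroup (Fin k)} (hx : x ≠ 1) :
    ∃ a y, x = freeStep k (some a) * y ∧ norm y + 1 ≤ norm x := by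
  cases h : x.toWord with
  | nil => exact absurd (toWord_eq_nil_iff.1 h) hx
  | cons a l =>
    refine ⟨a, FreeGroup.mk l, ?_, ?_⟩
    · rw [← mk_toWord (x := x), h, freeStep, mul_mk]
      rfl
    · have : norm (FreeGroup.mk l) ≤ l.length := norm_mk_le
      simp only [FreeGroup.norm, h, List.length_cons] at this ⊢
      omega

lemma isLength_biFreeGens :
    IsLength (biFreeGens n m) fun z : BiFree n m => norm z.1 + norm z.2 where
  one := by simp
  le_succ s hs x := by
    rcases (mem_biFreeGens_or_inv_iff s).1 hs with ⟨a, rfl⟩ | ⟨a, rfl⟩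
    · have := norm_freeStep_mul_le a x.1
      simp only [Prod.fst_mul, Prod.snd_mul, one_mul]
      omega
    · have := norm_freeStep_mul_le a x.2
      simp only [Prod.fst_mul, Prod.snd_mul, one_mul]
      omega
  exists_decr x hx := by
    by_cases h : x.1 = 1
    · have h2 : x.2 ≠ 1 := fun h2 => hx (Prod.ext h h2)
      obtain ⟨a, y, e, hy⟩ := exists_freeStep_mul h2
      refine ⟨(1, freeStep m (some a)), (mem_biFreeGens_or_inv_iff _).2 (Or.inr ⟨a, rfl⟩),
        (x.1, y), Prod.ext (by simp) (by simpa using e), ?_⟩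
      simp only
      omega
    · obtain ⟨a, y, e, hy⟩ := exists_freeStep_mul h
      refine ⟨(freeStep n (some a), 1), (mem_biFreeGens_or_inv_iff _).2 (Or.inl ⟨a, rfl⟩),
        (y, x.2), Prod.ext (by simpa using e) (by simp), ?_⟩
      simp only
      omega

lemma isAdmissible_biFreeMu (hn : 0 < n) (hm : 0 < m) (h₁ : 0 < α₁) (h₂ : 0 < α₂) :
    IsAdmissible (biFreeMu n m α₁ α₂) := by
  refine isLength_biFreeGens.isAdmissible (isFinMeasure_biFreeMu h₁.le h₂.le) fun s hs => ?_
  have hle : ∀ j, (Sum.elim (fun a => α₁ * freeMass n a) fun b => α₂ * freeMass m b) j ≤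
      biFreeMu n m α₁ α₂ ((Sum.elim (fun a => ((freeStep n a, 1) : BiFree n m))
        fun b => (1, freeStep m b)) j) := fun j => by
    rw [biFreeMu_eq_diracSum, diracSum]
    refine le_trans (le_of_eq ?_) (Finset.single_le_sum (fun i _ => ?_) (Finset.mem_univ j))
    · rw [if_pos rfl]
    · split_ifs
      · rcases i with a | b
        · exact mul_nonneg h₁.le (freeMass_nonneg a)
        · exact mul_nonneg h₂.le (freeMass_nonneg b)
      · exact le_rfl
  rcases (mem_biFreeGens_or_inv_iff s).1 hs with ⟨a, rfl⟩ | ⟨b, rfl⟩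
  · refine lt_of_lt_of_le ?_ (hle (Sum.inl (some a)))
    simp only [Sum.elim_inl, freeMass]
    positivity
  · refine lt_of_lt_of_le ?_ (hle (Sum.inr (some b)))
    simp only [Sum.elim_inr, freeMass]
    positivity

end FreeGroups

end

section

section RadialSequences

/-- The eigenvalue of the lazy walk on the free group associated with `a ^ |x|`. -/
noncomputable def drift (k : ℕ) (a : ℝ) : ℝ := 1 / 2 + (1 / a + (2 * k - 1) * a) / (4 * k)

variable {k : ℕ} {a b : ℝ}

lemma drift_sub (hk : 0 < k) (ha : 0 < a) (hb : 0 < b) :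
    drift k a - drift k b = (a - b) * ((2 * k - 1) * (a * b) - 1) / (4 * k * (a * b)) := by
  have : (k : ℝ) ≠ 0 := by positivity
  rw [drift, drift]
  field_simp
  ring

lemma drift_lt_of_lt (hk : 0 < k) (hb : 0 < b) (hab : b < a) (h : 1 < (2 * k - 1) * (a * b)) :
    drift k b < drift k a := by
  have ha := hb.trans hab
  rw [← sub_pos, drift_sub hk ha hb]
  have : (0 : ℝ) < k := by positivity
  exact div_pos (mul_pos (sub_pos.2 hab) (sub_pos.2 h)) (by positivity)

lemma drift_lt_of_gt (hk : 0 < k) (hb : 0 < b) (hab : b < a) (h : (2 * k - 1) * (a * b) < 1) :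
    drift k a < drift k b := by
  have ha := hb.trans hab
  rw [← sub_neg, drift_sub hk ha hb]
  have : (0 : ℝ) < k := by positivity
  exact div_neg_of_neg_of_pos (mul_neg_of_pos_of_neg (sub_pos.2 hab) (sub_neg.2 h))
    (by positivity)

lemma drift_eq_of_mul_eq_one (hk : 0 < k) (ha : 0 < a) (hb : 0 < b)
    (h : (2 * k - 1) * (a * b) = 1) : drift k a = drift k b := by
  rw [← sub_eq_zero, drift_sub hk ha hb, h]
  simp

lemma drift_one (hk : 0 < k) : drift k 1 = 1 := by
  have : (k : ℝ) ≠ 0 := by positivity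
  rw [drift]
  field_simp
  ring

lemma drift_pos (hk : 0 < k) (ha : 0 < a) : 0 < drift k a := by
  have : (1 : ℝ) ≤ k := by exact_mod_cast hk
  have : (0 : ℝ) < 2 * k - 1 := by linarith
  rw [drift]
  positivity

lemma lt_drift (hk : 0 < k) (ha : 0 < a) (ha1 : a < 1) : 1 / 2 + a / 2 < drift k a := by
  have hk' : (0 : ℝ) < k := by positivity
  have : drift k a - (1 / 2 + a / 2) = (1 - a) * (1 + a) / (4 * k * a) := by
    rw [drift]
    field_simp
    ring
  have h2 : 0 < (1 - a) * (1 + a) / (4 * k * a) :=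
    div_pos (mul_pos (by linarith) (by linarith)) (by positivity)
  linarith

lemma radial_pow_succ (ha : a ≠ 0) (j : ℕ) :
    radial k (fun i => a ^ i) (j + 1) = drift k a * a ^ (j + 1) := by
  rw [radial, drift]
  have : a ^ j = 1 / a * a ^ (j + 1) := by
    rw [pow_succ]
    field_simp
  rw [this, pow_succ a (j + 1)]
  ring

lemma radial_pow_zero : radial k (fun i => a ^ i) 0 = 1 / 2 + a / 2 := by
  simp [radial]

lemma radial_pow_le (hk : 0 < k) (ha : 0 < a) (ha1 : a < 1) (j : ℕ) :
    radial k (fun i => a ^ i) j ≤ drift k a * a ^ j := by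
  cases j with
  | zero => simpa [radial_pow_zero] using (lt_drift hk ha ha1).le
  | succ j => exact (radial_pow_succ ha.ne' j).le

lemma radial_sub (c : ℝ) (u v : ℕ → ℝ) (j : ℕ) :
    radial k (fun i => c * u i - v i) j = c * radial k u j - radial k v j := by
  cases j <;> simp only [radial] <;> ring

/-- A concave bump function on the natural numbers. -/
noncomputable def tent (K j : ℕ) : ℝ := max 0 ((j + 1) * (K - j))

lemma tent_nonneg (K j : ℕ) : 0 ≤ tent K j := le_max_left _ _

lemma tent_zero (K : ℕ) : tent K 0 = K := by simp [tent]

lemma tent_one {K : ℕ} (hK : 1 ≤ K) : tent K 1 = 2 * (K - 1) := by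
  have : (1 : ℝ) ≤ K := by exact_mod_cast hK
  rw [tent, Nat.cast_one, max_eq_right (mul_nonneg (by norm_num) (by linarith))]
  ring

lemma tent_succ {K j : ℕ} (h0 : 0 < tent K (j + 1)) :
    (K : ℝ) ≤ tent K (j + 1) ∧ 2 * tent K (j + 1) - 2 ≤ tent K j + tent K (j + 2) := by
  have hv : tent K (j + 1) = (j + 2) * (K - (j + 1)) := by
    simp only [tent] at h0 ⊢
    rcases lt_max_iff.1 h0 with h | h
    · exact absurd h (lt_irrefl _)
    · rw [max_eq_right h.le]
      push_cast
      ring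
  have hj : (0 : ℝ) ≤ j := Nat.cast_nonneg j
  have hpos : 0 < (K : ℝ) - (j + 1) := by
    rw [hv] at h0
    exact (mul_pos_iff_of_pos_left (by linarith)).1 h0
  have hjK : (j : ℝ) + 2 ≤ K := by
    have : (j + 1 : ℕ) < K := by
      have : ((j + 1 : ℕ) : ℝ) < K := by push_cast; linarith
      exact_mod_cast this
    exact_mod_cast this
  have e1 : ((j : ℝ) + 1) * (K - j) ≤ tent K j := le_max_right _ _
  have e2 : ((j : ℝ) + 3) * (K - (j + 2)) ≤ tent K (j + 2) := by
    refine le_trans (le_of_eq ?_) (le_max_right _ _)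
    push_cast
    ring
  rw [hv]
  constructor
  · have : 0 ≤ ((j : ℝ) + 1) * (K - (j + 2)) := mul_nonneg (by linarith) (by linarith)
    linarith
  · linarith

/-- At the bottom of the spectrum, an approximate eigenfunction with finite support. -/
lemma le_radial_tent (hk : 0 < k) {σ ε : ℝ} (hσ0 : 0 < σ) (hσ : (2 * k - 1) * (σ * σ) = 1)
    (hε : 0 ≤ ε) {K : ℕ} (hK1 : 2 * (k : ℝ) ≤ K) (hK2 : 1 / (2 * k * σ) ≤ K * ε) (j : ℕ) :
    (drift k σ - ε) * (σ ^ j * tent K j) ≤ radial k (fun i => σ ^ i * tent K i) j := by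
  have hk' : (1 : ℝ) ≤ k := by exact_mod_cast hk
  have hp : (2 * k - 1) * σ = 1 / σ := by
    field_simp
    linarith
  have hρ : drift k σ = 1 / 2 + 1 / (2 * k * σ) := by
    rw [drift, hp]
    field_simp
    ring
  rw [hρ]
  cases j with
  | zero =>
    have hK : 1 ≤ K := by
      have : (1 : ℝ) ≤ K := by linarith
      exact_mod_cast this
    have e2 : K * (1 / (2 * k * σ)) ≤ σ * (K - 1) := by
      have : 1 / (2 * k * σ) = (2 * k - 1) * σ / (2 * k) := by
        rw [hp]
        field_simp
      rw [this, ← mul_div_assoc, div_le_iff₀ (by positivity)]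
      nlinarith
    simp only [radial, pow_zero, one_mul, pow_one, tent_zero, tent_one hK]
    have : 0 ≤ ε * K := by positivity
    linarith
  | succ j =>
    have e : radial k (fun i => σ ^ i * tent K i) (j + 1) =
        σ ^ (j + 1) * (tent K (j + 1) / 2 + (tent K j + tent K (j + 2)) / (4 * k * σ)) := by
      have h3 : (2 * k - 1) * σ ^ (j + 2) = σ ^ j := by
        rw [pow_add]
        linear_combination σ ^ j * hσ
      simp only [radial]
      rw [← mul_assoc (2 * (k : ℝ) - 1), h3, pow_succ]
      field_simp
    rw [e]
    have key : (1 / 2 + 1 / (2 * k * σ) - ε) * tent K (j + 1) ≤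
        tent K (j + 1) / 2 + (tent K j + tent K (j + 2)) / (4 * k * σ) := by
      rcases (tent_nonneg K (j + 1)).eq_or_lt with h0 | h0
      · rw [← h0]
        have := tent_nonneg K j
        have := tent_nonneg K (j + 2)
        have : 0 ≤ (tent K j + tent K (j + 2)) / (4 * k * σ) := by positivity
        linarith
      · obtain ⟨h2, h3⟩ := tent_succ h0
        have h4 : (2 * tent K (j + 1) - 2) / (4 * k * σ) ≤
            (tent K j + tent K (j + 2)) / (4 * k * σ) := by
          gcongr
        have h5 : (2 * tent K (j + 1) - 2) / (4 * k * σ) =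
            1 / (2 * k * σ) * tent K (j + 1) - 1 / (2 * k * σ) := by
          field_simp
          ring
        have h6 : K * ε ≤ tent K (j + 1) * ε := mul_le_mul_of_nonneg_right h2 hε
        linarith
    calc _ = σ ^ (j + 1) * ((1 / 2 + 1 / (2 * k * σ) - ε) * tent K (j + 1)) := by ring
      _ ≤ _ := by gcongr

end RadialSequences

section ProductPhase

variable {G : Type*} [Group G] {μ : G → ℝ} {N₁ N₂ : G → ℕ} {n m : ℕ} {α₁ α₂ : ℝ}

lemma greenFinite_of_supersolution (hμ : IsFinMeasure μ) {t r C : ℝ} (ht : 0 ≤ t) (hr : 0 ≤ r)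
    (hrt : r * t < 1) {Ψ : G → ℝ} (hC : 0 ≤ C) (h1 : ∀ x, (if x = 1 then 1 else 0) ≤ C * Ψ x)
    (hΨ : ∀ x, lconv μ Ψ x ≤ t * Ψ x) : GreenFinite μ r := fun x => by
  refine Summable.of_nonneg_of_le (fun j => mul_nonneg (pow_nonneg hr j) (convPow_nonneg hμ j x))
    (fun j => ?_) ((summable_geometric_of_lt_one (mul_nonneg hr ht) hrt).mul_left (C * Ψ x))
  calc r ^ j * convPow μ j x ≤ r ^ j * (C * t ^ j * Ψ x) :=
        mul_le_mul_of_nonneg_left (convPow_le hμ ht hC h1 hΨ j x) (pow_nonneg hr j)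
    _ = C * Ψ x * (r * t) ^ j := by rw [mul_pow]; ring

/-- `μ` acts on tensor products of radial functions as a product walk. -/
def IsBiradial (μ : G → ℝ) (N₁ N₂ : G → ℕ) (n m : ℕ) (α₁ α₂ : ℝ) : Prop :=
  ∀ (u v : ℕ → ℝ) (z : G), lconv μ (fun y => u (N₁ y) * v (N₂ y)) z =
    α₁ * (radial n u (N₁ z) * v (N₂ z)) + α₂ * (u (N₁ z) * radial m v (N₂ z))

lemma IsBiradial.greenFinite (hL : IsBiradial μ N₁ N₂ n m α₁ α₂)
    (hμ : IsFinMeasure μ) (hn : 0 < n) (hm : 0 < m) (h₁ : 0 < α₁)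
    (h₂ : 0 < α₂) (hN₁ : N₁ 1 = 0) (hN₂ : N₂ 1 = 0) {a σ r : ℝ} (ha : 0 < a) (ha1 : a < 1)
    (hσ : 0 < σ) (hσ1 : σ < 1) (hr : 0 ≤ r)
    (hrt : r * (α₁ * drift n a + α₂ * drift m σ) < 1) : GreenFinite μ r := by
  have hda := drift_pos hn ha
  have hds := drift_pos hm hσ
  refine greenFinite_of_supersolution hμ (t := α₁ * drift n a + α₂ * drift m σ) (by positivity) hr
    hrt (C := 1) (Ψ := fun z => a ^ N₁ z * σ ^ N₂ z) zero_le_one (fun x => ?_) fun x => ?_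
  · split_ifs with hx
    · simp [hx, hN₁, hN₂]
    · positivity
  · rw [hL (fun i => a ^ i) (fun i => σ ^ i)]
    have e1 := radial_pow_le hn ha ha1 (N₁ x)
    have e2 := radial_pow_le hm hσ hσ1 (N₂ x)
    calc _ ≤ α₁ * (drift n a * a ^ N₁ x * σ ^ N₂ x) + α₂ * (a ^ N₁ x * (drift m σ * σ ^ N₂ x)) := by
          gcongr
      _ = _ := by ring

lemma IsBiradial.tsum_green_ne_top (hL : IsBiradial μ N₁ N₂ n m α₁ α₂)
    (hμ : IsFinMeasure μ) (hn : 0 < n) (hm : 0 < m) (h₁ : 0 < α₁)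
    (h₂ : 0 < α₂) (hinv₁ : ∀ z, N₁ z⁻¹ = N₁ z) (hinv₂ : ∀ z, N₂ z⁻¹ = N₂ z) {a σ : ℝ}
    (ha : 0 < a) (haσ : a < σ) (hσ1 : σ < 1) (hσ : (2 * m - 1) * (σ * σ) = 1)
    (hG : GreenFinite μ (α₁ * drift n a + α₂ * drift m σ)⁻¹) :
    ∑' z, ENNReal.ofReal (green μ (α₁ * drift n a + α₂ * drift m σ)⁻¹ z * a ^ (N₁ z + N₂ z)) ≠
      ⊤ := by
  have hσ0 := ha.trans haσ
  have ha1 := haσ.trans hσ1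
  have hda := drift_pos hn ha
  have hds := drift_pos hm hσ0
  set t := α₁ * drift n a + α₂ * drift m σ with ht
  have ht0 : 0 < t := by positivity
  have hp : (0 : ℝ) < 2 * m - 1 := by
    have : (1 : ℝ) ≤ m := by exact_mod_cast hm
    linarith
  set c := drift m a - drift m σ with hc
  have hc0 : 0 < c := sub_pos.2 (drift_lt_of_gt hm ha haσ
    ((mul_lt_mul_of_pos_left (mul_lt_mul_of_pos_left haσ hσ0) hp).trans_eq hσ))
  have he := lt_drift hm hσ0 hσ1
  set C := 1 + drift m a / (drift m σ - (1 / 2 + σ / 2)) with hC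
  have hdam := drift_pos hm ha
  have hC1 : 1 ≤ C := by
    have : 0 ≤ drift m a / (drift m σ - (1 / 2 + σ / 2)) := div_nonneg hdam.le (by linarith)
    linarith
  have hCe : drift m a ≤ C * (drift m σ - (1 / 2 + σ / 2)) := by
    rw [hC, add_mul, div_mul_cancel₀ _ (by linarith)]
    linarith
  have hv0 : ∀ j, 0 ≤ C * σ ^ j - a ^ j := fun j => by
    have h1 : a ^ j ≤ σ ^ j := pow_le_pow_left₀ ha.le haσ.le j
    have h2 : 0 < σ ^ j := pow_pos hσ0 j
    nlinarith
  have hv : ∀ j, radial m (fun i => C * σ ^ i - a ^ i) j ≤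
      drift m σ * (C * σ ^ j - a ^ j) - c * a ^ j := fun j => by
    rw [radial_sub C (fun i => σ ^ i) (fun i => a ^ i)]
    cases j with
    | zero =>
      rw [radial_pow_zero, radial_pow_zero]
      simp only [pow_zero, mul_one]
      nlinarith
    | succ j =>
      rw [radial_pow_succ hσ0.ne', radial_pow_succ ha.ne', hc]
      apply le_of_eq
      ring
  have hle := tsum_green_le hμ (inv_nonneg.2 ht0.le) hG (f := fun z => a ^ (N₁ z + N₂ z))
    (W := fun z => t / (α₂ * c) * (a ^ N₁ z * (C * σ ^ N₂ z - a ^ N₂ z)))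
    (fun z => by positivity) (fun z => mul_nonneg (by positivity)
      (mul_nonneg (by positivity) (hv0 _))) (fun z => by
      rw [lconv_const_mul, hL (fun i => a ^ i) fun i => C * σ ^ i - a ^ i]
      have e1 := radial_pow_le hn ha ha1 (N₁ z)
      have e2 := hv (N₂ z)
      have h3 := hv0 (N₂ z)
      have h4 : 0 < a ^ N₁ z := pow_pos ha _
      have : α₁ * (radial n (fun i => a ^ i) (N₁ z) * (C * σ ^ N₂ z - a ^ N₂ z)) +
          α₂ * (a ^ N₁ z * radial m (fun i => C * σ ^ i - a ^ i) (N₂ z)) ≤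
          t * (a ^ N₁ z * (C * σ ^ N₂ z - a ^ N₂ z)) - α₂ * c * a ^ (N₁ z + N₂ z) := by
        calc _ ≤ α₁ * (drift n a * a ^ N₁ z * (C * σ ^ N₂ z - a ^ N₂ z)) +
              α₂ * (a ^ N₁ z * (drift m σ * (C * σ ^ N₂ z - a ^ N₂ z) - c * a ^ N₂ z)) := by
              gcongr
          _ = _ := by rw [ht, pow_add]; ring
      calc _ ≤ a ^ (N₁ z + N₂ z) + t⁻¹ * (t / (α₂ * c) *
            (t * (a ^ N₁ z * (C * σ ^ N₂ z - a ^ N₂ z)) - α₂ * c * a ^ (N₁ z + N₂ z))) := by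
            gcongr
        _ = _ := by field_simp; ring)
  simp only [hinv₁, hinv₂] at hle
  exact ne_top_of_le_ne_top ENNReal.ofReal_ne_top hle

lemma IsBiradial.tsum_green_eq_top (hL : IsBiradial μ N₁ N₂ n m α₁ α₂)
    (hμ : IsFinMeasure μ) (hn : 0 < n) (hm : 0 < m) (h₁ : 0 < α₁)
    (h₂ : 0 < α₂) (hα : α₁ + α₂ = 1) (hN₁ : N₁ 1 = 0) (hN₂ : N₂ 1 = 0)
    (hinv₁ : ∀ z, N₁ z⁻¹ = N₁ z) (hinv₂ : ∀ z, N₂ z⁻¹ = N₂ z) {a₀ a σ : ℝ}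
    (ha₀ : 0 < a₀) (haa : a₀ < a) (ha1 : a < 1) (hσ0 : 0 < σ) (hσ1 : σ < 1)
    (hτ : 1 < (2 * n - 1) * (a₀ * a₀)) (hσ : (2 * m - 1) * (σ * σ) = 1)
    (hG : GreenFinite μ (α₁ * drift n a₀ + α₂ * drift m σ)⁻¹) :
    ∑' z, ENNReal.ofReal (green μ (α₁ * drift n a₀ + α₂ * drift m σ)⁻¹ z * a ^ (N₁ z + N₂ z)) =
      ⊤ := by
  have ha := ha₀.trans haa
  have hn' : (1 : ℝ) ≤ n := by exact_mod_cast hn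
  have hm' : (1 : ℝ) ≤ m := by exact_mod_cast hm
  have hq : (0 : ℝ) < 2 * n - 1 := by linarith
  have hp : (0 : ℝ) < 2 * m - 1 := by linarith
  have hda := drift_pos hn ha₀
  have hds := drift_pos hm hσ0
  set t := α₁ * drift n a₀ + α₂ * drift m σ with ht
  have ht0 : 0 < t := by positivity
  have haa2 : 1 < (2 * n - 1) * (a * a₀) := hτ.trans_le
    (mul_le_mul_of_nonneg_left (mul_le_mul_of_nonneg_right haa.le ha₀.le) hq.le)
  set ε := α₁ * (drift n a - drift n a₀) with hε
  have hε0 : 0 < ε := mul_pos h₁ (sub_pos.2 (drift_lt_of_lt hn ha₀ haa haa2))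
  set b := 1 / ((2 * n - 1) * a) with hb
  have hb0 : 0 < b := by positivity
  have hba : b < a := by
    rw [hb, div_lt_iff₀ (by positivity)]
    nlinarith
  have hdab : drift n a = drift n b := drift_eq_of_mul_eq_one hn ha hb0 (by
    rw [hb]; field_simp)
  obtain ⟨K, hK⟩ := exists_nat_ge (max (2 * (m : ℝ)) (1 / (2 * m * σ) / ε))
  have hK1 : 2 * (m : ℝ) ≤ K := (le_max_left _ _).trans hK
  have hK2 : 1 / (2 * m * σ) ≤ K * ε := by
    rw [← div_le_iff₀ hε0]
    exact (le_max_right _ _).trans hK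
  set h : ℕ → ℝ := tent K with hh
  have hh0 : ∀ j, 0 ≤ h j := tent_nonneg K
  have hφ0 : ∀ j, 0 ≤ 1 * a ^ j - b ^ j := fun j => by
    have := pow_le_pow_left₀ hb0.le hba.le j
    linarith
  have hφ : ∀ j, drift n a * (1 * a ^ j - b ^ j) ≤ radial n (fun i => 1 * a ^ i - b ^ i) j :=
    fun j => by
      rw [radial_sub 1 (fun i => a ^ i) (fun i => b ^ i)]
      cases j with
      | zero =>
        rw [radial_pow_zero, radial_pow_zero]
        simp only [pow_zero]
        linarith
      | succ j =>
        rw [radial_pow_succ ha.ne', radial_pow_succ hb0.ne', hdab]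
        apply le_of_eq
        ring
  have hψ : ∀ j, (drift m σ - ε) * (σ ^ j * h j) ≤ radial m (fun i => σ ^ i * h i) j :=
    le_radial_tent hm hσ0 hσ hε0.le hK1 hK2
  have hC : 0 < ((K : ℝ) + 1) * (K + 1) / a ^ K := by positivity
  have hres := GreenGrowth.tsum_green_eq_top hμ (inv_pos.2 ht0) hG
    (f := fun z => a ^ (N₁ z + N₂ z))
    (g := fun z => (1 * a ^ N₁ z - b ^ N₁ z) * (σ ^ N₂ z * h (N₂ z)))
    (fun z => by positivity) hC (fun z => ?_) (fun z => ?_) ?_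
  · simp only [hinv₁, hinv₂] at hres
    exact hres
  · have e1 : 1 * a ^ N₁ z - b ^ N₁ z ≤ a ^ N₁ z := by
      have : 0 < b ^ N₁ z := pow_pos hb0 _
      linarith
    have e2 : σ ^ N₂ z * h (N₂ z) ≤ ((K : ℝ) + 1) * (K + 1) / a ^ K * a ^ N₂ z := by
      rcases le_or_gt K (N₂ z) with hle | hlt
      · have hle' : (K : ℝ) ≤ N₂ z := by exact_mod_cast hle
        have : h (N₂ z) = 0 := max_eq_left (by nlinarith)
        rw [this, mul_zero]
        positivity
      · have hlt' : (N₂ z : ℝ) < K := by exact_mod_cast hlt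
        have hnn : (0 : ℝ) ≤ N₂ z := Nat.cast_nonneg _
        have h3 : h (N₂ z) ≤ (K + 1) * (K + 1) := max_le (by positivity) (by nlinarith)
        have h4 : σ ^ N₂ z ≤ 1 := pow_le_one₀ hσ0.le hσ1.le
        have h5 : a ^ K ≤ a ^ N₂ z := pow_le_pow_of_le_one ha.le ha1.le hlt.le
        calc σ ^ N₂ z * h (N₂ z) ≤ 1 * ((K + 1) * (K + 1)) :=
              mul_le_mul h4 h3 (hh0 _) zero_le_one
          _ = ((K : ℝ) + 1) * (K + 1) / a ^ K * a ^ K := by field_simp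
          _ ≤ _ := by gcongr
    calc _ ≤ a ^ N₁ z * (((K : ℝ) + 1) * (K + 1) / a ^ K * a ^ N₂ z) :=
          mul_le_mul e1 e2 (mul_nonneg (by positivity) (hh0 _)) (by positivity)
      _ = _ := by rw [pow_add]; ring
  · rw [hL (fun i => 1 * a ^ i - b ^ i) fun i => σ ^ i * h i, le_inv_mul_iff₀ ht0]
    have e1 := hφ (N₁ z)
    have e2 := hψ (N₂ z)
    have h3 := hφ0 (N₁ z)
    have h4 : 0 ≤ σ ^ N₂ z * h (N₂ z) := mul_nonneg (by positivity) (hh0 _)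
    calc t * ((1 * a ^ N₁ z - b ^ N₁ z) * (σ ^ N₂ z * h (N₂ z)))
        ≤ (α₁ * drift n a + α₂ * (drift m σ - ε)) *
          ((1 * a ^ N₁ z - b ^ N₁ z) * (σ ^ N₂ z * h (N₂ z))) := by
          refine mul_le_mul_of_nonneg_right ?_ (mul_nonneg h3 h4)
          have : α₁ * drift n a = α₁ * drift n a₀ + ε := by rw [hε]; ring
          rw [this, ht]
          nlinarith
      _ = α₁ * (drift n a * (1 * a ^ N₁ z - b ^ N₁ z) * (σ ^ N₂ z * h (N₂ z))) +
          α₂ * ((1 * a ^ N₁ z - b ^ N₁ z) * ((drift m σ - ε) * (σ ^ N₂ z * h (N₂ z)))) := by ring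
      _ ≤ _ := by gcongr
  · rw [hL (fun i => 1 * a ^ i - b ^ i) fun i => σ ^ i * h i, hN₁, hN₂]
    have e0 : h 0 = K := tent_zero K
    have : (0 : ℝ) < K := by linarith
    simp only [radial, pow_zero, pow_one, e0]
    have hpos : 0 < α₁ * ((a - b) * K) := mul_pos h₁ (mul_pos (sub_pos.2 hba) this)
    clear_value h
    calc 0 < α₁ * ((a - b) * K) / 2 := half_pos hpos
      _ = _ := by ring

/-- At a suitable parameter `ζ > 1` inside the interval of finiteness of the Green function, the
Poincaré series of the product walk converges at its critical exponent. -/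
theorem IsBiradial.exists_convergent (hL : IsBiradial μ N₁ N₂ n m α₁ α₂)
    (hμ : IsFinMeasure μ) (hm : 2 ≤ m) (hmn : m < n)
    (h₁ : 0 < α₁) (h₂ : 0 < α₂) (hα : α₁ + α₂ = 1) (hN₁ : N₁ 1 = 0) (hN₂ : N₂ 1 = 0)
    (hinv₁ : ∀ z, N₁ z⁻¹ = N₁ z) (hinv₂ : ∀ z, N₂ z⁻¹ = N₂ z) :
    ∃ ζ ζ' s₀ : ℝ, 1 < ζ ∧ ζ < ζ' ∧ GreenFinite μ ζ' ∧ 0 < s₀ ∧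
      poincare (fun z => N₁ z + N₂ z) (green μ ζ) s₀ ≠ ⊤ ∧
      ∀ s < s₀, poincare (fun z => N₁ z + N₂ z) (green μ ζ) s = ⊤ := by
  have hm0 : 0 < m := by omega
  have hn0 : 0 < n := by omega
  have hm' : (2 : ℝ) ≤ m := by exact_mod_cast hm
  have hmn' : (m : ℝ) < n := by exact_mod_cast hmn
  have hp : (1 : ℝ) < 2 * m - 1 := by linarith
  have hq : (1 : ℝ) < 2 * n - 1 := by linarith
  obtain ⟨σ, hσ0, hσ1, hσ⟩ : ∃ σ : ℝ, 0 < σ ∧ σ < 1 ∧ (2 * m - 1) * (σ * σ) = 1 := by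
    refine ⟨(√(2 * m - 1))⁻¹, by positivity, inv_lt_one_of_one_lt₀ ?_, ?_⟩
    · rw [Real.lt_sqrt zero_le_one]
      linarith
    · rw [← mul_inv, Real.mul_self_sqrt (by linarith), mul_inv_cancel₀ (by linarith)]
  obtain ⟨τ, hτ0, hτ1, hτ⟩ : ∃ σ : ℝ, 0 < σ ∧ σ < 1 ∧ (2 * n - 1) * (σ * σ) = 1 := by
    refine ⟨(√(2 * n - 1))⁻¹, by positivity, inv_lt_one_of_one_lt₀ ?_, ?_⟩
    · rw [Real.lt_sqrt zero_le_one]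
      linarith
    · rw [← mul_inv, Real.mul_self_sqrt (by linarith), mul_inv_cancel₀ (by linarith)]
  have hτσ : τ < σ := by
    by_contra! h
    have : σ * σ ≤ τ * τ := mul_le_mul h h hσ0.le hτ0.le
    have : 0 < σ * σ := by positivity
    nlinarith
  obtain ⟨a₀, hτa, haσ⟩ := exists_between hτσ
  obtain ⟨a', hτa', ha'a⟩ := exists_between hτa
  have ha0 : 0 < a₀ := hτ0.trans hτa
  have ha'0 : 0 < a' := hτ0.trans hτa'
  have ha1 : a₀ < 1 := haσ.trans hσ1
  have hτlt : ∀ x y : ℝ, τ < x → τ < y → 1 < (2 * n - 1) * (x * y) := fun x y hx hy => by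
    refine hτ.symm.trans_lt ?_
    exact mul_lt_mul_of_pos_left (mul_lt_mul hx hy.le hτ0 (hτ0.trans hx).le) (by linarith)
  have hd1 : drift n a₀ < 1 := by
    rw [← drift_one hn0]
    exact drift_lt_of_lt hn0 ha0 ha1 (hτlt _ _ hτ1 hτa)
  have hd2 : drift m σ < 1 := by
    rw [← drift_one hm0]
    refine drift_lt_of_lt hm0 hσ0 hσ1 ?_
    nlinarith
  have hd3 : drift n a' < drift n a₀ := drift_lt_of_lt hn0 ha'0 ha'a (hτlt _ _ hτa hτa')
  have hd0 := drift_pos hn0 ha'0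
  have hds := drift_pos hm0 hσ0
  set t := α₁ * drift n a₀ + α₂ * drift m σ with ht
  set t' := α₁ * drift n a' + α₂ * drift m σ with ht'
  have ht'0 : 0 < t' := by positivity
  have htt : t' < t := by
    have := mul_lt_mul_of_pos_left hd3 h₁
    linarith
  have ht0 := ht'0.trans htt
  have ht1 : t < 1 := by
    have e1 := mul_lt_mul_of_pos_left hd1 h₁
    have e2 := mul_lt_mul_of_pos_left hd2 h₂
    linarith
  obtain ⟨x, hx', hx⟩ := exists_between htt
  have hx0 := ht'0.trans hx'
  have hG' : GreenFinite μ x⁻¹ := hL.greenFinite hμ hn0 hm0 h₁ h₂ hN₁ hN₂ ha'0 (ha'a.trans ha1)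
    hσ0 hσ1 (inv_nonneg.2 hx0.le) (by rw [inv_mul_lt_iff₀ hx0]; linarith)
  have hζ : t⁻¹ < x⁻¹ := inv_strictAnti₀ hx0 hx
  have hG : GreenFinite μ t⁻¹ := GreenFinite.mono hμ (inv_nonneg.2 ht0.le) hζ.le hG'
  have hexp : ∀ a : ℝ, 0 < a → ∀ k : ℕ, Real.exp (-(-Real.log a * k)) = a ^ k := fun a ha k => by
    rw [neg_mul, neg_neg, mul_comm, Real.exp_nat_mul, Real.exp_log ha]
  refine ⟨t⁻¹, x⁻¹, -Real.log a₀, (one_lt_inv₀ ht0).2 ht1, hζ, hG', ?_, ?_, fun s hs => ?_⟩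
  · have := Real.log_neg ha0 ha1
    linarith
  · simp only [poincare, hexp a₀ ha0]
    exact hL.tsum_green_ne_top hμ hn0 hm0 h₁ h₂ hinv₁ hinv₂ ha0 haσ hσ1 hσ hG
  · obtain ⟨a, haa, haσ'⟩ : ∃ a, a₀ < a ∧ a < min σ (Real.exp (-s)) := by
      refine exists_between (lt_min haσ ?_)
      rw [← Real.exp_log ha0]
      exact Real.exp_lt_exp.2 (by linarith)
    have hap := ha0.trans haa
    have hs' : s ≤ -Real.log a := by
      have : Real.log a ≤ -s := by
        rw [← Real.log_exp (-s)]
        exact Real.log_le_log hap (haσ'.le.trans (min_le_right _ _))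
      linarith
    refine top_le_iff.1 (le_trans (le_of_eq ?_)
      (poincare_anti (fun z => green_nonneg hμ (inv_nonneg.2 ht0.le) z) hs'))
    simp only [poincare, hexp a hap]
    refine (hL.tsum_green_eq_top hμ hn0 hm0 h₁ h₂ hα hN₁ hN₂ hinv₁ hinv₂ ha0 haa
      ((haσ'.trans_le (min_le_left _ _)).trans hσ1) hσ0 hσ1 (hτlt _ _ hτa hτa) hσ hG).symm

end ProductPhase

section BiFreePhase

/-- At a suitable parameter `ζ > 1`, the Poincaré series of `F_n × F_m` converges at its critical
exponent. -/
theorem biFree_exists_convergent {n m : ℕ} (hn : 2 ≤ n) (hm : 2 ≤ m) (hnm : n ≠ m) {α₁ α₂ : ℝ}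
    (h₁ : 0 < α₁) (h₂ : 0 < α₂) (hα : α₁ + α₂ = 1) :
    ∃ ζ ζ' s₀ : ℝ, 1 < ζ ∧ ζ < ζ' ∧ GreenFinite (biFreeMu n m α₁ α₂) ζ' ∧ 0 < s₀ ∧
      poincare (fun z : BiFree n m => FreeGroup.norm z.1 + FreeGroup.norm z.2)
        (green (biFreeMu n m α₁ α₂) ζ) s₀ ≠ ⊤ ∧
      ∀ s < s₀, poincare (fun z : BiFree n m => FreeGroup.norm z.1 + FreeGroup.norm z.2)
        (green (biFreeMu n m α₁ α₂) ζ) s = ⊤ := by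
  have hμ : IsFinMeasure (biFreeMu n m α₁ α₂) := isFinMeasure_biFreeMu h₁.le h₂.le
  have hL : IsBiradial (biFreeMu n m α₁ α₂) (fun z => FreeGroup.norm z.1)
      (fun z => FreeGroup.norm z.2) n m α₁ α₂ :=
    lconv_biFreeMu (by omega) (by omega)
  rcases lt_or_gt_of_ne hnm with h | h
  · have hL' : IsBiradial (biFreeMu n m α₁ α₂) (fun z => FreeGroup.norm z.2)
        (fun z => FreeGroup.norm z.1) m n α₂ α₁ := fun u v z => by
      have := hL v u z
      simp only [mul_comm (v _)] at this
      rw [this]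
      ring
    simpa only [add_comm] using hL'.exists_convergent hμ hn h h₂ h₁ (by linarith) (by simp)
      (by simp) (fun z => by simp) (fun z => by simp)
  · exact hL.exists_convergent hμ hm h h₁ h₂ hα (by simp)
      (by simp) (fun z => by simp) (fun z => by simp)

end BiFreePhase

end

section

/-! ### Choice of the parameters -/

section

variable {G : Type*} [Group G] {μ : G → ℝ}

lemma green_one_mul_lt [Nontrivial G] (hμ : IsFinMeasure μ) (hsum : ∑' x, μ x = 1)
    (hadm : IsAdmissible μ) {r : ℝ} (hr : 0 < r) (hr1 : r < 1) : green μ r 1 * (1 - r) < 1 := by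
  obtain ⟨hG, hle⟩ := tsum_green_le_of_lt_one hμ hsum hr.le hr1
  obtain ⟨x, hx⟩ := exists_ne (1 : G)
  have hpos := green_pos hμ hr hG (hadm x)
  have h0 := green_nonneg hμ hr.le (1 : G)
  have h1 : ENNReal.ofReal (green μ r 1 + green μ r x) ≤ ENNReal.ofReal (1 - r)⁻¹ := by
    rw [ENNReal.ofReal_add h0 hpos.le,
      ← Finset.sum_pair (f := fun z => ENNReal.ofReal (green μ r z)) hx.symm]
    exact (ENNReal.sum_le_tsum _).trans hle
  have hr0 : 0 < 1 - r := sub_pos.2 hr1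
  have h2 := (ENNReal.ofReal_le_ofReal_iff (inv_nonneg.2 hr0.le)).1 h1
  rw [← lt_inv_mul_iff₀' hr0, mul_one]
  linarith

end

namespace Splitting

variable {M : Bool → Type*} [∀ i, Group (M i)]

lemma poincare_green {ℓ : ∀ i, M i → ℕ} {μ : ∀ i, M i → ℝ} {ζ : Bool → ℝ}
    (hμ : ∀ i, IsFinMeasure (μ i)) (hζ : ∀ i, 0 ≤ ζ i) (hG : ∀ i, GreenFinite (μ i) (ζ i))
    (hℓ1 : ∀ i, ℓ i 1 = 0) (s : ℝ) (i : Bool) :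
    poincare (ℓ i) (green (μ i) (ζ i)) s = ENNReal.ofReal (green (μ i) (ζ i) 1) *
      (1 + letterSum (weight ℓ (fun i => hitting (μ i) (ζ i)) s) i) := by
  have h1 := one_le_green_one (hμ i) (hζ i) (hG i)
  rw [← poincare_letter (fun i => hitting_one (hμ i) (hζ i) (hG i)) hℓ1 (by linarith)]
  congr 1
  funext x
  rw [hitting, mul_div_cancel₀ _ (by linarith)]

lemma poincare_green_ne_top_iff {ℓ : ∀ i, M i → ℕ} {μ : ∀ i, M i → ℝ} {ζ : Bool → ℝ}
    (hμ : ∀ i, IsFinMeasure (μ i)) (hζ : ∀ i, 0 ≤ ζ i) (hG : ∀ i, GreenFinite (μ i) (ζ i))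
    (hℓ1 : ∀ i, ℓ i 1 = 0) (s : ℝ) (i : Bool) :
    poincare (ℓ i) (green (μ i) (ζ i)) s ≠ ⊤ ↔
      letterSum (weight ℓ (fun i => hitting (μ i) (ζ i)) s) i ≠ ⊤ := by
  have h1 := one_le_green_one (hμ i) (hζ i) (hG i)
  rw [poincare_green hμ hζ hG hℓ1]
  have h2 : ENNReal.ofReal (green (μ i) (ζ i) 1) ≠ 0 := by
    rw [ne_eq, ENNReal.ofReal_eq_zero]
    linarith
  simp [ENNReal.mul_eq_top, h2]

lemma letterSum_hitting_le {ℓ : ∀ i, M i → ℕ} {μ : ∀ i, M i → ℝ} {ζ : Bool → ℝ}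
    (hμ : ∀ i, IsFinMeasure (μ i)) (hζ : ∀ i, 0 ≤ ζ i) (hG : ∀ i, GreenFinite (μ i) (ζ i))
    (hℓ1 : ∀ i, ℓ i 1 = 0) {s : ℝ} (hs : 0 ≤ s) {i : Bool} (hsum : ∑' x, μ i x = 1)
    (hi : ζ i ≤ 1 / 2) :
    letterSum (weight ℓ (fun i => hitting (μ i) (ζ i)) s) i ≤ ENNReal.ofReal (2 * ζ i) := by
  have h1 := one_le_green_one (hμ i) (hζ i) (hG i)
  have h2 : poincare (ℓ i) (green (μ i) (ζ i)) s ≤ ENNReal.ofReal (1 - ζ i)⁻¹ := by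
    refine (poincare_anti (green_nonneg (hμ i) (hζ i)) hs).trans ?_
    refine le_trans (le_of_eq ?_)
      (tsum_green_le_of_lt_one (hμ i) hsum (hζ i) (by linarith)).2
    simp [poincare]
  rw [poincare_green hμ hζ hG hℓ1] at h2
  have h3 : 1 + letterSum (weight ℓ (fun i => hitting (μ i) (ζ i)) s) i ≤
      ENNReal.ofReal (1 - ζ i)⁻¹ := by
    refine le_trans ?_ h2
    exact le_mul_of_one_le_left' (by simpa using ENNReal.ofReal_le_ofReal h1)
  have h4 : (1 - ζ i)⁻¹ ≤ 1 + 2 * ζ i := by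
    rw [inv_le_iff_one_le_mul₀ (by linarith)]
    nlinarith [hζ i]
  have h5 := h3.trans (ENNReal.ofReal_le_ofReal h4)
  rw [ENNReal.ofReal_add zero_le_one (by linarith [hζ i]), ENNReal.ofReal_one] at h5
  exact (ENNReal.add_le_add_iff_left ENNReal.one_ne_top).1 h5

end Splitting

/-- A right inverse of `x ↦ x * g x` on `[0, 1/2]` for `g ≥ 1` continuous and monotone. -/
lemma exists_continuousOn_inverse {g : ℝ → ℝ} (hg : ContinuousOn g (Set.Icc 0 (1 / 2)))
    (hmono : MonotoneOn g (Set.Icc 0 (1 / 2))) (h1 : ∀ x ∈ Set.Icc (0 : ℝ) (1 / 2), 1 ≤ g x) :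
    ∃ z : ℝ → ℝ, ContinuousOn z (Set.Icc 0 (1 / 2)) ∧
      ∀ u ∈ Set.Icc (0 : ℝ) (1 / 2), z u ∈ Set.Icc (0 : ℝ) (1 / 2) ∧ z u * g (z u) = u := by
  have hsurj : ∀ u ∈ Set.Icc (0 : ℝ) (1 / 2), ∃ y ∈ Set.Icc (0 : ℝ) (1 / 2), y * g y = u := by
    intro u hu
    have := intermediate_value_Icc (by norm_num : (0 : ℝ) ≤ 1 / 2)
      (f := fun y => y * g y) (continuousOn_id.mul hg)
    refine this ⟨by simpa using hu.1, hu.2.trans ?_⟩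
    have := h1 (1 / 2) (by norm_num)
    linarith
  choose! z hz hzu using hsurj
  refine ⟨z, ?_, fun u hu => ⟨hz u hu, hzu u hu⟩⟩
  have key : ∀ u ∈ Set.Icc (0 : ℝ) (1 / 2), ∀ v ∈ Set.Icc (0 : ℝ) (1 / 2), z u ≤ z v →
      z v - z u ≤ v - u := by
    intro u hu v hv h
    have e1 := hmono (hz u hu) (hz v hv) h
    have e2 := h1 _ (hz u hu)
    have e3 := (hz u hu).1
    have e4 := (hz v hv).1
    have e5 := hzu u hu
    have e6 := hzu v hv
    have e7 := mul_le_mul_of_nonneg_left e1 e4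
    have e8 := mul_le_mul_of_nonneg_left e2 (sub_nonneg.2 h)
    linarith
  refine (LipschitzOnWith.of_dist_le_mul (K := 1) fun u hu v hv => ?_).continuousOn
  rw [Real.dist_eq, Real.dist_eq, NNReal.coe_one, one_mul]
  rcases le_total (z u) (z v) with h | h
  · rw [abs_sub_comm, abs_of_nonneg (sub_nonneg.2 h), abs_sub_comm]
    exact (key u hu v hv h).trans (le_abs_self _)
  · rw [abs_of_nonneg (sub_nonneg.2 h)]
    exact (key v hv u hu h).trans (le_abs_self _)

/-- The parameters `x` and `y` of the two factors correspond to the parameter `r` of the free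
product walk. -/
def ParamRel (g₀ g₁ : ℝ → ℝ) (α r x y : ℝ) : Prop :=
  0 < y ∧ y ≤ 1 / 2 ∧ y * g₁ y = α / (1 - α) * (x * g₀ x) ∧
    r⁻¹ = (1 - α) / x + α / y - (1 - α) / (x * g₀ x)

lemma exists_paramRel {g₀ g₁ : ℝ → ℝ} {α b : ℝ} (hα : 0 < α) (hα1 : α < 1) (hb : 1 < b)
    (hg₀ : ContinuousOn g₀ (Set.Icc 0 b)) (h₀ : ∀ x ∈ Set.Icc (0 : ℝ) b, 1 ≤ g₀ x)
    (hg₁ : ContinuousOn g₁ (Set.Icc 0 (1 / 2))) (hmono : MonotoneOn g₁ (Set.Icc 0 (1 / 2)))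
    (h₁ : ∀ x ∈ Set.Icc (0 : ℝ) (1 / 2), 1 ≤ g₁ x)
    (hlt : ∀ x ∈ Set.Ioc (0 : ℝ) (1 / 2), g₁ x * (1 - x) < 1)
    (hsmall : ∀ x ∈ Set.Icc (0 : ℝ) b, α / (1 - α) * (x * g₀ x) ≤ 1 / 2) :
    ∃ r₁ r₂ : ℝ, 1 < r₁ ∧ r₁ < r₂ ∧ (1 - α) / b ≤ r₂⁻¹ ∧ (∃ y, ParamRel g₀ g₁ α r₂ b y) ∧
      ∀ r, 0 < r → r ≤ r₁ → ∃ x y, 0 < x ∧ x < 1 ∧ ParamRel g₀ g₁ α r x y := by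
  obtain ⟨z, hzc, hz⟩ := exists_continuousOn_inverse hg₁ hmono h₁
  have hα' : 0 < 1 - α := sub_pos.2 hα1
  have hb0 : 0 < b := zero_lt_one.trans hb
  set u : ℝ → ℝ := fun x => α / (1 - α) * (x * g₀ x) with hu
  have hsub : Set.Ioc 0 b ⊆ Set.Icc 0 b := Set.Ioc_subset_Icc_self
  have hxg : ∀ x ∈ Set.Ioc 0 b, 0 < x * g₀ x := fun x hx =>
    mul_pos hx.1 (zero_lt_one.trans_le (h₀ x (hsub hx)))
  have hu0 : ∀ x ∈ Set.Ioc 0 b, 0 < u x := fun x hx => mul_pos (div_pos hα hα') (hxg x hx)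
  have huI : ∀ x ∈ Set.Ioc 0 b, u x ∈ Set.Icc (0 : ℝ) (1 / 2) := fun x hx =>
    ⟨(hu0 x hx).le, hsmall x (hsub hx)⟩
  have hz0 : ∀ x ∈ Set.Ioc 0 b, 0 < z (u x) := fun x hx => by
    obtain ⟨⟨e1, -⟩, e2⟩ := hz _ (huI x hx)
    refine e1.lt_of_ne fun e => ?_
    rw [← e, zero_mul] at e2
    exact (hu0 x hx).ne e2
  set ρ : ℝ → ℝ := fun x => (1 - α) / x + α / z (u x) - (1 - α) / (x * g₀ x) with hρ
  have hxc : ContinuousOn (fun x => x * g₀ x) (Set.Ioc 0 b) := continuousOn_id.mul (hg₀.mono hsub)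
  have huc : ContinuousOn u (Set.Ioc 0 b) := continuousOn_const.mul hxc
  have hρc : ContinuousOn ρ (Set.Ioc 0 b) :=
    ((continuousOn_const.div continuousOn_id fun x hx => hx.1.ne').add
      (continuousOn_const.div (hzc.comp huc huI) fun x hx => (hz0 x hx).ne')).sub
      (continuousOn_const.div hxc fun x hx => (hxg x hx).ne')
  have hκ : ∀ x ∈ Set.Ioc 0 b, (1 - α) / (x * g₀ x) = α / (z (u x) * g₁ (z (u x))) := by
    intro x hx
    have := hxg x hx
    rw [(hz _ (huI x hx)).2, hu]
    field_simp
  have hρge : ∀ x ∈ Set.Ioc 0 b, (1 - α) / x ≤ ρ x := by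
    intro x hx
    have e : α / (z (u x) * g₁ (z (u x))) ≤ α / z (u x) :=
      div_le_div_of_nonneg_left hα.le (hz0 x hx)
        (le_mul_of_one_le_right (hz0 x hx).le (h₁ _ (hz _ (huI x hx)).1))
    simp only [hρ]
    rw [hκ x hx]
    linarith
  have hρlt : ∀ x ∈ Set.Ioc 0 b, 1 ≤ x → ρ x < 1 := by
    intro x hx hx1
    have hy := hz0 x hx
    have hyI := (hz _ (huI x hx)).1
    have hg1 := h₁ _ hyI
    have e0 := hlt _ ⟨hy, hyI.2⟩
    have e : α / z (u x) - α / (z (u x) * g₁ (z (u x))) < α := by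
      rw [div_sub_div _ _ hy.ne' (by positivity), div_lt_iff₀ (by positivity)]
      have := mul_pos (mul_pos hα hy) (sub_pos.2 e0)
      nlinarith
    have e2 : (1 - α) / x ≤ 1 - α := div_le_self hα'.le hx1
    simp only [hρ]
    rw [hκ x hx]
    linarith
  have hrel : ∀ x ∈ Set.Ioc 0 b, ∀ r : ℝ, r⁻¹ = ρ x → ParamRel g₀ g₁ α r x (z (u x)) :=
    fun x hx r hr => ⟨hz0 x hx, (hz _ (huI x hx)).1.2, (hz _ (huI x hx)).2, hr⟩
  have hbI : b ∈ Set.Ioc 0 b := ⟨hb0, le_rfl⟩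
  have hρpos : ∀ x ∈ Set.Ioc 0 b, 0 < ρ x := fun x hx =>
    (div_pos hα' hx.1).trans_le (hρge x hx)
  obtain ⟨x₀, hx0, hx1, hρx⟩ : ∃ x₀, 0 < x₀ ∧ x₀ < 1 ∧ ρ x₀ < 1 := by
    have hc : ContinuousAt ρ 1 := hρc.continuousAt (Ioc_mem_nhds zero_lt_one hb)
    have e1 : ∀ᶠ x in nhdsWithin (1 : ℝ) (Set.Iio 1), ρ x < 1 :=
      (hc.eventually_lt continuousAt_const (hρlt 1 ⟨zero_lt_one, hb.le⟩ le_rfl)).filter_mono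
        nhdsWithin_le_nhds
    have e2 : ∀ᶠ x in nhdsWithin (1 : ℝ) (Set.Iio 1), x ∈ Set.Ioo (0 : ℝ) 1 :=
      Ioo_mem_nhdsLT zero_lt_one
    obtain ⟨x, hx, hx'⟩ := (e1.and e2).exists
    exact ⟨x, hx'.1, hx'.2, hx⟩
  have hx0I : x₀ ∈ Set.Ioc 0 b := ⟨hx0, (hx1.trans hb).le⟩
  have hr2 : 1 < (ρ b)⁻¹ := (one_lt_inv₀ (hρpos b hbI)).2 (hρlt b hbI hb.le)
  have hr1 : 1 < (ρ x₀)⁻¹ := (one_lt_inv₀ (hρpos _ hx0I)).2 hρx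
  refine ⟨min (ρ x₀)⁻¹ ((1 + (ρ b)⁻¹) / 2), (ρ b)⁻¹, lt_min hr1 (by linarith),
    (min_le_right _ _).trans_lt (by linarith), by rw [inv_inv]; exact hρge b hbI,
    ⟨_, hrel b hbI _ (inv_inv _)⟩, fun r hr hrle => ?_⟩
  set a := min x₀ ((1 - α) * r) with ha
  have ha0 : 0 < a := lt_min hx0 (mul_pos hα' hr)
  have hax : a ≤ x₀ := min_le_left _ _
  have hI : Set.Icc a x₀ ⊆ Set.Ioc 0 b := fun x hx => ⟨ha0.trans_le hx.1, hx.2.trans hx0I.2⟩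
  have hmem : r⁻¹ ∈ Set.Icc (ρ x₀) (ρ a) := by
    constructor
    · rw [le_inv_comm₀ (hρpos _ hx0I) hr]
      exact hrle.trans (min_le_left _ _)
    · refine le_trans ?_ (hρge a (hI ⟨le_rfl, hax⟩))
      rw [inv_eq_one_div, div_le_div_iff₀ hr ha0, one_mul]
      exact min_le_right _ _
  obtain ⟨x, hx, hxr⟩ := intermediate_value_Icc' hax (hρc.mono hI) hmem
  exact ⟨x, _, (hI hx).1, hx.2.trans_lt hx1, hrel x (hI hx) r hxr.symm⟩

end

section

/-! ### The phase transition for free products -/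

namespace Splitting

variable {M : Bool → Type*} [∀ i, Group (M i)] {Γ : Type*} [Group Γ] (D : Splitting M Γ)
variable {ℓ : ∀ i, M i → ℕ} {S : ∀ i, Finset (M i)} {T : Finset Γ} {μ : ∀ i, M i → ℝ}

/-- The weights `1 - α` and `α` of the two factors. -/
def weights (α : ℝ) (i : Bool) : ℝ := cond i α (1 - α)

lemma weights_pos {α : ℝ} (hα : 0 < α) (hα1 : α < 1) (i : Bool) : 0 < weights α i := by
  cases i
  · exact sub_pos.2 hα1
  · exact hα

lemma green_mix_of_paramRel (hμ : ∀ i, IsFinMeasure (μ i)) {α r x y b : ℝ}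
    (hα : 0 < α) (hα1 : α < 1) (hx : 0 < x) (hxb : x ≤ b) (hG₀ : GreenFinite (μ false) b)
    (hG₁ : GreenFinite (μ true) (1 / 2)) (hr : 0 < r) (hrt : r * ((1 - α) / b + 2 * α) < 1)
    (h : ParamRel (fun x => green (μ false) x 1) (fun x => green (μ true) x 1) α r x y) :
    ∃ c, 0 < c ∧ ∀ g, green (D.mix (weights α) μ) r g =
      c * D.ext (fun i => hitting (μ i) (cond i y x)) g := by
  obtain ⟨hy, hy2, hrel, hr'⟩ := h
  simp only at hrel hr'
  have hα' : 0 < 1 - α := sub_pos.2 hα1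
  have hg₀ := one_le_green_one (hμ false) hx.le (GreenFinite.mono (hμ false) hx.le hxb hG₀)
  have hg₁ := one_le_green_one (hμ true) hy.le (GreenFinite.mono (hμ true) hy.le hy2 hG₁)
  have hxg : 0 < x * green (μ false) x 1 := by positivity
  have hκ : 0 < (1 - α) / (x * green (μ false) x 1) := div_pos hα' hxg
  obtain ⟨-, hgreen⟩ := D.green_mix (w := weights α) hμ (weights_pos hα hα1)
    (ζ := fun i => cond i y x) (ζ' := fun i => cond i (1 / 2) b)
    (by rintro (_ | _); exacts [hx, hy]) (by rintro (_ | _); exacts [hxb, hy2])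
    (by rintro (_ | _); exacts [hG₀, hG₁]) hκ
    (by
      rintro (_ | _)
      · simp only [weights, cond_false]
        rw [div_mul_cancel₀ _ hxg.ne']
      · simp only [weights, cond_true, hrel]
        field_simp) hr
    (by
      rw [Fintype.sum_bool]
      simp only [weights, cond_true, cond_false, hr']
      ring)
    (t := (1 - α) / b + 2 * α)
    (by
      rw [Fintype.sum_bool]
      simp only [weights, cond_true, cond_false]
      linarith) hrt
  refine ⟨(r * ((1 - α) / (x * green (μ false) x 1)))⁻¹, by positivity, fun g => ?_⟩
  rw [hgreen, div_eq_inv_mul]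

/-- The phase transition for a free product whose first factor carries a walk with a convergent
Poincaré series at a parameter `ζ > 1`. -/
theorem exists_phase [∀ i, Infinite (M i)] (hS : ∀ i, IsLength (S i) (ℓ i))
    (hT : (T : Set Γ) = ⋃ i, D.ι i '' (S i)) (hμ : ∀ i, IsFinMeasure (μ i))
    (hsum : ∀ i, ∑' x, μ i x = 1) (hadm : ∀ i, IsAdmissible (μ i)) (h1 : 0 < μ false 1)
    {b b' s₀ : ℝ} (hb : 1 < b) (hbb : b < b') (hG : GreenFinite (μ false) b') (hs₀ : 0 < s₀)
    (hconv : poincare (ℓ false) (green (μ false) b) s₀ ≠ ⊤)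
    (hdiv : ∀ s < s₀, poincare (ℓ false) (green (μ false) b) s = ⊤) :
    ∃ α₀ : ℝ, 0 < α₀ ∧ α₀ < 1 ∧ ∀ α : ℝ, 0 < α → α ≤ α₀ →
      ∃ r₁ r₂ : ℝ, 1 < r₁ ∧ r₁ < r₂ ∧ r₂ < greenRadius (D.mix (weights α) μ) ∧
        (∀ r : ℝ, 0 < r → r ≤ r₁ →
          (¬ Summable fun g => green (D.mix (weights α) μ) r g *
            Real.exp (-(greenGrowthRate T (D.mix (weights α) μ) r * (wordLength T g : ℝ)))) ∧
          ∀ i, omegaRestricted T (D.mix (weights α) μ) (Set.range (D.ι i)) r <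
            greenGrowthRate T (D.mix (weights α) μ) r) ∧
        (Summable fun g => green (D.mix (weights α) μ) r₂ g *
            Real.exp (-(greenGrowthRate T (D.mix (weights α) μ) r₂ * (wordLength T g : ℝ)))) ∧
          omegaRestricted T (D.mix (weights α) μ) (Set.range (D.ι false)) r₂ =
            greenGrowthRate T (D.mix (weights α) μ) r₂ := by
  have hb0 : 0 < b := zero_lt_one.trans hb
  have hb'0 : 0 < b' := hb0.trans hbb
  have hℓ1 : ∀ i, ℓ i 1 = 0 := fun i => (hS i).one
  have hGb : GreenFinite (μ false) b := GreenFinite.mono (hμ false) hb0.le hbb.le hG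
  have hG₁ : GreenFinite (μ true) (1 / 2) :=
    (tsum_green_le_of_lt_one (hμ true) (hsum true) (by norm_num) (by norm_num)).1
  set g₀ : ℝ → ℝ := fun x => green (μ false) x 1 with hg₀
  set g₁ : ℝ → ℝ := fun x => green (μ true) x 1 with hg₁
  have hg₀1 : ∀ x ∈ Set.Icc (0 : ℝ) b, 1 ≤ g₀ x := fun x hx =>
    one_le_green_one (hμ false) hx.1 (GreenFinite.mono (hμ false) hx.1 hx.2 hGb)
  have hg₁1 : ∀ x ∈ Set.Icc (0 : ℝ) (1 / 2), 1 ≤ g₁ x := fun x hx =>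
    one_le_green_one (hμ true) hx.1 (GreenFinite.mono (hμ true) hx.1 hx.2 hG₁)
  set H : ℝ := b * g₀ b with hH
  have hHx : ∀ x ∈ Set.Icc (0 : ℝ) b, x * g₀ x ≤ H := fun x hx =>
    mul_le_mul hx.2 (green_mono (hμ false) hx.1 hx.2 hGb 1) (by linarith [hg₀1 x hx]) hb0.le
  have hH0 : 0 < H := mul_pos hb0 (by linarith [hg₀1 b ⟨hb0.le, le_rfl⟩])
  -- the letter sum of the first factor does not involve the second factor
  set A : ENNReal := letterSum (weight ℓ (fun i => hitting (μ i) (cond i 0 b)) s₀) false with hA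
  have hA' : ∀ y s, letterSum (weight ℓ (fun i => hitting (μ i) (cond i y b)) s) false =
      letterSum (weight ℓ (fun i => hitting (μ i) (cond i 0 b)) s) false := fun _ _ => rfl
  have hbfin : ∀ i, GreenFinite (μ i) (cond i 0 b) := by
    rintro (_ | _)
    · exact hGb
    · exact GreenFinite.mono (hμ true) le_rfl (by norm_num) hG₁
  have hb00 : ∀ i : Bool, 0 ≤ cond i 0 b := by rintro (_ | _); exacts [hb0.le, le_rfl]
  have hAtop : A ≠ ⊤ := (poincare_green_ne_top_iff hμ hb00 hbfin hℓ1 s₀ false).1 hconv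
  set K : ℝ := A.toReal with hK
  have hK0 : 0 ≤ K := ENNReal.toReal_nonneg
  have hgap : 0 < 1 / b - 1 / b' := sub_pos.2 (one_div_lt_one_div_of_lt hb0 hbb)
  obtain ⟨α₀, hα₀, hα₀1, hα₀2, hα₀3, hα₀4⟩ : ∃ α₀ : ℝ, 0 < α₀ ∧ α₀ ≤ 1 / 2 ∧
      4 * α₀ < 1 / b - 1 / b' ∧ 4 * H * α₀ ≤ 1 ∧ 4 * H * K * α₀ < 1 := by
    set a := min (1 / 2) (min ((1 / b - 1 / b') / 5)
      (min (1 / (4 * H)) (1 / (4 * H * K + 1)))) with ha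
    have e4 : 0 < 4 * H * K + 1 := by positivity
    have a1 : a ≤ 1 / 2 := min_le_left _ _
    have a2 : a ≤ (1 / b - 1 / b') / 5 := (min_le_right _ _).trans (min_le_left _ _)
    have a3 : a ≤ 1 / (4 * H) :=
      (min_le_right _ _).trans ((min_le_right _ _).trans (min_le_left _ _))
    have a4 : a ≤ 1 / (4 * H * K + 1) :=
      (min_le_right _ _).trans ((min_le_right _ _).trans (min_le_right _ _))
    have a0 : 0 < a := by positivity
    refine ⟨a, a0, a1, by linarith, ?_, ?_⟩
    · rw [le_div_iff₀ (by positivity)] at a3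
      linarith
    · rw [le_div_iff₀ e4] at a4
      nlinarith
  refine ⟨α₀, hα₀, by linarith, fun α hα hαle => ?_⟩
  have hα1 : α < 1 := by linarith
  have hα' : 1 / 2 ≤ 1 - α := by linarith
  have hα'0 : 0 < 1 - α := by linarith
  have hdiv2 : α / (1 - α) ≤ 2 * α := by
    rw [div_le_iff₀ hα'0]
    nlinarith
  have hsmall : ∀ x ∈ Set.Icc (0 : ℝ) b, α / (1 - α) * (x * g₀ x) ≤ 2 * α * H := fun x hx =>
    mul_le_mul hdiv2 (hHx x hx) (mul_nonneg hx.1 (by linarith [hg₀1 x hx])) (by positivity)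
  have hsmall' : 2 * α * H ≤ 1 / 2 := by nlinarith
  obtain ⟨r₁, r₂, hr1, hr12, hr2b, ⟨y₂, hrel₂⟩, hpar⟩ :=
    exists_paramRel (g₀ := g₀) (g₁ := g₁) hα hα1 hb (continuousOn_green (hμ false) hGb 1) hg₀1
      (continuousOn_green (hμ true) hG₁ 1)
      (fun x hx y hy hxy => green_mono (hμ true) hx.1 hxy
        (GreenFinite.mono (hμ true) hy.1 hy.2 hG₁) 1) hg₁1
      (fun x hx => green_one_mul_lt (hμ true) (hsum true) (hadm true) hx.1 (by linarith [hx.2]))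
      (fun x hx => (hsmall x hx).trans hsmall')
  have hr2 : 0 < r₂ := by linarith
  set t : ℝ := (1 - α) / b' + 2 * α with ht
  have ht0 : 0 < t := by positivity
  have htr : t < r₂⁻¹ := by
    refine lt_of_lt_of_le ?_ hr2b
    have e1 := mul_le_mul_of_nonneg_right hα' hgap.le
    rw [ht, div_eq_mul_one_div, div_eq_mul_one_div (1 - α) b]
    nlinarith
  have hrt : ∀ r, 0 < r → r ≤ r₂ → r * t < 1 := fun r hr hrr => by
    calc r * t ≤ r₂ * t := by gcongr
      _ < r₂ * r₂⁻¹ := mul_lt_mul_of_pos_left htr hr2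
      _ = 1 := mul_inv_cancel₀ hr2.ne'
  refine ⟨r₁, r₂, hr1, hr12, ?_, fun r hr hrle => ?_, ?_⟩
  · refine ((lt_inv_comm₀ ht0 hr2).1 htr).trans_le ?_
    have hζ0 : ∀ i, 0 < cond i (1 / 2) b' := by
      rintro (_ | _)
      exacts [hb'0, by norm_num]
    have hζG : ∀ i, GreenFinite (μ i) (cond i (1 / 2) b') := by
      rintro (_ | _)
      exacts [hG, hG₁]
    have hw := weights_pos hα hα1
    refine le_greenRadius (isFinMeasure_mix D (fun i => (hw i).le) hμ) ht0 zero_le_one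
      (fun g => ?_)
      (D.lconv_mix_hitting_le hμ (fun i => (hw i).le) hζ0 hζG (t := t) ?_)
      (D.mix_one_pos (fun i => (hw i).le) hμ (hw false) h1)
    · split_ifs with h
      · rw [h, D.ext_one, mul_one]
      · rw [one_mul]
        exact D.ext_nonneg (fun i x => hitting_nonneg (hμ i) (hζ0 i).le x) g
    · rw [Fintype.sum_bool]
      simp only [weights, cond_true, cond_false]
      linarith
  · obtain ⟨x, y, hx0, hx1, hrel⟩ := hpar r hr hrle
    obtain ⟨c, hc, hgreen⟩ := D.green_mix_of_paramRel hμ hα hα1 hx0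
      (hx1.trans (hb.trans hbb)).le hG hG₁ hr (hrt r hr (hrle.trans hr12.le)) hrel
    have hζ0 : ∀ i, 0 < cond i y x := by
      rintro (_ | _)
      exacts [hx0, hrel.1]
    have hζ1 : ∀ i, cond i y x < 1 := by
      rintro (_ | _)
      exacts [hx1, hrel.2.1.trans_lt (by norm_num)]
    have hζG : ∀ i, GreenFinite (μ i) (cond i y x) := fun i =>
      (tsum_green_le_of_lt_one (hμ i) (hsum i) (hζ0 i).le (hζ1 i)).1
    have hone : ∀ i, hitting (μ i) (cond i y x) 1 = 1 := fun i =>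
      hitting_one (hμ i) (hζ0 i).le (hζG i)
    have hiff := poincare_green_ne_top_iff hμ (fun i => (hζ0 i).le) hζG hℓ1
    obtain ⟨e1, e2⟩ := D.growth_lt_and_divergent hS hT hone
      (fun i => exists_pow_le_hitting (hμ i) (hζ0 i) (hζG i) (hadm i) (hS i)) hc
      (fun i s hs => by
        obtain ⟨δ, hδ, h⟩ := poincare_green_open (hμ i) (hsum i) (hS i) (hζ0 i) (hζ1 i)
          ((hiff s i).2 hs)
        exact ⟨δ, hδ, (hiff _ i).1 h⟩)
      (fun i => (hiff 0 i).1 (poincare_zero_ne_top (hμ i) (hsum i) (ℓ i) (hζ0 i).le (hζ1 i)))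
    rw [D.greenGrowthRate_eq_growth hS hT hgreen, D.summable_green_iff hS hT
      (fun i x => hitting_nonneg (hμ i) (hζ0 i).le x) hc.le hgreen]
    refine ⟨fun h => h e1, fun i => ?_⟩
    rw [D.omegaRestricted_eq_growth hS hT hone hgreen]
    exact e2 i
  · obtain ⟨c, hc, hgreen⟩ := D.green_mix_of_paramRel hμ hα hα1 hb0 hbb.le hG hG₁ hr2
      (hrt r₂ hr2 le_rfl) hrel₂
    obtain ⟨hy0, hy2, hyrel, -⟩ := hrel₂
    have hζ0 : ∀ i, 0 < cond i y₂ b := by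
      rintro (_ | _)
      exacts [hb0, hy0]
    have hζG : ∀ i, GreenFinite (μ i) (cond i y₂ b) := by
      rintro (_ | _)
      exacts [hGb, GreenFinite.mono (hμ true) hy0.le hy2 hG₁]
    have hone : ∀ i, hitting (μ i) (cond i y₂ b) 1 = 1 := fun i =>
      hitting_one (hμ i) (hζ0 i).le (hζG i)
    have hiff := poincare_green_ne_top_iff hμ (fun i => (hζ0 i).le) hζG hℓ1
    have hB := letterSum_hitting_le hμ (fun i => (hζ0 i).le) hζG hℓ1 hs₀.le (i := true)
      (hsum true) hy2
    simp only [cond_true] at hB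
    have hyH : y₂ ≤ 2 * α * H := by
      have e1 := hsmall b ⟨hb0.le, le_rfl⟩
      have e2 := hg₁1 y₂ ⟨hy0.le, hy2⟩
      have e3 : y₂ * 1 ≤ y₂ * g₁ y₂ := mul_le_mul_of_nonneg_left e2 hy0.le
      linarith
    obtain ⟨e1, e2⟩ := D.growth_eq_and_convergent hS hT hone
      (fun i => exists_pow_le_hitting (hμ i) (hζ0 i) (hζG i) (hadm i) (hS i)) hc (s₀ := s₀)
      (by
        rintro (_ | _)
        · exact (hiff s₀ false).1 hconv
        · exact ne_top_of_le_ne_top ENNReal.ofReal_ne_top hB)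
      (by
        rw [hA', ← hA, ← ENNReal.ofReal_toReal hAtop, ← hK]
        refine (mul_le_mul_right hB _).trans_lt ?_
        rw [← ENNReal.ofReal_mul hK0, ENNReal.ofReal_lt_one]
        have e3 := mul_le_mul_of_nonneg_left hyH hK0
        have e4 := mul_le_mul_of_nonneg_left hαle (by positivity : 0 ≤ 4 * H * K)
        nlinarith)
      (fun s hs => by
        by_contra h
        exact (hiff s false).2 h (hdiv s hs))
    rw [D.greenGrowthRate_eq_growth hS hT hgreen, D.summable_green_iff hS hT
      (fun i x => hitting_nonneg (hμ i) (hζ0 i).le x) hc.le hgreen,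
      D.omegaRestricted_eq_growth hS hT hone hgreen]
    exact ⟨e1, e2⟩

end Splitting

end

section

variable {n m d : ℕ} {α₁ α₂ : ℝ}

/-- The two measures on the free factors of `(F_n × F_m) ∗ ℤ^d`. -/
noncomputable def factorMu (n m d : ℕ) (α₁ α₂ : ℝ) (μ₁ : Multiplicative (Fin d → ℤ) → ℝ) :
    ∀ i, Factor (BiFree n m) (Multiplicative (Fin d → ℤ)) i → ℝ
  | false => biFreeMu n m α₁ α₂
  | true => μ₁

/-- The generating sets of the free factors of `(F_n × F_m) ∗ ℤ^d`. -/
noncomputable def factorGens (n m d : ℕ) (S₁ : Finset (Multiplicative (Fin d → ℤ))) :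
    ∀ i, Finset (Factor (BiFree n m) (Multiplicative (Fin d → ℤ)) i)
  | false => biFreeGens n m
  | true => S₁

/-- The word lengths on the free factors of `(F_n × F_m) ∗ ℤ^d`. -/
noncomputable def factorLength (n m d : ℕ) (S₁ : Finset (Multiplicative (Fin d → ℤ))) :
    ∀ i, Factor (BiFree n m) (Multiplicative (Fin d → ℤ)) i → ℕ
  | false => fun z => FreeGroup.norm z.1 + FreeGroup.norm z.2
  | true => wordLength S₁

lemma coe_freeProdGens (S₁ : Finset (Multiplicative (Fin d → ℤ))) :
    (freeProdGens n m d S₁ : Set (FreeProdGroup n m d)) =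
      ⋃ i, (coprodSplitting (BiFree n m) (Multiplicative (Fin d → ℤ))).ι i ''
        (factorGens n m d S₁ i) := by
  rw [freeProdGens, Finset.coe_union, Finset.coe_image, Finset.coe_image, Set.union_comm,
    Set.union_eq_iUnion]
  refine Set.iUnion_congr ?_
  rintro (_ | _) <;> rfl

lemma freeProdMu_eq_mix (μ₁ : Multiplicative (Fin d → ℤ) → ℝ) (α : ℝ) :
    freeProdMu n m d α₁ α₂ μ₁ α =
      (coprodSplitting (BiFree n m) (Multiplicative (Fin d → ℤ))).mix (Splitting.weights α)
        (factorMu n m d α₁ α₂ μ₁) := by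
  funext g
  rw [Splitting.mix, Fintype.sum_bool]
  rfl

end

/-- For `Γ = (F_n × F_m) ∗ ℤ^d` (`n ≠ m`, `n,m ≥ 2`, `d ≥ 3`) and
`μ_α = α μ₁ + (1−α) μ₀`, if `α` is small enough then there exist
`1 < r_* < r_♯ < R_α` such that: for `0 < r ≤ r_*` the Poincaré series
`Θ_Γ(r, ω_Γ(r))` diverges and `ω_{Γ₀}(r) < ω_Γ(r)`, `ω_{Γ₁}(r) < ω_Γ(r)`
(parabolic gap); while at `r = r_♯` the series `Θ_Γ(r_♯, ω_Γ(r_♯))` converges and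
`ω_{Γ₀}(r_♯) = ω_Γ(r_♯)`. -/
theorem freeProd_poincare_convergence_phase (n m : ℕ) (hn : 2 ≤ n) (hm : 2 ≤ m)
    (hnm : n ≠ m) (α₁ α₂ : ℝ) (hα₁ : 0 < α₁) (hα₂ : 0 < α₂) (hα : α₁ + α₂ = 1)
    (d : ℕ) (hd : 3 ≤ d)
    (μ₁ : Multiplicative (Fin d → ℤ) → ℝ) (S₁ : Finset (Multiplicative (Fin d → ℤ)))
    (hS₁ : Subgroup.closure (S₁ : Set (Multiplicative (Fin d → ℤ))) = ⊤)
    (hprob₁ : IsProbMeasure μ₁) (hsymm₁ : IsSymm μ₁) (hadm₁ : IsAdmissible μ₁)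
    (hfin₁ : (Function.support μ₁).Finite) :
    ∃ α₀ : ℝ, 0 < α₀ ∧ α₀ < 1 ∧ ∀ α : ℝ, 0 < α → α ≤ α₀ →
      ∃ rstar rsharp : ℝ, 1 < rstar ∧ rstar < rsharp ∧
        rsharp < greenRadius (freeProdMu n m d α₁ α₂ μ₁ α) ∧
        (∀ r : ℝ, 0 < r → r ≤ rstar →
          (¬ Summable (fun x : FreeProdGroup n m d =>
            green (freeProdMu n m d α₁ α₂ μ₁ α) r x *
              Real.exp (-(greenGrowthRate (freeProdGens n m d S₁)
                  (freeProdMu n m d α₁ α₂ μ₁ α) r) *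
                (wordLength (freeProdGens n m d S₁) x : ℝ)))) ∧
          omegaRestricted (freeProdGens n m d S₁) (freeProdMu n m d α₁ α₂ μ₁ α)
              (Set.range fun x : BiFree n m => (Monoid.Coprod.inl x : FreeProdGroup n m d)) r <
            greenGrowthRate (freeProdGens n m d S₁) (freeProdMu n m d α₁ α₂ μ₁ α) r ∧
          omegaRestricted (freeProdGens n m d S₁) (freeProdMu n m d α₁ α₂ μ₁ α)
              (Set.range fun x : Multiplicative (Fin d → ℤ) =>
                (Monoid.Coprod.inr x : FreeProdGroup n m d)) r <
            greenGrowthRate (freeProdGens n m d S₁) (freeProdMu n m d α₁ α₂ μ₁ α) r) ∧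
        (Summable (fun x : FreeProdGroup n m d =>
            green (freeProdMu n m d α₁ α₂ μ₁ α) rsharp x *
              Real.exp (-(greenGrowthRate (freeProdGens n m d S₁)
                  (freeProdMu n m d α₁ α₂ μ₁ α) rsharp) *
                (wordLength (freeProdGens n m d S₁) x : ℝ))) ∧
          omegaRestricted (freeProdGens n m d S₁) (freeProdMu n m d α₁ α₂ μ₁ α)
              (Set.range fun x : BiFree n m => (Monoid.Coprod.inl x : FreeProdGroup n m d))
              rsharp =
            greenGrowthRate (freeProdGens n m d S₁) (freeProdMu n m d α₁ α₂ μ₁ α)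
              rsharp) := by
  have hinf : ∀ i, Infinite (Factor (BiFree n m) (Multiplicative (Fin d → ℤ)) i) := by
    rintro (_ | _)
    · have : Nonempty (Fin n) := ⟨⟨0, by omega⟩⟩
      exact inferInstanceAs (Infinite (BiFree n m))
    · have : Nonempty (Fin d) := ⟨⟨0, by omega⟩⟩
      exact inferInstanceAs (Infinite (Multiplicative (Fin d → ℤ)))
  obtain ⟨b, b', s₀, hb, hbb, hG, hs₀, hconv, hdiv⟩ :=
    biFree_exists_convergent hn hm hnm hα₁ hα₂ hα
  obtain ⟨α₀, h0, h1, h⟩ := (coprodSplitting (BiFree n m)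
    (Multiplicative (Fin d → ℤ))).exists_phase (ℓ := factorLength n m d S₁)
      (S := factorGens n m d S₁) (T := freeProdGens n m d S₁)
      (μ := factorMu n m d α₁ α₂ μ₁)
    (by
      rintro (_ | _)
      exacts [isLength_biFreeGens, isLength_wordLength hS₁])
    (coe_freeProdGens S₁)
    (by
      rintro (_ | _)
      exacts [isFinMeasure_biFreeMu hα₁.le hα₂.le, ⟨hprob₁.1, hfin₁⟩])
    (by
      rintro (_ | _)
      exacts [tsum_biFreeMu (by omega) (by omega) hα, hprob₁.2.tsum_eq])
    (by
      rintro (_ | _)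
      exacts [isAdmissible_biFreeMu (by omega) (by omega) hα₁ hα₂, hadm₁])
    (biFreeMu_one_pos hα₁ hα₂) hb hbb hG hs₀ hconv hdiv
  refine ⟨α₀, h0, h1, fun α hα hle => ?_⟩
  obtain ⟨r₁, r₂, h2, h3, h4, h5, h6⟩ := h α hα hle
  simp only [freeProdMu_eq_mix, neg_mul]
  exact ⟨r₁, r₂, h2, h3, h4, fun r hr hrr =>
    ⟨(h5 r hr hrr).1, (h5 r hr hrr).2 false, (h5 r hr hrr).2 true⟩, h6⟩

end GreenGrowth
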